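/- arXiv:1207.0274 — 5 statements merged into one kernel-verified Lean document; each statement's English description precedes it below -/
import Mathlib

section
/- Let r, D be positive integers with 2rD square-free, d an odd divisor of rD, and t an odd prime dividing rD/d. Then the equation W^2 = d + (8rD/d)·Z^4 has a solution in Q_t if and only if d is a quadratic residue modulo t. -/
namespace Padic

variable {p : ℕ} [Fact p.Prime]

/-- For odd `p`, an integer prime to `p` that is a square modulo `p` is a square in `ℤ_[p]`. -/
theorem exists_sq_eq_intCast_of_isSquare_zmod (hp : p ≠ 2) {d : ℤ} (hd : ¬ (p : ℤ) ∣ d)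
    (hsq : IsSquare (d : ZMod p)) : ∃ w : ℤ_[p], w ^ 2 = d := by
  obtain ⟨b, hb⟩ := hsq
  obtain ⟨a, rfl⟩ := ZMod.intCast_surjective b
  have hdvd : (p : ℤ) ∣ a ^ 2 - d := by
    rw [← ZMod.intCast_zmod_eq_zero_iff_dvd _ p]
    push_cast
    rw [hb]
    ring
  have hprime : Prime (p : ℤ) := Nat.prime_iff_prime_int.mp Fact.out
  have hder : ¬ (p : ℤ) ∣ 2 * a := by
    intro h
    rcases hprime.dvd_or_dvd h with h | h
    · have h2 : p ∣ 2 := by exact_mod_cast h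
      exact hp ((Nat.prime_dvd_prime_iff_eq Fact.out Nat.prime_two).mp h2)
    · exact hd ((dvd_sub_right (dvd_pow h two_ne_zero)).mp hdvd)
  have hone : ‖((2 * a : ℤ) : ℤ_[p])‖ = 1 :=
    le_antisymm (PadicInt.norm_le_one _)
      (not_lt.mp fun h => hder ((PadicInt.norm_int_lt_one_iff_dvd _).mp h))
  have hlt : ‖((a ^ 2 - d : ℤ) : ℤ_[p])‖ < 1 := (PadicInt.norm_int_lt_one_iff_dvd _).mpr hdvd
  push_cast at hone hlt
  obtain ⟨w, hw, -⟩ := hensels_lemma (p := p)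
    (F := (Polynomial.X ^ 2 - Polynomial.C (d : ℤ_[p]) : Polynomial ℤ_[p])) (a := (a : ℤ_[p]))
    (by simpa [Polynomial.derivative_X_pow, one_add_one_eq_two, hone] using hlt)
  refine ⟨w, ?_⟩
  simpa [sub_eq_zero] using hw

/-- If the integer `c` is exactly divisible by `p`, then `z` is integral for any solution of
`w ^ 2 = d + c * z ^ 4` over `ℚ_[p]`. -/
theorem norm_le_one_of_sq_eq_add_mul_pow_four {d c : ℤ} (hc : ‖(c : ℚ_[p])‖ = (p : ℝ)⁻¹)
    {z w : ℚ_[p]} (h : w ^ 2 = d + c * z ^ 4) : ‖z‖ ≤ 1 := by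
  by_contra! hz
  have hp1 : (1 : ℝ) < p := by exact_mod_cast (Fact.out : p.Prime).one_lt
  have hp0 : (p : ℝ) ≠ 0 := by positivity
  have hz0 : z ≠ 0 := by
    rintro rfl
    rw [norm_zero] at hz
    linarith
  have hnz := Padic.norm_eq_zpow_neg_valuation hz0
  have hcz : ‖(c : ℚ_[p]) * z ^ 4‖ = (p : ℝ) ^ (-1 - 4 * z.valuation) := by
    rw [norm_mul, norm_pow, hc, hnz, ← zpow_neg_one, ← zpow_natCast, ← zpow_mul,
      ← zpow_add₀ hp0]
    congr 1
    push_cast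
    ring
  have hv : z.valuation < 0 := by
    rw [hnz, one_lt_zpow_iff_right₀ hp1] at hz
    omega
  have hgt : 1 < ‖(c : ℚ_[p]) * z ^ 4‖ := by
    rw [hcz, one_lt_zpow_iff_right₀ hp1]
    omega
  have hd : ‖(d : ℚ_[p])‖ < ‖(c : ℚ_[p]) * z ^ 4‖ := (Padic.norm_int_le_one d).trans_lt hgt
  have hw : ‖w‖ ^ 2 = (p : ℝ) ^ (-1 - 4 * z.valuation) := by
    rw [← norm_pow, h, Padic.add_eq_max_of_ne hd.ne, max_eq_right hd.le, hcz]
  have hw0 : w ≠ 0 := by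
    rintro rfl
    rw [← hcz, norm_zero, zero_pow two_ne_zero] at hw
    linarith
  rw [Padic.norm_eq_zpow_neg_valuation hw0, ← zpow_natCast, ← zpow_mul] at hw
  have := zpow_right_injective₀ (by positivity) hp1.ne' hw
  push_cast at this
  omega

/-- Solvability of `w ^ 2 = d + c * z ^ 4` over `ℚ_[p]` when `p` is odd, prime to `d`, and divides
`c` exactly once. -/
theorem exists_sq_eq_add_mul_pow_four_iff (hp : p ≠ 2) {d c : ℤ} (hd : ¬ (p : ℤ) ∣ d)
    (hpc : (p : ℤ) ∣ c) (hpc' : ¬ (p : ℤ) ^ 2 ∣ c) :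
    (∃ z w : ℚ_[p], w ^ 2 = d + c * z ^ 4) ↔ IsSquare (d : ZMod p) := by
  constructor
  · rintro ⟨z, w, h⟩
    have hc : ‖(c : ℚ_[p])‖ = (p : ℝ)⁻¹ := by
      obtain ⟨k, rfl⟩ := hpc
      have hk : ¬ (p : ℤ) ∣ k := fun hk => hpc' (by rw [sq]; exact mul_dvd_mul_left _ hk)
      have hk1 : ‖(k : ℚ_[p])‖ = 1 :=
        le_antisymm (Padic.norm_int_le_one k)
          (not_lt.mp fun h => hk ((Padic.norm_intCast_lt_one_iff).mp h))
      rw [Int.cast_mul, norm_mul, hk1, Int.cast_natCast, Padic.norm_p, mul_one]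
    have hz := norm_le_one_of_sq_eq_add_mul_pow_four hc h
    obtain ⟨z, rfl⟩ : ∃ y : ℤ_[p], (y : ℚ_[p]) = z := ⟨⟨z, hz⟩, rfl⟩
    have hcoe : w ^ 2 = (((d : ℤ_[p]) + c * z ^ 4 : ℤ_[p]) : ℚ_[p]) := by
      rw [h, PadicInt.coe_add, PadicInt.coe_mul, PadicInt.coe_pow, PadicInt.coe_intCast,
        PadicInt.coe_intCast]
    have hw : ‖w‖ ≤ 1 := by
      rw [← sq_le_one_iff₀ (norm_nonneg w), ← norm_pow, hcoe]
      exact PadicInt.norm_le_one _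
    obtain ⟨w, rfl⟩ : ∃ y : ℤ_[p], (y : ℚ_[p]) = w := ⟨⟨w, hw⟩, rfl⟩
    rw [← PadicInt.coe_pow] at hcoe
    have h' : w ^ 2 = (d : ℤ_[p]) + c * z ^ 4 := Subtype.ext hcoe
    have hmod := congrArg (PadicInt.toZMod (p := p)) h'
    rw [map_add, map_mul, map_intCast, map_intCast,
      (ZMod.intCast_zmod_eq_zero_iff_dvd c p).mpr hpc, zero_mul, add_zero, map_pow] at hmod
    exact ⟨_, by rw [← hmod, sq]⟩
  · intro hsq
    obtain ⟨w, hw⟩ := exists_sq_eq_intCast_of_isSquare_zmod hp hd hsq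
    exact ⟨0, w, by simpa using congrArg ((↑) : ℤ_[p] → ℚ_[p]) hw⟩

end Padic

/-- For `2rD` square-free, `d` an odd divisor of `rD` and `t` an odd prime dividing `rD/d`,
the homogeneous space `W² = d + (8rD/d)·Z⁴` has a `ℚ_t`-point iff `d` is a quadratic
residue modulo `t`. -/
theorem stmt_2 (r D : ℕ) (hr : 0 < r) (hD : 0 < D)
    (hsf : Squarefree (2 * r * D)) (d : ℤ) (hdvd : d ∣ (r * D : ℤ)) (hodd : Odd d)
    (t : ℕ) [ht : Fact t.Prime] (htodd : t ≠ 2) (htdvd : (t : ℤ) ∣ (r * D : ℤ) / d) :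
    (∃ z w : ℚ_[t], w ^ 2 = (d : ℚ_[t]) + ((8 * r * D / d : ℤ) : ℚ_[t]) * z ^ 4) ↔
      IsSquare (d : ZMod t) := by
  have hprime : Prime (t : ℤ) := Nat.prime_iff_prime_int.mp ht.out
  have hsf' : ¬ (t : ℤ) * t ∣ r * D := by
    intro h
    have h' : t * t ∣ r * D := by exact_mod_cast h
    exact ht.out.not_isUnit (hsf t (by rw [mul_assoc]; exact h'.mul_left 2))
  obtain ⟨e, he⟩ := hdvd
  have hd0 : d ≠ 0 := by
    rintro rfl
    simp at hodd
  rw [he, Int.mul_ediv_cancel_left _ hd0] at htdvd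
  have hc : (8 * r * D / d : ℤ) = 8 * e := by
    rw [mul_assoc, he, mul_left_comm, Int.mul_ediv_cancel_left _ hd0]
  rw [hc]
  refine Padic.exists_sq_eq_add_mul_pow_four_iff htodd ?_ (htdvd.mul_left 8) ?_
  · intro h
    exact hsf' (he ▸ mul_dvd_mul h htdvd)
  · intro h
    have hcop : IsCoprime ((t : ℤ) ^ 2) 8 := by
      have : Nat.Coprime (t ^ 2) (2 ^ 3) :=
        Nat.Coprime.pow 2 3 ((Nat.coprime_primes ht.out Nat.prime_two).mpr htodd)
      exact_mod_cast Nat.isCoprime_iff_coprime.mpr this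
    have he2 := hcop.dvd_of_dvd_mul_left h
    rw [sq] at he2
    exact hsf' (he ▸ he2.mul_left d)
end

section
/- Let r, D be positive integers with 2rD square-free, d an odd divisor of rD, and t an odd prime dividing rD/d. Then the equation W^2 = d - (2rD/d)·Z^4 has a solution in Q_t if and only if d is a quadratic residue modulo t. -/
/-- An integer coprime to the odd prime `p` that is a square modulo `p` is a `p`-adic square. -/
lemma PadicInt.exists_sq_eq_intCast {p : ℕ} [Fact p.Prime] (hp : p ≠ 2) {d : ℤ}
    (hd : ¬ (p : ℤ) ∣ d) (h : IsSquare (d : ZMod p)) : ∃ w : ℤ_[p], w ^ 2 = d := by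
  obtain ⟨b, hb⟩ := h
  obtain ⟨a, rfl⟩ := ZMod.intCast_surjective b
  have hdvd : (p : ℤ) ∣ a ^ 2 - d := by
    rw [← ZMod.intCast_zmod_eq_zero_iff_dvd]
    push_cast
    rw [hb]
    ring
  have hpp : Prime (p : ℤ) := Nat.prime_iff_prime_int.mp Fact.out
  have hndvd : ¬ (p : ℤ) ∣ 2 * a := by
    intro h2
    rcases hpp.dvd_or_dvd h2 with h2 | h2
    · exact hp ((Nat.prime_dvd_prime_iff_eq Fact.out Nat.prime_two).mp (by exact_mod_cast h2))
    · exact hd ((dvd_sub_right (dvd_pow h2 two_ne_zero)).mp hdvd)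
  have hone : ‖((2 * a : ℤ) : ℤ_[p])‖ = 1 :=
    le_antisymm (PadicInt.norm_le_one _)
      (not_lt.mp fun hlt => hndvd ((PadicInt.norm_int_lt_one_iff_dvd _).mp hlt))
  have hlt : ‖((a ^ 2 - d : ℤ) : ℤ_[p])‖ < 1 := (PadicInt.norm_int_lt_one_iff_dvd _).mpr hdvd
  push_cast at hone hlt
  obtain ⟨w, hw, -⟩ := hensels_lemma
    (F := (Polynomial.X ^ 2 - Polynomial.C (d : ℤ_[p]) : Polynomial ℤ_[p])) (a := (a : ℤ_[p]))
    (by simpa [one_add_one_eq_two, hone] using hlt)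
  exact ⟨w, by simpa [sub_eq_zero] using hw⟩

/-- If `p` does not divide `m`, then in any `p`-adic point of
`w² = d - p m z⁴` the coordinate `z` is integral. -/
lemma Padic.norm_le_one_of_sq_eq_sub_mul_pow_four {p : ℕ} [Fact p.Prime] {d m : ℤ}
    (hm : ¬ (p : ℤ) ∣ m) {z w : ℚ_[p]}
    (h : w ^ 2 = (d : ℚ_[p]) - ((p * m : ℤ) : ℚ_[p]) * z ^ 4) : ‖z‖ ≤ 1 := by
  by_contra! hz
  have hp1 : (1 : ℝ) < p := by exact_mod_cast (Fact.out : p.Prime).one_lt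
  have hp0 : (0 : ℝ) < p := by linarith
  have hz0 : z ≠ 0 := by rintro rfl; simp at hz; linarith
  have hm1 : ‖(m : ℚ_[p])‖ = 1 :=
    le_antisymm (Padic.norm_int_le_one _)
      (not_lt.mp fun hlt => hm ((Padic.norm_intCast_lt_one_iff).mp hlt))
  have hnz := Padic.norm_eq_zpow_neg_valuation hz0
  have hv : z.valuation < 0 := by
    rw [hnz, one_lt_zpow_iff_right₀ hp1] at hz
    omega
  have hterm : ‖((p * m : ℤ) : ℚ_[p]) * z ^ 4‖ = (p : ℝ) ^ (-1 - 4 * z.valuation) := by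
    push_cast
    rw [norm_mul, norm_mul, norm_pow, hm1, Padic.norm_p, hnz, ← zpow_natCast, ← zpow_mul,
      mul_one, ← zpow_neg_one, ← zpow_add₀ hp0.ne']
    congr 1
    push_cast
    ring
  have hbig : 1 < ‖((p * m : ℤ) : ℚ_[p]) * z ^ 4‖ := by
    rw [hterm, one_lt_zpow_iff_right₀ hp1]
    omega
  have hd1 : ‖(d : ℚ_[p])‖ ≤ 1 := Padic.norm_int_le_one _
  have hw : ‖w‖ ^ 2 = (p : ℝ) ^ (-1 - 4 * z.valuation) := by
    rw [← norm_pow, h, sub_eq_add_neg, Padic.add_eq_max_of_ne (by rw [norm_neg]; linarith),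
      norm_neg, max_eq_right (by linarith), hterm]
  have hw0 : w ≠ 0 := by
    rintro rfl
    rw [← hterm] at hw
    simp only [norm_zero] at hw
    linarith
  rw [Padic.norm_eq_zpow_neg_valuation hw0, ← zpow_natCast, ← zpow_mul] at hw
  have := zpow_right_injective₀ hp0 hp1.ne' hw
  push_cast at this
  omega

/-- For `2rD` square-free, `d` an odd divisor of `rD` and `t` an odd prime dividing `rD/d`,
the homogeneous space `W² = d - (2rD/d)·Z⁴` has a `ℚ_t`-point iff `d` is a quadratic
residue modulo `t`. -/
theorem stmt_4 (r D : ℕ) (hr : 0 < r) (hD : 0 < D)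
    (hsf : Squarefree (2 * r * D)) (d : ℤ) (hdvd : d ∣ (r * D : ℤ)) (hodd : Odd d)
    (t : ℕ) [ht : Fact t.Prime] (htodd : t ≠ 2) (htdvd : (t : ℤ) ∣ (r * D : ℤ) / d) :
    (∃ z w : ℚ_[t], w ^ 2 = (d : ℚ_[t]) - ((2 * r * D / d : ℤ) : ℚ_[t]) * z ^ 4) ↔
      IsSquare (d : ZMod t) := by
  obtain ⟨k, hk⟩ := hdvd
  have hd0 : d ≠ 0 := by rintro rfl; simp at hodd
  rw [hk, Int.mul_ediv_cancel_left _ hd0] at htdvd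
  obtain ⟨n, rfl⟩ := htdvd
  have hprod : (2 * r * D : ℤ) = d * (t * (2 * n)) := by rw [mul_assoc, hk]; ring
  have hsfz : Squarefree (d * (t * (2 * n))) := by
    rw [← hprod]
    exact_mod_cast Int.squarefree_natCast.mpr hsf
  have htp : Prime (t : ℤ) := Nat.prime_iff_prime_int.mp Fact.out
  have htd : ¬ (t : ℤ) ∣ d := fun ⟨c, hc⟩ =>
    htp.not_isUnit (hsfz t ⟨c * (2 * n), by rw [hc]; ring⟩)
  have htn : ¬ (t : ℤ) ∣ 2 * n := fun ⟨c, hc⟩ =>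
    htp.not_isUnit (hsfz t ⟨d * c, by rw [hc]; ring⟩)
  rw [hprod, Int.mul_ediv_cancel_left _ hd0]
  constructor
  · rintro ⟨z, w, h⟩
    have hz := Padic.norm_le_one_of_sq_eq_sub_mul_pow_four htn h
    obtain ⟨z, rfl⟩ : ∃ x : ℤ_[t], (x : ℚ_[t]) = z := ⟨⟨z, hz⟩, rfl⟩
    have hcoe : w ^ 2 =
        (((d : ℤ_[t]) - ((t * (2 * n) : ℤ) : ℤ_[t]) * z ^ 4 : ℤ_[t]) : ℚ_[t]) := by
      rw [h, PadicInt.coe_sub, PadicInt.coe_mul, PadicInt.coe_pow, PadicInt.coe_intCast,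
        PadicInt.coe_intCast]
    have hw : ‖w‖ ≤ 1 := by
      rw [← pow_le_one_iff_of_nonneg (norm_nonneg _) two_ne_zero, ← norm_pow, hcoe]
      exact PadicInt.norm_le_one _
    obtain ⟨w, rfl⟩ : ∃ x : ℤ_[t], (x : ℚ_[t]) = w := ⟨⟨w, hw⟩, rfl⟩
    rw [← PadicInt.coe_pow] at hcoe
    have heq := Subtype.coe_injective hcoe
    have hmod := congrArg PadicInt.toZMod heq
    simp at hmod
    exact ⟨PadicInt.toZMod w, by rw [← hmod, sq]⟩
  · intro h
    obtain ⟨w, hw⟩ := PadicInt.exists_sq_eq_intCast htodd htd h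
    refine ⟨0, w, ?_⟩
    rw [zero_pow four_ne_zero, mul_zero, sub_zero]
    exact_mod_cast congrArg (fun x : ℤ_[t] => (x : ℚ_[t])) hw
end

section
/- Let r, D be positive integers with 2rD square-free, d an odd divisor of rD, and l an odd prime dividing d. Then the equation W^2 = d - (2rD/d)·Z^4 has a solution in Q_l if and only if -2rD/d is a quadratic residue modulo l. -/
/-- An integer prime to `l` that is a nonzero square mod an odd prime `l` is a square in `ℚ_[l]`. -/
theorem exists_padic_sq_eq_of_isSquare (l : ℕ) [Fact l.Prime] (hl : l ≠ 2) (a : ℤ)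
    (ha : ¬ (l : ℤ) ∣ a) (h : IsSquare (a : ZMod l)) : ∃ w : ℚ_[l], w ^ 2 = a := by
  obtain ⟨t, ht⟩ := h
  obtain ⟨s, rfl⟩ := ZMod.intCast_surjective t
  have hdvd : (l : ℤ) ∣ s ^ 2 - a := by
    rw [← ZMod.intCast_zmod_eq_zero_iff_dvd]
    push_cast
    rw [ht]; ring
  have hprime : Prime (l : ℤ) := Nat.prime_iff_prime_int.mp Fact.out
  have h2s : ¬ (l : ℤ) ∣ 2 * s := by
    intro hd
    rcases hprime.dvd_or_dvd hd with h2 | hs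
    · have h2' : l ∣ 2 := by exact_mod_cast h2
      exact hl ((Nat.prime_dvd_prime_iff_eq Fact.out Nat.prime_two).mp h2')
    · apply ha
      have := dvd_sub (dvd_pow hs two_ne_zero) hdvd
      simpa using this
  have hder : ‖((2 * s : ℤ) : ℤ_[l])‖ = 1 := by
    refine le_antisymm (PadicInt.norm_le_one _) (not_lt.mp ?_)
    rwa [PadicInt.norm_int_lt_one_iff_dvd]
  have hval : ‖((s ^ 2 - a : ℤ) : ℤ_[l])‖ < 1 := by
    rwa [PadicInt.norm_int_lt_one_iff_dvd]
  push_cast at hder hval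
  obtain ⟨w, hw, -⟩ := hensels_lemma (p := l) (R := ℤ_[l])
    (F := Polynomial.X ^ 2 - Polynomial.C (a : ℤ_[l])) (a := (s : ℤ_[l]))
    (by simpa [one_add_one_eq_two, ← norm_mul, hder] using hval)
  refine ⟨w, ?_⟩
  have hw' : w ^ 2 = (a : ℤ_[l]) := by simpa [sub_eq_zero] using hw
  exact_mod_cast congrArg (fun x : ℤ_[l] => (x : ℚ_[l])) hw'

/-- An integer congruent to a square of `ℚ_[l]` modulo the maximal ideal is a square mod `l`. -/
theorem isSquare_of_norm_sq_sub_lt_one (l : ℕ) [Fact l.Prime] (a : ℤ) (u : ℚ_[l])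
    (h : ‖u ^ 2 - a‖ < 1) : IsSquare (a : ZMod l) := by
  have hu : ‖u‖ ≤ 1 := by
    have h1 : ‖u ^ 2‖ ≤ 1 := by
      have := Padic.nonarchimedean (u ^ 2 - (a : ℚ_[l])) (a : ℚ_[l])
      rw [sub_add_cancel] at this
      exact this.trans (max_le h.le (Padic.norm_int_le_one a))
    rw [norm_pow] at h1
    exact (pow_le_one_iff_of_nonneg (norm_nonneg u) two_ne_zero).mp h1
  obtain ⟨u, rfl⟩ : ∃ v : ℤ_[l], (v : ℚ_[l]) = u := ⟨⟨u, hu⟩, rfl⟩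
  have hmem : u ^ 2 - (a : ℤ_[l]) ∈ RingHom.ker (PadicInt.toZMod (p := l)) := by
    rw [PadicInt.ker_toZMod, IsLocalRing.mem_maximalIdeal, PadicInt.mem_nonunits,
      PadicInt.norm_def]
    exact_mod_cast h
  rw [RingHom.mem_ker, map_sub, map_pow, map_intCast, sub_eq_zero] at hmem
  exact ⟨PadicInt.toZMod u, by rw [← hmem, sq]⟩

theorem norm_sq_ne_inv_prime (l : ℕ) [hl : Fact l.Prime] (w : ℚ_[l]) :
    ‖w ^ 2‖ ≠ (l : ℝ)⁻¹ := by
  have hl1 : (1 : ℝ) < l := by exact_mod_cast hl.out.one_lt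
  intro h
  have hw : w ≠ 0 := by
    rintro rfl
    simp only [ne_eq, OfNat.ofNat_ne_zero, not_false_eq_true, zero_pow, norm_zero] at h
    exact absurd h (by positivity)
  rw [norm_pow, Padic.norm_eq_zpow_neg_valuation hw, ← zpow_natCast, ← zpow_mul,
    ← zpow_neg_one] at h
  have := zpow_right_injective₀ (by positivity) hl1.ne' h
  push_cast at this
  omega

/-- For `2rD` square-free, `d` an odd divisor of `rD` and `l` an odd prime dividing `d`,
the homogeneous space `W² = d - (2rD/d)·Z⁴` has a `ℚ_l`-point iff `-2rD/d` is a quadratic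
residue modulo `l`. -/
theorem stmt_5 (r D : ℕ) (hr : 0 < r) (hD : 0 < D)
    (hsf : Squarefree (2 * r * D)) (d : ℤ) (hdvd : d ∣ (r * D : ℤ)) (hodd : Odd d)
    (l : ℕ) [hl : Fact l.Prime] (hlodd : l ≠ 2) (hldvd : (l : ℤ) ∣ d) :
    (∃ z w : ℚ_[l], w ^ 2 = (d : ℚ_[l]) - ((2 * r * D / d : ℤ) : ℚ_[l]) * z ^ 4) ↔
      IsSquare ((-(2 * r * D) / d : ℤ) : ZMod l) := by
  have hdm : d ∣ 2 * r * D := by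
    rw [mul_assoc]; exact hdvd.mul_left 2
  rw [Int.neg_ediv_of_dvd hdm]
  obtain ⟨m, hm⟩ := hdm
  obtain ⟨e, rfl⟩ := hldvd
  have hd0 : (l : ℤ) * e ≠ 0 := by
    rintro h
    simp [h] at hodd
  rw [hm, Int.mul_ediv_cancel_left _ hd0]
  have hnot : ¬ (l : ℤ) ∣ e * m := by
    rintro ⟨k, hk⟩
    have hll : (l : ℤ) * l ∣ 2 * r * D := ⟨k, by rw [hm, mul_assoc, hk]; ring⟩
    have := hsf l (by exact_mod_cast hll)
    exact hl.out.one_lt.ne' (Nat.isUnit_iff.mp this)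
  have hne : ¬ (l : ℤ) ∣ e := fun h => hnot (h.mul_right m)
  have hnm : ¬ (l : ℤ) ∣ m := fun h => hnot (h.mul_left e)
  have norm_one : ∀ {a : ℤ}, ¬ (l : ℤ) ∣ a → ‖(a : ℚ_[l])‖ = 1 := fun {a} ha =>
    le_antisymm (Padic.norm_int_le_one a)
      (not_lt.mp fun h => ha (Padic.norm_intCast_lt_one_iff.mp h))
  have hl1 : (1 : ℝ) < l := by exact_mod_cast hl.out.one_lt
  have hd : ‖((l * e : ℤ) : ℚ_[l])‖ = (l : ℝ)⁻¹ := by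
    push_cast
    rw [norm_mul, norm_one hne, Padic.norm_p, mul_one]
  constructor
  · rintro ⟨z, w, h⟩
    rcases lt_or_ge ‖z‖ 1 with hz | hz
    · exfalso
      have hz' : ‖z‖ ≤ (l : ℝ)⁻¹ := by
        simpa using (Padic.norm_le_pow_iff_norm_lt_pow_add_one z (-1)).mpr (by simpa using hz)
      have hlt : ‖(m : ℚ_[l]) * z ^ 4‖ < ‖((l * e : ℤ) : ℚ_[l])‖ := by
        rw [hd, norm_mul, norm_one hnm, one_mul, norm_pow]
        calc ‖z‖ ^ 4 ≤ ((l : ℝ)⁻¹) ^ 4 := by gcongr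
          _ < (l : ℝ)⁻¹ :=
            pow_lt_self_of_lt_one₀ (by positivity) (inv_lt_one_of_one_lt₀ hl1) (by norm_num)
      apply norm_sq_ne_inv_prime l w
      rw [← norm_neg (_ * _)] at hlt
      rw [h, sub_eq_add_neg, Padic.add_eq_max_of_ne hlt.ne', max_eq_left hlt.le, hd]
    · apply isSquare_of_norm_sq_sub_lt_one l (-m) (w / z ^ 2)
      have hz0 : z ≠ 0 := by
        rintro rfl
        norm_num at hz
      have heq : (w / z ^ 2) ^ 2 - ((-m : ℤ) : ℚ_[l]) = ((l * e : ℤ) : ℚ_[l]) / z ^ 4 := by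
        rw [div_pow, h]
        push_cast
        field_simp
        ring
      rw [heq, norm_div, hd, norm_pow]
      exact (div_le_self (by positivity) (one_le_pow₀ hz)).trans_lt (inv_lt_one_of_one_lt₀ hl1)
  · intro h
    obtain ⟨w, hw⟩ := exists_padic_sq_eq_of_isSquare l hlodd (l * e - m)
      (fun hdiv => hnm ((dvd_sub_right (dvd_mul_right _ _)).mp hdiv)) (by simpa using h)
    exact ⟨1, w, by rw [hw]; push_cast; ring⟩
end

section
/- Let E : y^2 = x^3 - 2rDx with 2rD square-free, and let P be a point of infinite order in E(Q) with x(P) = a/d^2 in lowest terms. Then (1/4)·log((a^2 + 2rD·d^4)/(2rD)) ≤ ĥ(P) ≤ (1/4)·log(a^2 + 2rD·d^4) + (1/12)·log 2. -/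
/-- The curve `y² = x³ + Ax` over `ℚ`. -/
def Ecurve (A : ℚ) : WeierstrassCurve.Affine ℚ := ⟨0, 0, 0, A, 0⟩

/-- The `x`-coordinate of an affine point, with junk value `0` at the point at infinity. -/
def xCoord {A : ℚ} : (Ecurve A).Point → ℚ
  | .zero => 0
  | @WeierstrassCurve.Affine.Point.some _ _ _ x _ _ => x

/-- The naive (Weil) logarithmic height of a rational number `x = a/d²` in lowest terms,
`h = log max {|a|, d²}`. -/
noncomputable def naiveHeight (x : ℚ) : ℝ := Real.log (max (|x.num| : ℝ) (x.den : ℝ))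

/-- The quadratic form `num² + N·den²` evaluated at a rational number in lowest terms. -/
def quadHeight (N : ℤ) (x : ℚ) : ℤ := x.num ^ 2 + N * (x.den : ℤ) ^ 2

theorem quadHeight_pos {N : ℤ} (hN : 0 < N) (x : ℚ) : 0 < quadHeight N x := by
  have : (0 : ℤ) < x.den := by exact_mod_cast x.den_pos
  unfold quadHeight
  positivity

theorem Rat.exists_eq_mul_num_den {x : ℚ} {A B : ℤ} (hB : B ≠ 0) (hx : x = A / B) :
    ∃ c : ℤ, c ≠ 0 ∧ A = c * x.num ∧ B = c * x.den := by
  obtain ⟨c, h1, h2⟩ := Rat.num_den_mk (q := x) hB (by rw [hx, Rat.divInt_eq_div])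
  exact ⟨c, by rintro rfl; exact hB (by rw [h2, zero_mul]), h1, h2⟩

theorem quadHeight_le {N : ℤ} (hN : 0 < N) {x : ℚ} {A B : ℤ} (hB : B ≠ 0) (hx : x = A / B) :
    quadHeight N x ≤ A ^ 2 + N * B ^ 2 := by
  obtain ⟨c, hc, rfl, rfl⟩ := Rat.exists_eq_mul_num_den hB hx
  have h1 : 1 ≤ c ^ 2 := Int.one_le_abs hc |>.trans (by rw [← sq_abs]; nlinarith [Int.one_le_abs hc])
  have := (quadHeight_pos hN x).le
  calc quadHeight N x ≤ c ^ 2 * quadHeight N x := by nlinarith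
    _ = _ := by unfold quadHeight; ring

theorem natAbs_num_of_isCoprime {x : ℚ} {A B : ℤ} (hB : B ≠ 0) (hAB : IsCoprime A B)
    (hx : x = A / B) : x.num.natAbs = A.natAbs := by
  obtain ⟨c, hc, rfl, rfl⟩ := Rat.exists_eq_mul_num_den hB hx
  have hu : IsUnit c := hAB.isUnit_of_dvd' (dvd_mul_right _ _) (dvd_mul_right _ _)
  rw [Int.natAbs_mul, Int.isUnit_iff_natAbs_eq.1 hu, one_mul]

/-- The action of duplication on `x`-coordinates of `y² = x³ - Nx`. -/
def dupX (N : ℤ) (x : ℚ) : ℚ := (x ^ 2 + N) ^ 2 / (4 * (x ^ 3 - N * x))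

theorem dupX_eq_div {N : ℤ} {x : ℚ} :
    dupX N x = ((quadHeight N x ^ 2 : ℤ) : ℚ) /
      ((4 * x.num * x.den * (x.num ^ 2 - N * (x.den : ℤ) ^ 2) : ℤ) : ℚ) := by
  have hd : (x.den : ℚ) ≠ 0 := by exact_mod_cast x.den_nz
  have hq : x = x.num / x.den := x.num_div_den.symm
  unfold dupX quadHeight
  push_cast
  generalize x.num = p at *
  generalize x.den = q at *
  subst hq
  rw [show ((p : ℚ) / q) ^ 2 + N = (p ^ 2 + N * q ^ 2) / q ^ 2 by field_simp,
    show 4 * (((p : ℚ) / q) ^ 3 - N * (p / q)) = (4 * p * q * (p ^ 2 - N * q ^ 2)) / q ^ 4 by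
      field_simp,
    div_pow, ← pow_mul, div_div_div_cancel_right₀ (by positivity)]

theorem dup_den_ne_zero {N : ℤ} {x : ℚ} (h : x ^ 3 - N * x ≠ 0) :
    4 * x.num * x.den * (x.num ^ 2 - N * (x.den : ℤ) ^ 2) ≠ 0 := by
  have hd : (x.den : ℚ) ≠ 0 := by exact_mod_cast x.den_nz
  intro h0
  apply h
  have h1 : (4 * x.num * x.den * (x.num ^ 2 - N * (x.den : ℚ) ^ 2) : ℚ) = 0 := by exact_mod_cast h0
  have hq : (x.num : ℚ) = x * x.den := (Rat.mul_den_eq_num x).symm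
  rw [hq] at h1
  have h2 : (4 * (x.den : ℚ) ^ 4) * (x ^ 3 - N * x) = 0 := by linear_combination h1
  exact (mul_eq_zero.1 h2).resolve_left (by positivity)

theorem quadHeight_dupX_le {N : ℤ} (hN : 0 < N) {x : ℚ} (h : x ^ 3 - N * x ≠ 0) :
    quadHeight N (dupX N x) ≤ 2 * quadHeight N x ^ 4 := by
  refine (quadHeight_le hN (dup_den_ne_zero h) dupX_eq_div).trans ?_
  unfold quadHeight
  generalize x.num = p
  generalize (x.den : ℤ) = q
  nlinarith [sq_nonneg (4 * p ^ 2 * (N * q ^ 2) - (p ^ 2 - N * q ^ 2) ^ 2)]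

theorem quadHeight_dupX_ge {N : ℤ} (hN : 0 < N) (h2 : 2 ∣ N) (hsf : Squarefree N) {x : ℚ}
    (h : x ^ 3 - N * x ≠ 0) :
    IsCoprime (dupX N x).num N ∧
      quadHeight N x ^ 4 ≤ (Int.gcd x.num N : ℤ) ^ 4 * quadHeight N (dupX N x) := by
  have hB := dup_den_ne_zero h
  have hx := dupX_eq_div (N := N) (x := x)
  have hpq : IsCoprime x.num (x.den : ℤ) := Rat.isCoprime_num_den x
  have hge : (dupX N x).num ^ 2 ≤ quadHeight N (dupX N x) := by
    unfold quadHeight; nlinarith [sq_nonneg ((dupX N x).den : ℤ)]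
  have hg0 : (Int.gcd x.num N : ℤ) ≠ 0 := by
    simp [Int.gcd_eq_zero_iff, hN.ne']
  obtain ⟨p, hp⟩ := Int.gcd_dvd_left x.num N
  obtain ⟨M, hM⟩ := Int.gcd_dvd_right x.num N
  have hpM : IsCoprime p M := by
    have hg : 0 < Int.gcd x.num N := Nat.pos_of_ne_zero (by exact_mod_cast hg0)
    have := Int.gcd_div_gcd_div_gcd hg
    nth_rewrite 1 [hp] at this
    nth_rewrite 3 [hM] at this
    rwa [Int.mul_ediv_cancel_left _ hg0, Int.mul_ediv_cancel_left _ hg0,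
      ← Int.isCoprime_iff_gcd_eq_one] at this
  generalize (Int.gcd x.num N : ℤ) = g at *
  have hgM : IsCoprime g M := by
    rw [hM] at hsf
    exact (squarefree_mul_iff.1 hsf).1.isCoprime
  have hF : quadHeight N x = g * (g * p ^ 2 + M * (x.den : ℤ) ^ 2) := by
    unfold quadHeight; rw [hp]; nth_rewrite 1 [hM]; ring
  generalize (x.den : ℤ) = q at *
  rw [hp] at hpq
  have huv : IsCoprime (g * p ^ 2) (M * q ^ 2) :=
    .mul_left (.mul_right hgM hpq.of_mul_left_left.pow_right)
      (.mul_right hpM.pow_left hpq.of_mul_left_right.pow)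
  have huu : IsCoprime (g * p ^ 2 + M * q ^ 2) (g * p ^ 2) := by
    simpa [add_comm] using huv.symm.add_mul_left_left 1
  have huv' : IsCoprime (g * p ^ 2 + M * q ^ 2) (M * q ^ 2) := by
    simpa using huv.add_mul_left_left 1
  have huvN : IsCoprime (g * p ^ 2 + M * q ^ 2) N :=
    hM ▸ huu.of_mul_right_left.mul_right huv'.of_mul_right_left
  have hu2 : IsCoprime (g * p ^ 2 + M * q ^ 2) 2 := huvN.of_isCoprime_of_dvd_right h2
  have hdiff : IsCoprime (g * p ^ 2 + M * q ^ 2) (g * p ^ 2 - M * q ^ 2) := by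
    rw [show g * p ^ 2 - M * q ^ 2 = 2 * (g * p ^ 2) + (g * p ^ 2 + M * q ^ 2) * -1 by ring]
    exact (hu2.mul_right huu).add_mul_left_right (-1)
  have hp' : IsCoprime (g * p ^ 2 + M * q ^ 2) p :=
    huu.of_isCoprime_of_dvd_right ⟨g * p, by ring⟩
  have hq' : IsCoprime (g * p ^ 2 + M * q ^ 2) q :=
    huv'.of_isCoprime_of_dvd_right ⟨M * q, by ring⟩
  have hcop : IsCoprime ((g * p ^ 2 + M * q ^ 2) ^ 2)
      (2 * 2 * p * q * (g * p ^ 2 - M * q ^ 2)) :=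
    ((((hu2.mul_right hu2).mul_right hp').mul_right hq').mul_right hdiff).pow_left
  have hBeq : 4 * x.num * q * (x.num ^ 2 - N * q ^ 2) =
      g ^ 2 * (2 * 2 * p * q * (g * p ^ 2 - M * q ^ 2)) := by
    rw [hp, hM]; ring
  rw [hBeq] at hB hx
  have hx' : dupX N x = (((g * p ^ 2 + M * q ^ 2) ^ 2 : ℤ) : ℚ) /
      ((2 * 2 * p * q * (g * p ^ 2 - M * q ^ 2) : ℤ) : ℚ) := by
    rw [hx, hF, mul_pow, Int.cast_mul, Int.cast_mul (g ^ 2)]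
    exact mul_div_mul_left _ _ (by exact_mod_cast pow_ne_zero 2 hg0)
  have hnum := natAbs_num_of_isCoprime (right_ne_zero_of_mul hB) hcop hx'
  constructor
  · rw [Int.isCoprime_iff_gcd_eq_one, Int.gcd_def, hnum, ← Int.gcd_def,
      ← Int.isCoprime_iff_gcd_eq_one]
    exact huvN.pow_left
  · have : (dupX N x).num ^ 2 = ((g * p ^ 2 + M * q ^ 2) ^ 2) ^ 2 := by
      rw [← Int.natAbs_sq, hnum, Int.natAbs_sq]
    rw [hF]
    calc _ = g ^ 4 * (dupX N x).num ^ 2 := by rw [this]; ring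
      _ ≤ _ := by gcongr

theorem xCoord_add_self {N : ℤ} (Q : (Ecurve (-(N : ℚ))).Point) (hQ : Q ≠ 0) (h2Q : Q + Q ≠ 0) :
    xCoord Q ^ 3 - N * xCoord Q ≠ 0 ∧ xCoord (Q + Q) = dupX N (xCoord Q) := by
  match Q, hQ, h2Q with
  | .zero, hQ, _ => exact absurd rfl hQ
  | @WeierstrassCurve.Affine.Point.some _ _ _ x y h, _, h2Q =>
    have hne : y ≠ (Ecurve (-(N : ℚ))).negY x y := fun hy ↦
      h2Q (WeierstrassCurve.Affine.Point.add_self_of_Y_eq hy)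
    have hy0 : y ≠ 0 := by
      rintro rfl
      simp [WeierstrassCurve.Affine.negY, Ecurve] at hne
    have heq : y ^ 2 = x ^ 3 - N * x := by
      have := (WeierstrassCurve.Affine.equation_iff _ _).1 h.1
      simp only [Ecurve] at this
      linear_combination this
    rw [WeierstrassCurve.Affine.Point.add_self_of_Y_ne hne]
    simp only [xCoord]
    refine ⟨heq ▸ pow_ne_zero 2 hy0, ?_⟩
    rw [WeierstrassCurve.Affine.slope_of_Y_ne rfl hne, dupX, ← heq]
    simp only [WeierstrassCurve.Affine.addX, WeierstrassCurve.Affine.negY, Ecurve]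
    rw [show y - (-y - 0 * x - 0) = 2 * y by ring]
    field_simp
    linear_combination -32 * x * heq

theorem two_mul_naiveHeight_le {N : ℤ} (hN : 1 ≤ N) (x : ℚ) :
    2 * naiveHeight x ≤ Real.log (quadHeight N x) := by
  have hd : (0 : ℝ) < x.den := by exact_mod_cast x.den_pos
  have hN' : (1 : ℝ) ≤ N := by exact_mod_cast hN
  have hm : 0 < max |(x.num : ℝ)| (x.den : ℝ) := lt_max_of_lt_right hd
  rw [naiveHeight, ← Nat.cast_two, ← Real.log_pow]
  refine Real.log_le_log (by positivity) ?_
  unfold quadHeight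
  push_cast
  rcases max_choice |(x.num : ℝ)| (x.den : ℝ) with h | h <;> rw [h]
  · rw [sq_abs]; nlinarith [sq_nonneg (x.den : ℝ)]
  · nlinarith [sq_nonneg (x.num : ℝ), sq_nonneg (x.den : ℝ)]

theorem log_quadHeight_le {N : ℤ} (hN : 1 ≤ N) (x : ℚ) :
    Real.log (quadHeight N x) ≤ 2 * naiveHeight x + Real.log (1 + N) := by
  have hd : (0 : ℝ) < x.den := by exact_mod_cast x.den_pos
  have hN' : (1 : ℝ) ≤ N := by exact_mod_cast hN
  have hm : 0 < max |(x.num : ℝ)| (x.den : ℝ) := lt_max_of_lt_right hd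
  rw [naiveHeight, ← Nat.cast_two, ← Real.log_pow, ← Real.log_mul (by positivity) (by positivity)]
  refine Real.log_le_log (by exact_mod_cast quadHeight_pos (by lia) x) ?_
  have h1 : (x.num : ℝ) ^ 2 ≤ max |(x.num : ℝ)| (x.den : ℝ) ^ 2 :=
    sq_abs (x.num : ℝ) ▸ pow_le_pow_left₀ (abs_nonneg _) (le_max_left _ _) 2
  have h2 : (x.den : ℝ) ^ 2 ≤ max |(x.num : ℝ)| (x.den : ℝ) ^ 2 := by gcongr; exact le_max_right _ _
  unfold quadHeight
  push_cast
  nlinarith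

/-- The canonical height bounds for an orbit of the duplication map on `x`-coordinates. -/
theorem height_bounds_of_dupX_orbit {N : ℤ} (hN : 0 < N) (h2 : 2 ∣ N) (hsf : Squarefree N)
    {u : ℕ → ℚ} (hu : ∀ n, u n ^ 3 - N * u n ≠ 0) (hdup : ∀ n, u (n + 1) = dupX N (u n))
    {hhat : ℝ}
    (hlim : Filter.Tendsto (fun n ↦ naiveHeight (u n) / 2 / 4 ^ n) Filter.atTop (nhds hhat)) :
    1 / 4 * (Real.log (quadHeight N (u 0)) - Real.log N) ≤ hhat ∧
      hhat ≤ 1 / 4 * Real.log (quadHeight N (u 0)) + 1 / 12 * Real.log 2 := by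
  have hpos (n) : (0 : ℝ) < quadHeight N (u n) := by exact_mod_cast quadHeight_pos hN (u n)
  have hup (n) : Real.log (quadHeight N (u (n + 1))) ≤
      4 * Real.log (quadHeight N (u n)) + Real.log 2 := by
    have h := quadHeight_dupX_le hN (hu n)
    rw [← hdup] at h
    have h' : (quadHeight N (u (n + 1)) : ℝ) ≤ 2 * (quadHeight N (u n) : ℝ) ^ 4 := by
      exact_mod_cast h
    have := Real.log_le_log (hpos _) h'
    rw [Real.log_mul two_ne_zero (pow_pos (hpos n) 4).ne', Real.log_pow] at this
    push_cast at this
    linarith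
  have hlow (n) : 4 * Real.log (quadHeight N (u n)) ≤
      4 * Real.log (Int.gcd (u n).num N) + Real.log (quadHeight N (u (n + 1))) := by
    have h := (quadHeight_dupX_ge hN h2 hsf (hu n)).2
    rw [← hdup] at h
    have h' : (quadHeight N (u n) : ℝ) ^ 4 ≤
        (Int.gcd (u n).num N : ℝ) ^ 4 * quadHeight N (u (n + 1)) := by exact_mod_cast h
    have hg : (0 : ℝ) < Int.gcd (u n).num N := by
      exact_mod_cast Int.gcd_pos_of_ne_zero_right _ hN.ne'
    have := Real.log_le_log (pow_pos (hpos n) 4) h'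
    rw [Real.log_mul (pow_pos hg 4).ne' (hpos _).ne', Real.log_pow, Real.log_pow] at this
    exact_mod_cast this
  have hlow' (n) : 4 * Real.log (quadHeight N (u (n + 1))) ≤
      Real.log (quadHeight N (u (n + 1 + 1))) := by
    have h := hlow (n + 1)
    rw [Int.isCoprime_iff_gcd_eq_one.1 (hdup n ▸ (quadHeight_dupX_ge hN h2 hsf (hu n)).1)] at h
    simpa using h
  have hU (n : ℕ) : Real.log (quadHeight N (u n)) ≤
      4 ^ n * (Real.log (quadHeight N (u 0)) + Real.log 2 / 3) - Real.log 2 / 3 := by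
    induction n with
    | zero => simp
    | succ n ih => rw [pow_succ]; linarith [hup n]
  have hg0 : Real.log (Int.gcd (u 0).num N) ≤ Real.log N := by
    refine Real.log_le_log (by exact_mod_cast Int.gcd_pos_of_ne_zero_right _ hN.ne') ?_
    exact_mod_cast Int.le_of_dvd hN (Int.gcd_dvd_right _ _)
  have hL (n : ℕ) : 4 ^ (n + 1) * (Real.log (quadHeight N (u 0)) - Real.log N) ≤
      Real.log (quadHeight N (u (n + 1))) := by
    induction n with
    | zero => simpa using (by linarith [hlow 0] : 4 * (Real.log (quadHeight N (u 0)) - Real.log N) ≤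
        Real.log (quadHeight N (u (0 + 1))))
    | succ n ih => rw [pow_succ]; linarith [hlow' n]
  have hlog2 : 0 ≤ Real.log 2 := Real.log_nonneg one_le_two
  constructor
  · have ht : Filter.Tendsto (fun n : ℕ ↦ naiveHeight (u (n + 1)) / 2 / 4 ^ (n + 1) +
        Real.log (1 + N) / 4 * ((4 : ℝ)⁻¹) ^ (n + 1)) Filter.atTop (nhds (hhat + _ * 0)) :=
      ((Filter.tendsto_add_atTop_iff_nat 1).2 hlim).add
        (((Filter.tendsto_add_atTop_iff_nat 1).2
          (tendsto_pow_atTop_nhds_zero_of_lt_one (by norm_num) (by norm_num))).const_mul _)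
    rw [mul_zero, add_zero] at ht
    refine ge_of_tendsto' ht fun n ↦ ?_
    have h4 : (0 : ℝ) < 4 ^ (n + 1) := by positivity
    rw [inv_pow, ← div_eq_mul_inv, ← add_div, le_div_iff₀ h4]
    linarith [hL n, log_quadHeight_le (by lia : 1 ≤ N) (u (n + 1))]
  · refine le_of_tendsto' hlim fun n ↦ ?_
    rw [div_le_iff₀ (by positivity)]
    linarith [hU n, two_mul_naiveHeight_le (by lia : 1 ≤ N) (u n)]

/-- On `E : y² = x³ - 2rDx` with `2rD` square-free, for `P ∈ E(ℚ)` of infinite order with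
`x(P) = a/d²` in lowest terms, the canonical height (normalized so that
`ĥ(P) = lim (1/2)·h(x([2ⁿ]P))/4ⁿ`) satisfies
`(1/4)·log((a² + 2rD·d⁴)/(2rD)) ≤ ĥ(P) ≤ (1/4)·log(a² + 2rD·d⁴) + (1/12)·log 2`. -/
theorem stmt_15 (r D : ℕ) (hr : 0 < r) (hD : 0 < D) (hsf : Squarefree (2 * r * D))
    (P : (Ecurve (-(2 * r * D : ℚ))).Point) (hP : ¬ IsOfFinAddOrder P)
    (a d : ℤ) (hd : 0 < d) (hcop : IsCoprime a d)
    (hx : xCoord P = (a : ℚ) / (d : ℚ) ^ 2)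
    (hhat : ℝ)
    (hlim : Filter.Tendsto
      (fun n : ℕ => naiveHeight (xCoord ((2 ^ n : ℤ) • P)) / 2 / 4 ^ n)
      Filter.atTop (nhds hhat)) :
    (1 / 4 : ℝ) * Real.log (((a : ℝ) ^ 2 + 2 * r * D * (d : ℝ) ^ 4) / (2 * r * D)) ≤ hhat ∧
      hhat ≤ (1 / 4 : ℝ) * Real.log ((a : ℝ) ^ 2 + 2 * r * D * (d : ℝ) ^ 4) +
        (1 / 12 : ℝ) * Real.log 2 := by
  obtain ⟨N, hN⟩ : ∃ N : ℤ, N = ((2 * r * D : ℕ) : ℤ) := ⟨_, rfl⟩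
  have hNpos : 0 < N := by rw [hN]; positivity
  have hNQ : (2 * r * D : ℚ) = N := by rw [hN]; push_cast; rfl
  have hNR : (2 * r * D : ℝ) = N := by rw [hN]; push_cast; rfl
  have hNsf : Squarefree N := by rw [hN]; exact Int.squarefree_natCast.2 hsf
  have hN2 : 2 ∣ N := ⟨r * D, by rw [hN]; push_cast; ring⟩
  rw [hNR]
  clear hNR hN hsf
  revert P
  rw [hNQ]
  intro P hP hx hlim
  have hne (m : ℤ) (hm : m ≠ 0) : m • P ≠ 0 := fun h ↦
    hP (isOfFinAddOrder_iff_zsmul_eq_zero.2 ⟨m, hm, h⟩)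
  have hstep (n : ℕ) := xCoord_add_self (((2 : ℤ) ^ n) • P) (hne _ (by positivity))
    (by rw [← add_zsmul]; exact hne _ (by positivity))
  have hadd (n : ℕ) : ((2 : ℤ) ^ (n + 1)) • P = ((2 : ℤ) ^ n) • P + ((2 : ℤ) ^ n) • P := by
    rw [← add_zsmul, pow_succ, mul_two]
  have hq : (quadHeight N (xCoord P) : ℝ) = a ^ 2 + N * d ^ 4 := by
    have hc : Nat.Coprime a.natAbs (d ^ 2).natAbs :=
      Int.isCoprime_iff_nat_coprime.1 hcop.pow_right
    have hd2 : 0 < d ^ 2 := by positivity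
    have h1 := Rat.num_div_eq_of_coprime hd2 hc
    have h2 := Rat.den_div_eq_of_coprime hd2 hc
    rw [quadHeight, hx, ← Int.cast_pow, h1, h2]
    push_cast
    ring
  have hpos : (0 : ℝ) < quadHeight N (xCoord P) := by exact_mod_cast quadHeight_pos hNpos _
  have := height_bounds_of_dupX_orbit hNpos hN2 hNsf (u := fun n ↦ xCoord (((2 : ℤ) ^ n) • P))
    (fun n ↦ (hstep n).1) (fun n ↦ by rw [hadd]; exact (hstep n).2) hlim
  simp only [pow_zero, one_zsmul] at this
  rwa [← hq, Real.log_div hpos.ne' (by exact_mod_cast hNpos.ne')]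
end

section
/- Given positive integers k and m, there exists a constant c depending only on m and k such that: for any pairwise distinct odd primes p_1, …, p_k none dividing m, any signs ε_1, …, ε_k ∈ {-1, 1}, and any integer a coprime to m, assuming GRH, the least odd prime l satisfying (p_i/l) = ε_i for all 1 ≤ i ≤ k and l ≡ a (mod m) is at most c·log^2(p_1⋯p_k). -/
/-- The Generalized Riemann Hypothesis for Dirichlet L-functions: every zero of a
Dirichlet L-function with positive real part lies on the critical line `Re s = 1/2`. -/
def GRH : Prop :=
  ∀ (N : ℕ) [NeZero N] (χ : DirichletCharacter ℂ N) (s : ℂ),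
    DirichletCharacter.LFunction χ s = 0 → 0 < s.re → s.re = 1 / 2

open Complex Metric Set in
theorem circleIntegral_mul_sub_inv_pow {c b : ℂ} {R : ℝ} {U : Set ℂ} (hU : IsOpen U)
    (hcU : closedBall c R ⊆ U) (hb : b ∈ ball c R) (n : ℕ) {f : ℂ → ℂ}
    (hf : DifferentiableOn ℂ f U) :
    (∮ z in C(c, R), f z * ((z - b)⁻¹) ^ (n + 1)) =
      2 * Real.pi * I * (iteratedDeriv n f b / n.factorial) := by
  have hR : 0 < R := by
    by_contra h
    rw [ball_eq_empty.2 (not_lt.1 h)] at hb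
    exact hb
  have hne : ∀ z ∈ sphere c R, z - b ≠ 0 := by
    intro z hz h0
    rw [sub_eq_zero] at h0
    subst h0
    rw [mem_ball] at hb
    rw [mem_sphere] at hz
    exact absurd hz hb.ne
  induction n generalizing f with
  | zero =>
    have h := (hf.mono hcU).circleIntegral_sub_inv_smul hb
    simp only [smul_eq_mul] at h
    simp only [zero_add, pow_one, iteratedDeriv_zero, Nat.factorial_zero, Nat.cast_one, div_one]
    rw [← h]
    congr 1
    ext z
    ring
  | succ n ih =>
    have hf' : DifferentiableOn ℂ (deriv f) U := hf.deriv hU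
    have h1 := ih hf'
    have hz := circleIntegral.integral_eq_zero_of_hasDerivWithinAt (c := c) (R := R)
      (f := fun z ↦ f z * ((z - b)⁻¹) ^ (n + 1))
      (f' := fun z ↦ deriv f z * ((z - b)⁻¹) ^ (n + 1)
        - (n + 1) * (f z * ((z - b)⁻¹) ^ (n + 1 + 1))) hR.le ?_
    · have hc1 : ContinuousOn (fun z : ℂ ↦ (z - b)⁻¹) (sphere c R) :=
        ContinuousOn.inv₀ (by fun_prop) hne
      have hcf : ContinuousOn f (sphere c R) :=
        hf.continuousOn.mono (sphere_subset_closedBall.trans hcU)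
      have hcf' : ContinuousOn (deriv f) (sphere c R) :=
        hf'.continuousOn.mono (sphere_subset_closedBall.trans hcU)
      rw [circleIntegral.integral_sub, circleIntegral.integral_const_mul, h1] at hz
      · rw [iteratedDeriv_succ', Nat.factorial_succ]
        have : ((n : ℂ) + 1) ≠ 0 := by exact_mod_cast Nat.succ_ne_zero n
        have h2 : ((n.factorial : ℂ)) ≠ 0 := by exact_mod_cast n.factorial_ne_zero
        push_cast
        rw [sub_eq_zero] at hz
        field_simp
        field_simp at hz
        linear_combination -hz
      · exact ContinuousOn.circleIntegrable hR.le (hcf'.mul (hc1.pow _))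
      · exact ContinuousOn.circleIntegrable hR.le
          (continuousOn_const.mul (hcf.mul (hc1.pow _)))
    · intro z hzs
      have hzU : z ∈ U := hcU (sphere_subset_closedBall hzs)
      have hd : HasDerivAt f (deriv f z) z :=
        ((hf z hzU).differentiableAt (hU.mem_nhds hzU)).hasDerivAt
      have hi : HasDerivAt (fun z : ℂ ↦ (z - b)⁻¹) (-1 / (z - b) ^ 2) z :=
        ((hasDerivAt_id z).sub_const b).inv (hne z hzs)
      have := hd.mul (hi.pow (n + 1))
      refine HasDerivAt.hasDerivWithinAt ?_
      refine this.congr_deriv ?_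
      have h0 := hne z hzs
      push_cast
      simp only [Pi.pow_apply, inv_pow]
      field_simp
      ring

open Complex Metric Set ComplexConjugate in
/-- On a circle tangent to the imaginary axis, a kernel of the form `(z - b)⁻¹ ^ (J + 1)` is
orthogonal to antiholomorphic functions. -/
theorem circleIntegral_conj_mul_sub_inv_pow {b R : ℝ} (hb : 0 < b) (hbR : b ≤ R)
    {J : ℕ} (hJ : J ≠ 0) {f : ℂ → ℂ} {U : Set ℂ}
    (hcU : closedBall (R : ℂ) R ⊆ U) (hf : DifferentiableOn ℂ f U) :
    (∮ z in C((R : ℂ), R), conj (f z) * ((z - b)⁻¹) ^ (J + 1)) = 0 := by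
  have hR : 0 < R := hb.trans_le hbR
  have hRc : (R : ℂ) ≠ 0 := by exact_mod_cast hR.ne'
  let H : ℂ → ℂ := fun z ↦ -(R : ℂ) ^ 2 * (z - R) ^ (J - 1) / ((R - b) * (z - R) + R ^ 2) ^ (J + 1)
  have hden : ∀ z ∈ closedBall (R : ℂ) R, ((R : ℂ) - b) * (z - R) + R ^ 2 ≠ 0 := by
    intro z hz h0
    rw [mem_closedBall, dist_eq_norm] at hz
    have h1 : ((R : ℂ) - b) * (z - R) = - R ^ 2 := by linear_combination h0
    have h2 := congrArg norm h1
    rw [norm_mul, ← ofReal_sub, norm_real, norm_neg, norm_pow, norm_real, Real.norm_of_nonneg hR.le,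
      Real.norm_of_nonneg (by linarith)] at h2
    nlinarith [norm_nonneg (z - R)]
  have hH : DifferentiableOn ℂ H (closedBall (R : ℂ) R) := by
    refine DifferentiableOn.div (by fun_prop) (by fun_prop) fun z hz ↦ pow_ne_zero _ (hden z hz)
  have h0 : (∮ z in C((R : ℂ), R), f z * H z) = 0 := by
    apply DiffContOnCl.circleIntegral_eq_zero hR.le
    apply DifferentiableOn.diffContOnCl
    rw [closure_ball _ hR.ne']
    exact (hf.mono hcU).mul hH
  rw [circleIntegral] at h0 ⊢
  have h1 := congrArg conj h0
  rw [map_zero, intervalIntegral.integral_of_le (by positivity), ← integral_conj,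
    ← intervalIntegral.integral_of_le (by positivity)] at h1
  rw [← h1]
  apply intervalIntegral.integral_congr
  intro θ _
  simp only [deriv_circleMap, smul_eq_mul, map_mul]
  set u := circleMap 0 R θ with hu
  have hcm : circleMap (R : ℂ) R θ = R + u := by simp [u, circleMap]
  have hune : u ≠ 0 := by simp [u, hR.ne']
  have hconj : conj u = R ^ 2 / u := by
    rw [eq_div_iff hune, mul_comm, mul_conj, normSq_eq_norm_sq]
    simp [u]
  have hmem : (R : ℂ) + u ∈ closedBall (R : ℂ) R := by simp [u, abs_of_pos hR]
  have hd := hden _ hmem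
  have hwb : (R : ℂ) + u - b ≠ 0 := by
    intro h
    have h3 := hd
    have h4 : u = b - R := by linear_combination h
    have h2 : conj u = u := by rw [h4]; simp
    rw [hconj] at h2
    apply h3
    rw [add_sub_cancel_left]
    have h5 : (R : ℂ) ^ 2 = u * u := by field_simp at h2; linear_combination h2
    rw [h5, h4]
    ring
  rw [hcm]
  obtain ⟨j, rfl⟩ : ∃ j, J = j + 1 := ⟨J - 1, by omega⟩
  simp only [H, map_div₀, map_mul, map_neg, map_pow, map_sub, map_add, conj_ofReal, conj_I,
    add_sub_cancel_left, hconj, Nat.add_sub_cancel]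
  have hd' : ((R : ℂ) - b) * (R ^ 2 / u) + R ^ 2 = R ^ 2 / u * (R + u - b) := by
    field_simp
    ring
  rw [hd', mul_pow, div_pow, div_pow, inv_pow]
  field_simp
  ring

open Complex Metric Set ComplexConjugate in
theorem norm_iteratedDeriv_le_of_re_nonneg_of_isOpen {b : ℝ} (hb : 1 ≤ b) {J : ℕ} (hJ : J ≠ 0)
    (hbJ : 8 * b ^ 2 ≤ 3 * (J + 1)) {f : ℂ → ℂ} {δ : ℝ} (hδ : 0 < δ)
    (hf : DifferentiableOn ℂ f {w | -δ < w.re}) (hre : ∀ w : ℂ, 0 ≤ w.re → 0 ≤ (f w).re) :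
    ‖iteratedDeriv J f b‖ ≤ J.factorial * (4 * (f 1).re / b ^ (J + 1)) := by
  set R : ℝ := 4 * b with hRdef
  have hR : 0 < R := by positivity
  have hre_mem : ∀ w ∈ closedBall (R : ℂ) R, 0 ≤ w.re := by
    intro w hw
    rw [mem_closedBall, dist_eq_norm] at hw
    have := (abs_le.1 ((abs_re_le_norm (w - R)).trans hw)).1
    simp at this
    linarith
  have hcU : closedBall (R : ℂ) R ⊆ {w : ℂ | -δ < w.re} := fun w hw ↦ by
    have := hre_mem w hw
    simp only [mem_ofPred_eq]
    linarith
  have hU : IsOpen {w : ℂ | -δ < w.re} := isOpen_lt continuous_const continuous_re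
  have hbb : (b : ℂ) ∈ ball (R : ℂ) R := by
    rw [mem_ball, dist_eq_norm, ← ofReal_sub, norm_real, Real.norm_eq_abs, abs_lt]
    constructor <;> linarith
  have h1b : (1 : ℂ) ∈ ball (R : ℂ) R := by
    rw [mem_ball, dist_eq_norm, ← ofReal_one, ← ofReal_sub, norm_real, Real.norm_eq_abs, abs_lt]
    constructor <;> linarith
  have hc1 := circleIntegral_mul_sub_inv_pow hU hcU hbb J hf
  have hc2 := circleIntegral_conj_mul_sub_inv_pow (by linarith) (by linarith : b ≤ R) hJ hcU hf
  have hcf : ContinuousOn f (sphere (R : ℂ) R) :=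
    hf.continuousOn.mono (sphere_subset_closedBall.trans hcU)
  have hne : ∀ z ∈ sphere (R : ℂ) R, z - b ≠ 0 := by
    intro z hz h0
    rw [sub_eq_zero] at h0
    subst h0
    rw [mem_ball] at hbb
    rw [mem_sphere] at hz
    exact absurd hz hbb.ne
  have hcK : ContinuousOn (fun z : ℂ ↦ ((z - b)⁻¹) ^ (J + 1)) (sphere (R : ℂ) R) :=
    (ContinuousOn.inv₀ (by fun_prop) hne).pow _
  have hsum : (∮ z in C((R : ℂ), R), ((2 * (f z).re : ℝ) : ℂ) * ((z - b)⁻¹) ^ (J + 1)) =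
      2 * Real.pi * I * (iteratedDeriv J f b / J.factorial) := by
    rw [← hc1, ← add_zero (∮ z in C((R : ℂ), R), f z * ((z - b)⁻¹) ^ (J + 1)), ← hc2,
      ← circleIntegral.integral_add]
    · congr 1
      ext z
      rw [← add_mul, add_conj]
    · exact ContinuousOn.circleIntegrable hR.le (hcf.mul hcK)
    · exact ContinuousOn.circleIntegrable hR.le ((continuous_conj.comp_continuousOn hcf).mul hcK)
  -- the Poisson integral at `1`
  have hP := (DifferentiableOn.diffContOnCl (by
    rw [closure_ball _ hR.ne']; exact hf.mono hcU) :
      DiffContOnCl ℂ f (ball (R : ℂ) R)).circleAverage_poissonKernel_smul' h1b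
  have hmem : ∀ θ, circleMap (R : ℂ) R θ ∈ sphere (R : ℂ) R := fun θ ↦
    circleMap_mem_sphere _ hR.le θ
  have hcont : Continuous fun θ : ℝ ↦ f (circleMap (R : ℂ) R θ) :=
    hcf.comp_continuous (continuous_circleMap _ _) hmem
  have hne1 : ∀ θ, circleMap (R : ℂ) R θ - 1 ≠ 0 := by
    intro θ h0
    have := hmem θ
    rw [sub_eq_zero.1 h0] at this
    exact absurd (mem_sphere.1 this) (mem_ball.1 h1b).ne
  have hP' : (f 1).re = (2 * Real.pi)⁻¹ * ∫ θ in (0 : ℝ)..2 * Real.pi,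
      (2 * R - 1) / ‖circleMap (R : ℂ) R θ - 1‖ ^ 2 * (f (circleMap (R : ℂ) R θ)).re := by
    rw [← hP, Real.circleAverage, real_smul, re_ofReal_mul]
    congr 1
    have hint : IntervalIntegrable (fun θ ↦ ((‖circleMap (R : ℂ) R θ - R‖ ^ 2 - ‖(1 : ℂ) - R‖ ^ 2) /
        ‖circleMap (R : ℂ) R θ - R - (1 - R)‖ ^ 2) • f (circleMap (R : ℂ) R θ))
        MeasureTheory.volume 0 (2 * Real.pi) := by
      apply Continuous.intervalIntegrable
      refine Continuous.fun_smul (Continuous.div₀ ?_ ?_ ?_) hcont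
      · fun_prop
      · fun_prop
      · intro θ
        have := hne1 θ
        rw [sub_sub_sub_cancel_right]
        positivity
    have := reCLM.intervalIntegral_comp_comm hint
    rw [reCLM_apply] at this
    rw [← this]
    apply intervalIntegral.integral_congr
    intro θ _
    simp only [reCLM_apply, real_smul, re_ofReal_mul, sub_sub_sub_cancel_right]
    congr 2
    have h1 : ‖circleMap (R : ℂ) R θ - R‖ = R := by
      rw [← dist_eq_norm]; exact mem_sphere.1 (hmem θ)
    have h2 : ‖(1 : ℂ) - R‖ = R - 1 := by
      rw [← ofReal_one, ← ofReal_sub, norm_real, Real.norm_eq_abs, abs_sub_comm,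
        abs_of_nonneg (by linarith)]
    rw [h1, h2]
    ring
  -- comparison of the two kernels
  have hker : ∀ θ, ‖circleMap (R : ℂ) R θ - 1‖ ^ 2 * b ^ (J + 1) ≤
      ‖circleMap (R : ℂ) R θ - b‖ ^ (J + 1) := by
    intro θ
    set w := circleMap (R : ℂ) R θ with hw
    have hwR : normSq (w - R) = R ^ 2 := by
      rw [normSq_eq_norm_sq, ← dist_eq_norm, mem_sphere.1 (hmem θ)]
    have hwre := hre_mem w (sphere_subset_closedBall (hmem θ))
    set t := normSq w with ht
    have ht0 : 0 ≤ t := normSq_nonneg w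
    have h3 : t = 2 * R * w.re := by
      rw [normSq_apply] at hwR ht
      simp at hwR
      nlinarith
    have h1 : ‖w - 1‖ ^ 2 ≤ 1 + t := by
      rw [← normSq_eq_norm_sq, normSq_apply]
      rw [normSq_apply] at ht
      simp
      nlinarith
    have h2 : ‖w - b‖ ^ 2 = b ^ 2 * (1 + 3 / 4 * t / b ^ 2) := by
      rw [← normSq_eq_norm_sq, normSq_apply]
      have hb0 : b ≠ 0 := by positivity
      field_simp
      rw [normSq_apply] at ht
      simp
      have : b * w.re = t / 8 := by rw [h3, hRdef]; ring
      nlinarith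
    have hs : 0 ≤ 3 / 4 * t / b ^ 2 := by positivity
    have hB : 1 + t ≤ (1 + 3 / 4 * t / b ^ 2) ^ (((J + 1 : ℕ) : ℝ) / 2) := by
      have hbpos : 0 < b ^ 2 := by positivity
      have hJ2 : (1 : ℝ) ≤ ((J + 1 : ℕ) : ℝ) / 2 := by push_cast; nlinarith
      refine le_trans ?_ (one_add_mul_self_le_rpow_one_add (by linarith) hJ2)
      gcongr
      push_cast
      rw [mul_div_assoc', le_div_iff₀ hbpos]
      nlinarith
    have h4 : ‖w - b‖ ^ (J + 1) = (‖w - b‖ ^ 2) ^ (((J + 1 : ℕ) : ℝ) / 2) := by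
      rw [← Real.rpow_natCast _ 2, ← Real.rpow_mul (norm_nonneg _), ← Real.rpow_natCast]
      congr 1
      push_cast
      ring
    have h5 : b ^ (J + 1) = (b ^ 2) ^ (((J + 1 : ℕ) : ℝ) / 2) := by
      rw [← Real.rpow_natCast _ 2, ← Real.rpow_mul (by linarith), ← Real.rpow_natCast]
      congr 1
      push_cast
      ring
    rw [h4, h2, Real.mul_rpow (by positivity) (by positivity), ← h5, mul_comm]
    gcongr
    exact h1.trans hB
  -- estimate of the integral
  have hnorm : ‖2 * Real.pi * I * (iteratedDeriv J f b / J.factorial)‖ ≤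
      ∫ θ in (0 : ℝ)..2 * Real.pi, 2 * R / ((2 * R - 1) * b ^ (J + 1)) *
      ((2 * R - 1) / ‖circleMap (R : ℂ) R θ - 1‖ ^ 2 * (f (circleMap (R : ℂ) R θ)).re) := by
    rw [← hsum, circleIntegral]
    apply intervalIntegral.norm_integral_le_of_norm_le (by positivity)
    · refine Filter.Eventually.of_forall fun θ _ ↦ ?_
      have hfre := hre _ (hre_mem _ (sphere_subset_closedBall (hmem θ)))
      have h0 := hne _ (hmem θ)
      have h1 := hne1 θ
      have h2 : 0 < 2 * R - 1 := by linarith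
      simp only [deriv_circleMap, smul_eq_mul, norm_mul, norm_circleMap_zero, norm_I, norm_pow,
        norm_inv, norm_real, Real.norm_eq_abs, abs_of_pos hR, abs_of_nonneg hfre, mul_one, abs_two]
      have h3 := hker θ
      set K := ‖circleMap (R : ℂ) R θ - b‖
      set L := ‖circleMap (R : ℂ) R θ - 1‖
      have hK : 0 < K := norm_pos_iff.2 h0
      have hL : 0 < L := norm_pos_iff.2 h1
      have h4 : (K⁻¹) ^ (J + 1) ≤ 1 / (L ^ 2 * b ^ (J + 1)) := by
        rw [inv_pow, ← one_div]
        exact one_div_le_one_div_of_le (by positivity) h3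
      calc _ ≤ R * (2 * (f (circleMap (R : ℂ) R θ)).re * (1 / (L ^ 2 * b ^ (J + 1)))) := by
            gcongr
        _ = _ := by
            have h2' : R * 2 - 1 ≠ 0 := by linarith
            have h2'' : 2 * R - 1 ≠ 0 := h2.ne'
            field_simp
    · apply Continuous.intervalIntegrable
      refine continuous_const.mul (Continuous.fun_mul (Continuous.div₀ ?_ ?_ ?_) ?_)
      · fun_prop
      · fun_prop
      · intro θ
        have := hne1 θ
        positivity
      · exact continuous_re.comp hcont
  rw [intervalIntegral.integral_const_mul] at hnorm
  have hint : (∫ θ in (0 : ℝ)..2 * Real.pi,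
      (2 * R - 1) / ‖circleMap (R : ℂ) R θ - 1‖ ^ 2 * (f (circleMap (R : ℂ) R θ)).re) =
      2 * Real.pi * (f 1).re := by
    rw [hP', mul_inv_cancel_left₀ (by positivity)]
  rw [hint] at hnorm
  simp only [norm_mul, norm_div, norm_I, norm_real, Complex.norm_natCast, norm_ofNat, mul_one,
    Real.norm_eq_abs, abs_of_pos Real.pi_pos] at hnorm
  have hf1 : 0 ≤ (f 1).re := hre 1 (by simp)
  have hfac : (0 : ℝ) < J.factorial := by exact_mod_cast J.factorial_pos
  have h6 : ‖iteratedDeriv J f b‖ / J.factorial ≤ 2 * R / ((2 * R - 1) * b ^ (J + 1)) * (f 1).re := by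
    have := Real.pi_pos
    refine le_of_mul_le_mul_left ?_ (by positivity : 0 < 2 * Real.pi)
    linarith
  rw [div_le_iff₀' hfac] at h6
  refine h6.trans ?_
  gcongr
  have h7 : 0 < b ^ (J + 1) := by positivity
  have h8 : 0 < 2 * R - 1 := by linarith
  rw [div_mul_eq_mul_div, div_le_div_iff₀ (by positivity) h7, ← sub_nonneg]
  have : 4 * (f 1).re * ((2 * R - 1) * b ^ (J + 1)) - 2 * R * (f 1).re * b ^ (J + 1) =
    ((f 1).re * b ^ (J + 1)) * (6 * R - 4) := by ring
  rw [this]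
  exact mul_nonneg (by positivity) (by linarith)

open Complex Metric Set Filter Topology in
/-- If `f` is holomorphic with nonnegative real part on the right half plane, its derivatives of
high order at `b` are controlled by its value at `1`. -/
theorem norm_iteratedDeriv_le_of_re_nonneg {b : ℝ} (hb : 1 ≤ b) {J : ℕ} (hJ : J ≠ 0)
    (hbJ : 8 * b ^ 2 ≤ 3 * (J + 1)) {f : ℂ → ℂ}
    (hf : DifferentiableOn ℂ f {w | 0 < w.re}) (hre : ∀ w : ℂ, 0 < w.re → 0 ≤ (f w).re) :
    ‖iteratedDeriv J f b‖ ≤ J.factorial * (4 * (f 1).re / b ^ (J + 1)) := by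
  have hU : IsOpen {w : ℂ | 0 < w.re} := isOpen_lt continuous_const continuous_re
  have key : ∀ δ : ℝ, 0 < δ → ‖iteratedDeriv J f (b + δ)‖ ≤
      J.factorial * (4 * (f (1 + δ)).re / b ^ (J + 1)) := by
    intro δ hδ
    have := norm_iteratedDeriv_le_of_re_nonneg_of_isOpen hb hJ hbJ hδ (f := fun w ↦ f (w + δ))
      (hf.comp (by fun_prop) fun w hw ↦ by
        simp only [mem_ofPred_eq, add_re, ofReal_re] at hw ⊢; linarith)
      (fun w hw ↦ hre _ (by simp only [add_re, ofReal_re]; linarith))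
    rwa [iteratedDeriv_comp_add_const] at this
  have hA : AnalyticOnNhd ℂ f {w | 0 < w.re} := hf.analyticOnNhd hU
  have hc1 : ContinuousAt (iteratedDeriv J f) (b : ℂ) := by
    have := (hA.iterated_deriv J) b (by simp; linarith)
    rw [← iteratedDeriv_eq_iterate] at this
    exact this.continuousAt
  have hc2 : ContinuousAt f 1 := (hA 1 (by simp)).continuousAt
  have ht : ∀ x : ℂ, Tendsto (fun δ : ℝ ↦ x + (δ : ℂ)) (𝓝[>] 0) (𝓝 x) := fun x ↦ by
    have : Tendsto (fun δ : ℝ ↦ x + (δ : ℂ)) (𝓝 0) (𝓝 (x + ((0 : ℝ) : ℂ))) :=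
      (continuous_const.add continuous_ofReal).tendsto 0
    simp only [ofReal_zero, add_zero] at this
    exact this.mono_left nhdsWithin_le_nhds
  have t1 : Tendsto (fun δ : ℝ ↦ ‖iteratedDeriv J f (b + δ)‖) (𝓝[>] 0)
      (𝓝 ‖iteratedDeriv J f b‖) := (hc1.tendsto.comp (ht b)).norm
  have t2 : Tendsto (fun δ : ℝ ↦ J.factorial * (4 * (f (1 + δ)).re / b ^ (J + 1))) (𝓝[>] 0)
      (𝓝 (J.factorial * (4 * (f 1).re / b ^ (J + 1)))) :=
    ((((continuous_re.tendsto _).comp (hc2.tendsto.comp (ht 1))).const_mul 4).div_const _).const_mul _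
  exact le_of_tendsto_of_tendsto t1 t2 (eventually_nhdsWithin_of_forall fun δ hδ ↦ key δ hδ)

open Finset in
theorem DirichletCharacter.norm_sum_range_le {N : ℕ} [NeZero N] {χ : DirichletCharacter ℂ N}
    (hχ : χ ≠ 1) (n : ℕ) : ‖∑ k ∈ range n, χ k‖ ≤ N := by
  have h0 : ∑ k ∈ range N, χ k = 0 := by
    rw [← MulChar.sum_eq_zero_of_ne_one hχ]
    refine sum_bij (fun k _ ↦ (k : ZMod N)) (by simp) ?_ ?_ (fun _ _ ↦ rfl)
    · intro a ha b hb h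
      rw [ZMod.natCast_eq_natCast_iff'] at h
      rwa [Nat.mod_eq_of_lt (mem_range.1 ha), Nat.mod_eq_of_lt (mem_range.1 hb)] at h
    · intro b _
      exact ⟨b.val, mem_range.2 b.val_lt, by simp⟩
  induction n using Nat.strong_induction_on with
  | _ n ih =>
    rcases lt_or_ge n N with h | h
    · refine (norm_sum_le _ _).trans ?_
      refine (sum_le_sum fun (i : ℕ) _ ↦ χ.norm_le_one (i : ZMod N)).trans ?_
      simpa using h.le
    · obtain ⟨r, rfl⟩ := Nat.exists_eq_add_of_le h
      rw [sum_range_add, h0, zero_add]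
      simpa using ih r (by have := NeZero.pos N; omega)

open Complex Filter Topology Set MeasureTheory Asymptotics in
/-- Partial summation bounds a Dirichlet `L`-function in the right half plane. -/
theorem DirichletCharacter.norm_LFunction_le {N : ℕ} [NeZero N] {χ : DirichletCharacter ℂ N}
    (hχ : χ ≠ 1) {s : ℂ} (hs : 0 < s.re) : ‖LFunction χ s‖ ≤ N * (‖s‖ / s.re) := by
  let S : ℝ → ℂ := fun t ↦ ∑ k ∈ Finset.Icc 1 ⌊t⌋₊, χ k
  have hN1 : N ≠ 1 := fun h ↦ by
    subst h
    exact hχ (Subsingleton.elim _ _)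
  have hχ0 : χ (0 : ℕ) = 0 := by
    rw [Nat.cast_zero]
    have := Fact.mk (Nat.lt_of_le_of_ne (NeZero.pos N) hN1.symm)
    exact χ.map_nonunit not_isUnit_zero
  have hSeq : ∀ n : ℕ, ∑ k ∈ Finset.Icc 1 n, χ k = ∑ k ∈ Finset.range (n + 1), χ k := fun n ↦ by
    rw [Finset.range_eq_Ico, Finset.sum_eq_sum_Ico_succ_bot (by omega), hχ0, zero_add]
    rfl
  have hS : ∀ t, ‖S t‖ ≤ N := fun t ↦ by
    simp only [S, hSeq]
    exact norm_sum_range_le hχ _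
  have hSm : Measurable S := by
    have : S = (fun n : ℕ ↦ ∑ k ∈ Finset.Icc 1 n, χ k) ∘ fun t : ℝ ↦ ⌊t⌋₊ := rfl
    rw [this]
    exact (measurable_from_nat).comp Nat.measurable_floor
  let g : ℝ → ℂ := (Ioi 1).indicator S
  have hgN : ∀ t, ‖g t‖ ≤ N := fun t ↦ (norm_indicator_le_norm_self _ _).trans (hS t)
  have hgm : Measurable g := hSm.indicator measurableSet_Ioi
  have hmel : ∀ z : ℂ, mellin g (-z) = ∫ t in Ioi (1 : ℝ), S t * (t : ℂ) ^ (-(z + 1)) := by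
    intro z
    rw [mellin, ← integral_indicator measurableSet_Ioi, ← integral_indicator measurableSet_Ioi]
    congr 1
    ext t
    by_cases ht : t ∈ Ioi (1 : ℝ)
    · have ht0 : t ∈ Ioi (0 : ℝ) := zero_lt_one.trans (mem_Ioi.1 ht)
      simp only [indicator_of_mem ht, indicator_of_mem ht0, g, smul_eq_mul]
      rw [mul_comm]
      congr 2
      ring
    · simp [g, indicator_of_notMem ht]
  have hdiff : DifferentiableOn ℂ (fun z ↦ z * mellin g (-z)) {z | 0 < z.re} := by
    intro z hz
    refine DifferentiableAt.differentiableWithinAt (differentiableAt_id.mul ?_)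
    refine DifferentiableAt.comp (g := mellin g) (f := Neg.neg) z ?_ differentiableAt_id.neg
    refine mellin_differentiableAt_of_isBigO_rpow (a := 0) (b := - z.re - 1) ?_ ?_ ?_ ?_ ?_
    · refine (LocallyIntegrable.locallyIntegrableOn ?_ _)
      refine (locallyIntegrable_const (N : ℝ)).mono hgm.aestronglyMeasurable ?_
      refine Eventually.of_forall fun t ↦ ?_
      simpa using hgN t
    · refine isBigO_of_le' (c := N) _ fun t ↦ ?_
      simpa using hgN t
    · simpa using hz
    · refine IsBigO.of_bound 1 ?_
      filter_upwards [Ioo_mem_nhdsGT (zero_lt_one (α := ℝ))] with t ht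
      simp only [g, indicator_of_notMem (notMem_Ioi.2 ht.2.le), norm_zero]
      positivity
    · simp
  have hopen : IsOpen {z : ℂ | 0 < z.re} := isOpen_lt continuous_const continuous_re
  have heq : EqOn (LFunction χ) (fun z ↦ z * mellin g (-z)) {z | 0 < z.re} := by
    refine AnalyticOnNhd.eqOn_of_preconnected_of_eventuallyEq (z₀ := 2)
      ((differentiable_LFunction hχ).differentiableOn.analyticOnNhd hopen)
      (hdiff.analyticOnNhd hopen) (convex_halfSpace_re_gt 0).isPreconnected (by simp) ?_
    filter_upwards [(isOpen_lt continuous_const continuous_re : IsOpen {z : ℂ | 1 < z.re}).mem_nhds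
      (by simp : (2 : ℂ) ∈ {z : ℂ | 1 < z.re})] with z hz
    rw [LFunction_eq_LSeries χ hz, hmel]
    refine LSeries_eq_mul_integral _ le_rfl (zero_lt_one.trans hz)
      (LSeriesSummable_of_one_lt_re χ hz) ?_
    refine isBigO_of_le' (c := N) _ fun n ↦ ?_
    rw [hSeq]
    simpa using norm_sum_range_le hχ (n + 1)
  rw [heq hs, norm_mul, hmel]
  have hint : ‖∫ t in Ioi (1 : ℝ), S t * (t : ℂ) ^ (-(s + 1))‖ ≤ N / s.re := by
    have h1 : IntegrableOn (fun t : ℝ ↦ (N : ℝ) * t ^ (-s.re - 1)) (Ioi 1) :=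
      (integrableOn_Ioi_rpow_of_lt (by linarith) zero_lt_one).const_mul _
    refine (norm_integral_le_of_norm_le h1 ?_).trans_eq ?_
    · filter_upwards [ae_restrict_mem measurableSet_Ioi] with t ht
      have ht0 : (0 : ℝ) < t := zero_lt_one.trans ht
      rw [norm_mul, norm_cpow_eq_rpow_re_of_pos ht0]
      have : (-(s + 1)).re = -s.re - 1 := by simp; ring
      rw [this]
      gcongr
      exact hS t
    · rw [integral_const_mul, integral_Ioi_rpow_of_lt (by linarith) zero_lt_one]
      simp
      field_simp
  calc _ ≤ ‖s‖ * (N / s.re) := by gcongr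
    _ = _ := by ring

open Complex Filter Topology in
/-- On horizontal rays the quotient `‖Γ (σ + it)‖ / Γ σ` is increasing. -/
theorem Complex.norm_Gamma_mul_Gamma_le {s : ℂ} (hs : 0 < s.re) {a : ℝ} (ha : 0 ≤ a) :
    ‖Gamma s‖ * Real.Gamma (s.re + a) ≤ ‖Gamma (s + a)‖ * Real.Gamma s.re := by
  have t1 : Tendsto (fun n ↦ ‖GammaSeq s n‖ * ‖GammaSeq ((s.re + a : ℝ) : ℂ) n‖) atTop
      (𝓝 (‖Gamma s‖ * ‖Gamma ((s.re + a : ℝ) : ℂ)‖)) :=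
    (GammaSeq_tendsto_Gamma _).norm.mul (GammaSeq_tendsto_Gamma _).norm
  have t2 : Tendsto (fun n ↦ ‖GammaSeq (s + a) n‖ * ‖GammaSeq (s.re : ℂ) n‖) atTop
      (𝓝 (‖Gamma (s + a)‖ * ‖Gamma (s.re : ℂ)‖)) :=
    (GammaSeq_tendsto_Gamma _).norm.mul (GammaSeq_tendsto_Gamma _).norm
  rw [Gamma_ofReal, norm_real, Real.norm_of_nonneg (Real.Gamma_pos_of_pos (by linarith)).le] at t1
  rw [Gamma_ofReal, norm_real, Real.norm_of_nonneg (Real.Gamma_pos_of_pos hs).le] at t2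
  refine le_of_tendsto_of_tendsto t1 t2 ?_
  filter_upwards [eventually_gt_atTop 0] with n hn
  have hpos : ∀ z : ℂ, 0 < z.re → ∀ j : ℕ, 0 < ‖z + j‖ := fun z hz j ↦ by
    rw [norm_pos_iff]
    intro h
    have := congrArg re h
    simp at this
    have : (0 : ℝ) ≤ j := j.cast_nonneg
    linarith
  have hprod : ∀ z : ℂ, 0 < z.re → 0 < ∏ j ∈ Finset.range (n + 1), ‖z + j‖ := fun z hz ↦
    Finset.prod_pos fun j _ ↦ hpos z hz j
  have hsa : 0 < (s + a).re := by simp; linarith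
  have key : (∏ j ∈ Finset.range (n + 1), ‖s + a + j‖) * ∏ j ∈ Finset.range (n + 1), ‖(s.re : ℂ) + j‖ ≤
      (∏ j ∈ Finset.range (n + 1), ‖s + j‖) *
        ∏ j ∈ Finset.range (n + 1), ‖((s.re + a : ℝ) : ℂ) + j‖ := by
    rw [← Finset.prod_mul_distrib, ← Finset.prod_mul_distrib]
    refine Finset.prod_le_prod (fun _ _ ↦ by positivity) fun j _ ↦ ?_
    have hj : (0 : ℝ) ≤ j := j.cast_nonneg
    rw [← abs_of_nonneg (by positivity : 0 ≤ ‖s + a + j‖ * ‖(s.re : ℂ) + j‖),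
      ← abs_of_nonneg (by positivity : 0 ≤ ‖s + j‖ * ‖((s.re + a : ℝ) : ℂ) + j‖), ← sq_le_sq,
      mul_pow, mul_pow]
    simp only [← normSq_eq_norm_sq, normSq_apply]
    simp
    have h1 : 0 ≤ (s.re + a + j) ^ 2 - (s.re + j) ^ 2 := by nlinarith
    nlinarith [mul_nonneg h1 (sq_nonneg s.im)]
  have hn' : (n : ℂ) ≠ 0 := by exact_mod_cast hn.ne'
  simp only [GammaSeq, norm_div, norm_mul, norm_prod, norm_natCast_cpow_of_pos hn]
  rw [div_mul_div_comm, div_mul_div_comm]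
  have e : (n : ℝ) ^ s.re * ‖(n.factorial : ℂ)‖ * ((n : ℝ) ^ ((s.re + a : ℝ) : ℂ).re * ‖(n.factorial : ℂ)‖) =
    (n : ℝ) ^ (s + a).re * ‖(n.factorial : ℂ)‖ * ((n : ℝ) ^ (s.re : ℂ).re * ‖(n.factorial : ℂ)‖) := by
    simp
    ring
  rw [e]
  exact div_le_div_of_nonneg_left (by positivity) (mul_pos (hprod _ hsa) (hprod _ (by simpa))) key

theorem Real.Gamma_le_exp_mul_Gamma_add {x a : ℝ} (hx : 1 / 8 ≤ x) (ha : 0 ≤ a) :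
    Real.Gamma x ≤ Real.exp (12 * a) * Real.Gamma (x + a) := by
  have h1 : Real.Gamma (x + 2) = (x + 1) * (x * Real.Gamma x) := by
    rw [← Real.Gamma_add_one (by linarith), ← Real.Gamma_add_one (by linarith)]
    congr 1; ring
  have h2 : Real.Gamma (x + a + 2) = (x + a + 1) * ((x + a) * Real.Gamma (x + a)) := by
    rw [← Real.Gamma_add_one (by linarith), ← Real.Gamma_add_one (by linarith)]
    congr 1; ring
  have h3 : Real.Gamma (x + 2) ≤ Real.Gamma (x + a + 2) :=
    Real.Gamma_strictMonoOn_Ici.monotoneOn (by simp; linarith) (by simp; linarith) (by linarith)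
  rw [h1, h2] at h3
  have h4 : x + a ≤ x * Real.exp (8 * a) := by
    have := Real.add_one_le_exp (8 * a)
    nlinarith
  have h5 : x + a + 1 ≤ (x + 1) * Real.exp a := by
    have := Real.add_one_le_exp a
    nlinarith
  have h6 : Real.exp (12 * a) = Real.exp (8 * a) * Real.exp a * Real.exp (3 * a) := by
    rw [← Real.exp_add, ← Real.exp_add]; congr 1; ring
  have h7 : 1 ≤ Real.exp (3 * a) := Real.one_le_exp (by linarith)
  have hG : 0 < Real.Gamma (x + a) := Real.Gamma_pos_of_pos (by linarith)
  have h8 : (x + 1) * x * Real.Gamma x ≤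
      (x + 1) * x * (Real.exp (8 * a) * Real.exp a * Real.Gamma (x + a)) := by
    calc _ ≤ (x + a + 1) * ((x + a) * Real.Gamma (x + a)) := by linarith
      _ ≤ ((x + 1) * Real.exp a) * ((x * Real.exp (8 * a)) * Real.Gamma (x + a)) := by
        gcongr
      _ = _ := by ring
  refine (le_of_mul_le_mul_left h8 (by nlinarith)).trans ?_
  rw [h6]
  refine mul_le_mul_of_nonneg_right ?_ hG.le
  exact le_mul_of_one_le_right (by positivity) h7

theorem Complex.norm_Gamma_le_exp_mul {s : ℂ} (hs : 1 / 8 ≤ s.re) {a : ℝ} (ha : 0 ≤ a) :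
    ‖Gamma s‖ ≤ Real.exp (12 * a) * ‖Gamma (s + a)‖ := by
  have h1 := norm_Gamma_mul_Gamma_le (by linarith : 0 < s.re) ha
  have hG : 0 < Real.Gamma (s.re + a) := Real.Gamma_pos_of_pos (by linarith)
  refine le_of_mul_le_mul_right (h1.trans ?_) hG
  calc _ ≤ ‖Gamma (s + a)‖ * (Real.exp (12 * a) * Real.Gamma (s.re + a)) := by
        gcongr
        exact Real.Gamma_le_exp_mul_Gamma_add hs ha
    _ = _ := by ring

theorem Complex.norm_Gammaℝ_le_exp_mul {s : ℂ} (hs : 1 / 4 ≤ s.re) {a : ℝ} (ha : 0 ≤ a) :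
    ‖Gammaℝ s‖ ≤ Real.exp (7 * a) * ‖Gammaℝ (s + a)‖ := by
  have hpi : (0 : ℝ) < Real.pi := Real.pi_pos
  rw [Gammaℝ_def, Gammaℝ_def, norm_mul, norm_mul, norm_cpow_eq_rpow_re_of_pos hpi,
    norm_cpow_eq_rpow_re_of_pos hpi]
  have e1 : (-s / 2).re = -s.re / 2 := by simp
  have e2 : (-(s + a) / 2).re = -s.re / 2 - a / 2 := by simp; ring
  have e3 : (s + a) / 2 = s / 2 + ((a / 2 : ℝ) : ℂ) := by push_cast; ring
  rw [e1, e2, e3]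
  have h1 := norm_Gamma_le_exp_mul (s := s / 2) (by simp; linarith) (by linarith : 0 ≤ a / 2)
  have h2 : Real.pi ^ (-s.re / 2) ≤ Real.exp a * Real.pi ^ (-s.re / 2 - a / 2) := by
    rw [Real.rpow_sub hpi, mul_div_assoc', le_div_iff₀ (by positivity), mul_comm]
    gcongr
    have : Real.pi ≤ Real.exp 2 := by
      have := Real.pi_le_four
      have h3 := Real.exp_one_gt_d9
      have h4 : Real.exp 2 = Real.exp 1 * Real.exp 1 := by rw [← Real.exp_add]; norm_num
      nlinarith
    calc _ ≤ (Real.exp 2) ^ (a / 2) := by gcongr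
      _ = _ := by rw [← Real.exp_mul]; congr 1; ring
  calc _ ≤ (Real.exp a * Real.pi ^ (-s.re / 2 - a / 2)) *
        (Real.exp (12 * (a / 2)) * ‖Gamma (s / 2 + ((a / 2 : ℝ) : ℂ))‖) := by gcongr
    _ = (Real.exp a * Real.exp (12 * (a / 2))) * (Real.pi ^ (-s.re / 2 - a / 2) *
        ‖Gamma (s / 2 + ((a / 2 : ℝ) : ℂ))‖) := by ring
    _ = _ := by
      rw [← Real.exp_add]
      congr 2
      ring

theorem DirichletCharacter.norm_gammaFactor_le_exp_mul {N : ℕ} (χ : DirichletCharacter ℂ N)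
    {s : ℂ} (hs : 1 / 4 ≤ s.re) {a : ℝ} (ha : 0 ≤ a) :
    ‖gammaFactor χ s‖ ≤ Real.exp (7 * a) * ‖gammaFactor χ (s + a)‖ := by
  rcases χ.even_or_odd with h | h
  · rw [h.gammaFactor_def, h.gammaFactor_def]
    exact Complex.norm_Gammaℝ_le_exp_mul hs ha
  · rw [h.gammaFactor_def, h.gammaFactor_def, add_right_comm]
    exact Complex.norm_Gammaℝ_le_exp_mul (by simp; linarith) ha

theorem DirichletCharacter.differentiableAt_gammaFactor {N : ℕ} (χ : DirichletCharacter ℂ N)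
    {s : ℂ} (hs : 0 < s.re) : DifferentiableAt ℂ (gammaFactor χ) s := by
  have key : ∀ z : ℂ, 0 < z.re → DifferentiableAt ℂ Complex.Gammaℝ z := by
    intro z hz
    have h1 : DifferentiableAt ℂ Complex.Gamma (z / 2) :=
      Complex.differentiableAt_Gamma _ fun m h ↦ by
        have := congrArg Complex.re h
        simp at this
        have : (0 : ℝ) ≤ m := m.cast_nonneg
        linarith
    have h2 : DifferentiableAt ℂ (fun z : ℂ ↦ (Real.pi : ℂ) ^ (-z / 2)) z :=
      DifferentiableAt.const_cpow (by fun_prop) (Or.inl (by exact_mod_cast Real.pi_ne_zero))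
    exact h2.mul (h1.comp z (by fun_prop : DifferentiableAt ℂ (fun z : ℂ ↦ z / 2) z))
  rcases χ.even_or_odd with h | h
  · rw [show gammaFactor χ = Complex.Gammaℝ from funext h.gammaFactor_def]
    exact key s hs
  · rw [show gammaFactor χ = fun s ↦ Complex.Gammaℝ (s + 1) from funext h.gammaFactor_def]
    have h1 := key (s + 1) (by simp; linarith)
    exact DifferentiableAt.comp (f := fun s : ℂ ↦ s + 1) s h1 (by fun_prop)

theorem DirichletCharacter.gammaFactor_ne_zero {N : ℕ} (χ : DirichletCharacter ℂ N)
    {s : ℂ} (hs : 0 < s.re) : gammaFactor χ s ≠ 0 := by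
  rcases χ.even_or_odd with h | h
  · rw [h.gammaFactor_def]
    exact Complex.Gammaℝ_ne_zero_of_re_pos hs
  · rw [h.gammaFactor_def]
    exact Complex.Gammaℝ_ne_zero_of_re_pos (by simp; linarith)

open Filter Topology in
theorem Complex.neg_le_re_logDeriv {f : ℂ → ℂ} {s : ℂ} (hf : DifferentiableAt ℂ f s) (hfs : f s ≠ 0)
    {C : ℝ} (h : ∀ᶠ a : ℝ in 𝓝[>] 0, ‖f (s - a)‖ ≤ Real.exp (2 * C * a) * ‖f (s + a)‖) :
    -C ≤ (logDeriv f s).re := by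
  let φ : ℝ → ℝ := fun a ↦ ‖f (s + a)‖ ^ 2 * Real.exp (2 * C * a)
  have hf' : HasDerivAt f (deriv f s) s := hf.hasDerivAt
  have hg : HasDerivAt (fun a : ℝ ↦ f (s + a)) (deriv f s) 0 := by
    have h1 : HasDerivAt (fun z : ℂ ↦ f (s + z)) (deriv f s) ((0 : ℝ) : ℂ) := by
      have : HasDerivAt f (deriv f s) (s + ((0 : ℝ) : ℂ)) := by simpa using hf'
      exact this.comp_const_add s _
    exact h1.comp_ofReal
  have hφ : HasDerivAt φ (2 * inner ℝ (f s) (deriv f s) + ‖f s‖ ^ 2 * (2 * C)) 0 := by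
    have h1 := hg.norm_sq
    have h2 : HasDerivAt (fun a : ℝ ↦ Real.exp (2 * C * a)) (2 * C) 0 := by
      have := ((hasDerivAt_id (0 : ℝ)).const_mul (2 * C)).exp
      simpa using this
    have := h1.fun_mul h2
    simpa only [ofReal_zero, add_zero, mul_zero, Real.exp_zero, mul_one] using! this
  have hψ : HasDerivAt (fun a ↦ φ a - φ (-a))
      (2 * (2 * inner ℝ (f s) (deriv f s) + ‖f s‖ ^ 2 * (2 * C))) 0 := by
    have h1 : HasDerivAt φ (2 * inner ℝ (f s) (deriv f s) + ‖f s‖ ^ 2 * (2 * C)) (-0) := by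
      simpa using hφ
    have h2 := h1.scomp (0 : ℝ) (hasDerivAt_neg (0 : ℝ))
    have := hφ.sub h2
    refine (this.congr_deriv ?_)
    simp
    ring
  have hnn : 0 ≤ 2 * (2 * inner ℝ (f s) (deriv f s) + ‖f s‖ ^ 2 * (2 * C)) := by
    have ht := hψ.tendsto_slope_zero_right
    refine ge_of_tendsto ht ?_
    filter_upwards [h, self_mem_nhdsWithin] with a ha ha0
    have ha0 : 0 < a := ha0
    simp only [zero_add, neg_zero, sub_self, sub_zero, smul_eq_mul]
    refine mul_nonneg (by positivity) (sub_nonneg.2 ?_)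
    have e0 : φ (-a) = ‖f (s - a)‖ ^ 2 * Real.exp (-(2 * C * a)) := by
      simp only [φ, ofReal_neg, ← sub_eq_add_neg, mul_neg]
    rw [e0]
    have e : Real.exp (2 * C * a) = Real.exp (2 * C * a) ^ 2 * Real.exp (-(2 * C * a)) := by
      rw [← Real.exp_nat_mul, ← Real.exp_add]; congr 1; push_cast; ring
    calc ‖f (s - a)‖ ^ 2 * Real.exp (-(2 * C * a))
        ≤ (Real.exp (2 * C * a) * ‖f (s + a)‖) ^ 2 * Real.exp (-(2 * C * a)) := by gcongr
      _ = Real.exp (2 * C * a) ^ 2 * Real.exp (-(2 * C * a)) * ‖f (s + a)‖ ^ 2 := by ring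
      _ = _ := by rw [← e, mul_comm]
  have hpos : 0 < ‖f s‖ ^ 2 := by positivity
  have hlog : (logDeriv f s).re * ‖f s‖ ^ 2 = inner ℝ (f s) (deriv f s) := by
    rw [logDeriv_apply, Complex.inner, div_eq_mul_inv, inv_def, ← normSq_eq_norm_sq]
    have : normSq (f s) ≠ 0 := normSq_eq_zero.not.2 hfs
    rw [← mul_assoc, re_mul_ofReal]
    field_simp
  rw [← hlog] at hnn
  nlinarith

open Complex Metric Set in
/-- A holomorphic function without zeros on a disc, bounded above there, is bounded below. -/
theorem Complex.norm_mul_exp_le_norm_of_ne_zero {f : ℂ → ℂ} {c z : ℂ} {R M : ℝ} (hM : 0 < M)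
    (hf : DifferentiableOn ℂ f (ball c R)) (h0 : ∀ w ∈ ball c R, f w ≠ 0)
    (hb : ∀ w ∈ ball c R, ‖f w‖ ≤ ‖f c‖ * Real.exp M) (hz : z ∈ ball c R) :
    ‖f c‖ * Real.exp (-(2 * M * ‖z - c‖ / (R - ‖z - c‖))) ≤ ‖f z‖ := by
  have hR : 0 < R := dist_nonneg.trans_lt (mem_ball.1 hz)
  have hc : c ∈ ball c R := mem_ball_self hR
  have hfc := h0 c hc
  have hdiv : DifferentiableOn ℂ (fun w ↦ deriv f w / f w) (ball c R) :=
    (hf.deriv isOpen_ball).div hf h0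
  obtain ⟨g, hgc, hg⟩ := hdiv.isExactOn_ball.with_val_at c 0
  have hconst : ∀ w ∈ ball c R, f w * exp (-g w) = f c := by
    intro w hw
    have hd : ∀ y ∈ ball c R, HasDerivAt (fun y ↦ f y * exp (-g y)) 0 y := by
      intro y hy
      have h1 : HasDerivAt f (deriv f y) y :=
        ((hf y hy).differentiableAt (isOpen_ball.mem_nhds hy)).hasDerivAt
      refine (h1.mul (hg y hy).neg.cexp).congr_deriv ?_
      have := h0 y hy
      field_simp
      ring
    have := isOpen_ball.is_const_of_deriv_eq_zero (convex_ball c R).isPreconnected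
      (fun y hy ↦ (hd y hy).differentiableAt.differentiableWithinAt)
      (fun y hy ↦ (hd y hy).deriv) hw hc
    rw [this, hgc]
    simp
  have hfexp : ∀ w ∈ ball c R, f w = f c * exp (g w) := by
    intro w hw
    rw [← hconst w hw, mul_assoc, ← exp_add]
    simp
  have hre : ∀ w ∈ ball c R, (g w).re ≤ M := by
    intro w hw
    have h1 := hb w hw
    rw [hfexp w hw, norm_mul, norm_exp] at h1
    exact Real.exp_le_exp.1 (le_of_mul_le_mul_left h1 (norm_pos_iff.2 hfc))
  have hmaps : ∀ w ∈ ball (0 : ℂ) R, w + c ∈ ball c R := fun w hw ↦ by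
    simpa using hw
  have hB := borelCaratheodory_zero (f := fun w ↦ g (w + c)) (z := z - c) hM
    (fun w hw ↦ (((hg _ (hmaps w hw)).differentiableAt).comp w
      (by fun_prop : DifferentiableAt ℂ (fun w ↦ w + c) w)).differentiableWithinAt)
    (fun w hw ↦ hre _ (hmaps w hw)) hR (by simpa [dist_eq_norm] using hz) (by simpa using hgc)
  simp only [sub_add_cancel] at hB
  rw [hfexp z hz, norm_mul, norm_exp]
  gcongr
  exact (neg_le_neg hB).trans ((abs_le.1 (abs_re_le_norm (g z))).1)

open Complex LSeries in
theorem norm_LSeries_le_two {f : ℕ → ℂ} (hf : ∀ n, ‖f n‖ ≤ 1) {s : ℂ} (hs : 2 ≤ s.re) :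
    ‖LSeries f s‖ ≤ 2 := by
  have hb : ∀ n, ‖term f s n‖ ≤ 1 / (n : ℝ) ^ 2 := by
    intro n
    rw [norm_term_eq]
    split_ifs with h
    · positivity
    · have h1 : (1 : ℝ) ≤ n := by exact_mod_cast Nat.one_le_iff_ne_zero.2 h
      refine div_le_div₀ zero_le_one (hf n) (by positivity) ?_
      rw [← Real.rpow_natCast]
      exact Real.rpow_le_rpow_of_exponent_le h1 (by simpa using hs)
  refine (tsum_of_norm_bounded hasSum_zeta_two hb).trans ?_
  nlinarith [Real.pi_lt_d2, Real.pi_pos]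

namespace DirichletCharacter

variable {N : ℕ}

open Complex ComplexConjugate in
theorem norm_gammaFactor_inv_conj (χ : DirichletCharacter ℂ N) (s : ℂ) :
    ‖gammaFactor χ⁻¹ (conj s)‖ = ‖gammaFactor χ s‖ := by
  have key : ∀ z : ℂ, ‖Gammaℝ (conj z)‖ = ‖Gammaℝ z‖ := by
    intro z
    have e : conj z / 2 = conj (z / 2) := by rw [map_div₀, conj_ofNat]
    rw [Gammaℝ_def, Gammaℝ_def, norm_mul, norm_mul, norm_cpow_eq_rpow_re_of_pos Real.pi_pos,
      norm_cpow_eq_rpow_re_of_pos Real.pi_pos, e, Gamma_conj, norm_conj]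
    simp
  have hinv : χ⁻¹ (-1) = χ (-1) := by
    rcases χ.even_or_odd with h | h
    · rw [MulChar.inv_apply_eq_inv', h, inv_one]
    · rw [MulChar.inv_apply_eq_inv', h, inv_neg, inv_one]
  rcases χ.even_or_odd with h | h
  · have h' : χ⁻¹.Even := by rw [Even, hinv, h]
    rw [h.gammaFactor_def, h'.gammaFactor_def, key]
  · have h' : χ⁻¹.Odd := by rw [Odd, hinv, h]
    have e : conj s + 1 = conj (s + 1) := by simp
    rw [h.gammaFactor_def, h'.gammaFactor_def, e, key]

variable [NeZero N]

open Complex in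
theorem norm_LFunction_le_two (χ : DirichletCharacter ℂ N) {s : ℂ} (hs : 2 ≤ s.re) :
    ‖LFunction χ s‖ ≤ 2 := by
  rw [LFunction_eq_LSeries χ (by linarith)]
  exact norm_LSeries_le_two (fun n ↦ χ.norm_le_one _) hs

open Complex in
theorem half_le_norm_LFunction (χ : DirichletCharacter ℂ N) {s : ℂ} (hs : 2 ≤ s.re) :
    1 / 2 ≤ ‖LFunction χ s‖ := by
  rw [LFunction_eq_LSeries χ (by linarith)]
  have h1 := congrArg norm (LSeries.mul_mu_eq_one χ (by linarith : 1 < s.re))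
  rw [norm_mul, norm_one] at h1
  have h2 : ‖LSeries ((fun n : ℕ ↦ χ n) * fun n ↦ (ArithmeticFunction.moebius n : ℂ)) s‖ ≤ 2 := by
    refine norm_LSeries_le_two (fun n ↦ ?_) hs
    rw [Pi.mul_apply, norm_mul]
    refine mul_le_one₀ (χ.norm_le_one _) (norm_nonneg _) ?_
    rw [norm_intCast]
    exact_mod_cast ArithmeticFunction.abs_moebius_le_one
  have h3 := norm_nonneg (LSeries (fun n : ℕ ↦ χ n) s)
  nlinarith

open Complex Metric in
theorem exp_neg_le_norm_LFunction {χ : DirichletCharacter ℂ N} (hχ : χ ≠ 1)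
    (h0 : ∀ s : ℂ, 1 / 2 < s.re → LFunction χ s ≠ 0) {a : ℝ} (ha : 0 < a) {s : ℂ}
    (hs : 1 / 2 + a ≤ s.re) :
    1 / 2 * Real.exp (-(24 * N * (‖s‖ + 4) / a)) ≤ ‖LFunction χ s‖ := by
  have hexp : Real.exp (-(24 * N * (‖s‖ + 4) / a)) ≤ 1 :=
    Real.exp_le_one_iff.2 (by rw [neg_nonpos]; positivity)
  rcases le_or_gt 2 s.re with h2 | h2
  · exact (mul_le_of_le_one_right (by norm_num) hexp).trans (half_le_norm_LFunction χ h2)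
  set c : ℂ := ⟨2, s.im⟩ with hc
  have hsc : s - c = ((s.re - 2 : ℝ) : ℂ) := by apply Complex.ext <;> simp [c]
  have hnsc : ‖s - c‖ = 2 - s.re := by
    rw [hsc, norm_real, Real.norm_eq_abs, abs_of_neg (by linarith), neg_sub]
  have hs_mem : s ∈ ball c (3 / 2) := by
    rw [mem_ball, dist_eq_norm, hnsc]; linarith
  have hre : ∀ w ∈ ball c (3 / 2), 1 / 2 < w.re := by
    intro w hw
    rw [mem_ball, dist_eq_norm] at hw
    have := (abs_lt.1 ((abs_re_le_norm _).trans_lt hw)).1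
    simp [c] at this
    linarith
  have hLc := half_le_norm_LFunction χ (s := c) (by simp [c])
  have hN : (1 : ℝ) ≤ N := by exact_mod_cast NeZero.one_le
  set M : ℝ := 8 * N * (‖s‖ + 4) with hM
  have hMpos : 0 < M := by positivity
  have hbd : ∀ w ∈ ball c (3 / 2), ‖LFunction χ w‖ ≤ ‖LFunction χ c‖ * Real.exp M := by
    intro w hw
    have hw1 := hre w hw
    have hws : ‖w‖ ≤ ‖s‖ + 4 := by
      rw [mem_ball, dist_eq_norm] at hw
      have e : w = (w - c) + (c - s) + s := by ring
      have h3 : ‖c - s‖ = 2 - s.re := by rw [norm_sub_rev, hnsc]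
      calc ‖w‖ = ‖(w - c) + (c - s) + s‖ := by rw [← e]
        _ ≤ ‖w - c‖ + ‖c - s‖ + ‖s‖ := norm_add₃_le
        _ ≤ _ := by rw [h3]; linarith
    have h4 := norm_LFunction_le hχ (by linarith : 0 < w.re)
    have h5 : ‖w‖ / w.re ≤ 2 * (‖s‖ + 4) := by
      rw [div_le_iff₀ (by linarith)]
      nlinarith [norm_nonneg s]
    have h6 : M ≤ Real.exp M := by linarith [Real.add_one_le_exp M]
    calc _ ≤ N * (‖w‖ / w.re) := h4
      _ ≤ N * (2 * (‖s‖ + 4)) := by gcongr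
      _ ≤ 1 / 2 * M := by rw [hM]; nlinarith [norm_nonneg s]
      _ ≤ _ := by gcongr
  have key := norm_mul_exp_le_norm_of_ne_zero hMpos (differentiable_LFunction hχ).differentiableOn
    (fun w hw ↦ h0 w (hre w hw)) hbd hs_mem
  refine le_trans ?_ key
  refine mul_le_mul hLc (Real.exp_le_exp.2 (neg_le_neg ?_)) (Real.exp_nonneg _) (norm_nonneg _)
  rw [hnsc]
  have h7 : 2 * M * (2 - s.re) ≤ 3 * M := by nlinarith
  calc 2 * M * (2 - s.re) / (3 / 2 - (2 - s.re)) ≤ 3 * M / a := by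
        gcongr
        linarith
    _ = _ := by rw [hM]; ring

open Complex ComplexConjugate Topology in
theorem LFunction_inv_conj {χ : DirichletCharacter ℂ N} (hχ : χ ≠ 1) (s : ℂ) :
    LFunction χ⁻¹ (conj s) = conj (LFunction χ s) := by
  have hd : Differentiable ℂ (conj ∘ LFunction χ ∘ conj) := fun z ↦
    differentiableAt_conj_conj_iff.2 (differentiable_LFunction hχ _)
  have hd' : Differentiable ℂ (LFunction χ⁻¹) := differentiable_LFunction (inv_ne_one.2 hχ)
  have heq : LFunction χ⁻¹ = conj ∘ LFunction χ ∘ conj := by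
    refine AnalyticOnNhd.eq_of_eventuallyEq (z₀ := 2) (fun z _ ↦ hd'.analyticAt z)
      (fun z _ ↦ hd.analyticAt z) ?_
    filter_upwards [(isOpen_lt continuous_const continuous_re : IsOpen {z : ℂ | 1 < z.re}).mem_nhds
      (by simp : (2 : ℂ) ∈ {z : ℂ | 1 < z.re})] with z hz
    have hz' : 1 < (conj z).re := by simpa using hz
    rw [Function.comp_apply, Function.comp_apply, LFunction_eq_LSeries _ hz,
      LFunction_eq_LSeries _ hz', LSeries, LSeries, Complex.conj_tsum]
    congr 1
    ext n
    rcases eq_or_ne n 0 with rfl | hn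
    · simp
    · rw [LSeries.term_of_ne_zero hn, LSeries.term_of_ne_zero hn, map_div₀, ← MulChar.star_apply',
        cpow_conj _ _ (by rw [natCast_arg]; exact Real.pi_pos.ne), conj_conj, conj_natCast]
      rfl
  rw [heq]
  simp

end DirichletCharacter

namespace DirichletCharacter

open Filter Topology in
theorem neg_seven_le_re_logDeriv_gammaFactor {N : ℕ} (χ : DirichletCharacter ℂ N) {s : ℂ}
    (hs : 1 / 2 < s.re) : -7 ≤ (logDeriv (gammaFactor χ) s).re := by
  refine Complex.neg_le_re_logDeriv (differentiableAt_gammaFactor χ (by linarith))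
    (gammaFactor_ne_zero χ (by linarith)) ?_
  filter_upwards [Ioo_mem_nhdsGT (by norm_num : (0 : ℝ) < 1 / 4)] with a ha
  have := norm_gammaFactor_le_exp_mul χ (s := s - a) (a := 2 * a)
    (by simp; linarith [ha.2]) (by linarith [ha.1])
  have e : s - a + ((2 * a : ℝ) : ℂ) = s + a := by push_cast; ring
  rw [e] at this
  convert this using 3
  ring

variable {N : ℕ} [NeZero N]

/-- The completed `L`-function of a Dirichlet character, with the conductor factor. -/
noncomputable def symmetricLFunction (χ : DirichletCharacter ℂ N) (s : ℂ) : ℂ :=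
  (N : ℂ) ^ (s / 2) * gammaFactor χ s * LFunction χ s

open Complex ComplexConjugate in
theorem norm_symmetricLFunction_one_sub_conj_eq_mul {χ : DirichletCharacter ℂ N} (hχ : χ ≠ 1)
    (hp : χ.IsPrimitive) {s : ℂ} (h0 : 0 < s.re) (h1 : s.re < 1) :
    ‖symmetricLFunction χ (1 - conj s)‖ = ‖rootNumber χ‖ * ‖symmetricLFunction χ s‖ := by
  have hN : 0 < N := NeZero.pos N
  have hN1 : N ≠ 1 := fun h ↦ by
    subst h
    exact hχ (Subsingleton.elim _ _)
  have hmul : ∀ ψ : DirichletCharacter ℂ N, ∀ z : ℂ, 0 < z.re →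
      gammaFactor ψ z * LFunction ψ z = completedLFunction ψ z := by
    intro ψ z hz
    rw [LFunction_eq_completed_div_gammaFactor ψ z (Or.inr hN1),
      mul_div_cancel₀ _ (gammaFactor_ne_zero ψ hz)]
  have hre : 0 < (1 - conj s).re := by simpa using h1
  have hcre : 0 < (conj s).re := by simpa using h0
  rw [symmetricLFunction, symmetricLFunction, mul_assoc, hmul _ _ hre,
    hp.completedLFunction_one_sub, ← hmul _ _ hcre, LFunction_inv_conj hχ]
  simp only [norm_mul, norm_gammaFactor_inv_conj, norm_conj, norm_natCast_cpow_of_pos hN]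
  have e : (N : ℝ) ^ ((1 - conj s) / 2).re * (N : ℝ) ^ (conj s - 1 / 2).re = (N : ℝ) ^ (s / 2).re := by
    rw [← Real.rpow_add (by exact_mod_cast hN)]
    congr 1
    simp
    ring
  rw [← e]
  ring

open Complex ComplexConjugate in
theorem norm_symmetricLFunction_one_sub_conj {χ : DirichletCharacter ℂ N} (hχ : χ ≠ 1)
    (hp : χ.IsPrimitive) (hL : ∀ s : ℂ, 1 / 2 < s.re → LFunction χ s ≠ 0) {s : ℂ} (h0 : 0 < s.re)
    (h1 : s.re < 1) : ‖symmetricLFunction χ (1 - conj s)‖ = ‖symmetricLFunction χ s‖ := by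
  have hr : ‖rootNumber χ‖ = 1 := by
    have e1 := norm_symmetricLFunction_one_sub_conj_eq_mul hχ hp (s := 3 / 4) (by norm_num)
      (by norm_num)
    have e2 := norm_symmetricLFunction_one_sub_conj_eq_mul hχ hp (s := 1 / 4) (by norm_num)
      (by norm_num)
    have c1 : (1 : ℂ) - conj (3 / 4 : ℂ) = 1 / 4 := by
      rw [map_div₀, conj_ofNat, conj_ofNat]; norm_num
    have c2 : (1 : ℂ) - conj (1 / 4 : ℂ) = 3 / 4 := by
      rw [map_div₀, map_one, conj_ofNat]; norm_num
    rw [c1] at e1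
    rw [c2, e1, ← mul_assoc] at e2
    have hpos : 0 < ‖symmetricLFunction χ (3 / 4)‖ := by
      rw [norm_pos_iff, symmetricLFunction]
      refine mul_ne_zero (mul_ne_zero ?_ (gammaFactor_ne_zero χ (by norm_num)))
        (hL _ (by norm_num))
      rw [Ne, cpow_eq_zero_iff]
      exact fun h ↦ NeZero.ne N (by exact_mod_cast h.1)
    have : ‖rootNumber χ‖ * ‖rootNumber χ‖ = 1 := by
      refine mul_right_cancel₀ hpos.ne' ?_
      rw [← e2, one_mul]
    nlinarith [norm_nonneg (rootNumber χ)]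
  rw [norm_symmetricLFunction_one_sub_conj_eq_mul hχ hp h0 h1, hr, one_mul]

theorem differentiableAt_symmetricLFunction {χ : DirichletCharacter ℂ N} (hχ : χ ≠ 1) {s : ℂ}
    (hs : 0 < s.re) : DifferentiableAt ℂ (symmetricLFunction χ) s := by
  refine (DifferentiableAt.mul ?_ (differentiableAt_gammaFactor χ hs)).mul
    (differentiable_LFunction hχ s)
  exact DifferentiableAt.const_cpow (by fun_prop) (Or.inl (NeZero.ne _))

open Complex in
theorem symmetricLFunction_ne_zero {χ : DirichletCharacter ℂ N} {s : ℂ}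
    (hs : 0 < s.re) (hL : LFunction χ s ≠ 0) : symmetricLFunction χ s ≠ 0 := by
  refine mul_ne_zero (mul_ne_zero ?_ (gammaFactor_ne_zero χ hs)) hL
  rw [Ne, cpow_eq_zero_iff]
  exact fun h ↦ NeZero.ne N (by exact_mod_cast h.1)

open Complex Filter Asymptotics ComplexConjugate Bornology in
/-- If `L(s, χ)` has no zeros to the right of the critical line, then the completed
`L`-function increases in absolute value along horizontal rays there. -/
theorem norm_symmetricLFunction_sub_le {χ : DirichletCharacter ℂ N} (hχ : χ ≠ 1)
    (hp : χ.IsPrimitive) (hL : ∀ s : ℂ, 1 / 2 < s.re → LFunction χ s ≠ 0) {a : ℝ} (ha : 0 < a)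
    (ha4 : a ≤ 1 / 4) {s : ℂ} (hs : 1 / 2 ≤ s.re) :
    ‖symmetricLFunction χ (s - a)‖ ≤ ‖symmetricLFunction χ (s + a)‖ := by
  have hN : 0 < N := NeZero.pos N
  have hN' : (1 : ℝ) ≤ N := by exact_mod_cast hN
  let R : ℂ → ℂ := fun z ↦ symmetricLFunction χ (1 / 2 + z - a) / symmetricLFunction χ (1 / 2 + z + a)
  have hden : ∀ z : ℂ, -a < z.re → symmetricLFunction χ (1 / 2 + z + a) ≠ 0 := by
    intro z hz
    have : 1 / 2 < (1 / 2 + z + a).re := by simp; linarith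
    exact symmetricLFunction_ne_zero (by linarith) (hL _ this)
  have hd : ∀ z : ℂ, -a < z.re → DifferentiableAt ℂ R z := by
    intro z hz
    refine DifferentiableAt.fun_div ?_ ?_ (hden z hz)
    · exact (differentiableAt_symmetricLFunction hχ (by simp; linarith)).comp
        (f := fun z : ℂ ↦ 1 / 2 + z - a) z (by fun_prop)
    · exact (differentiableAt_symmetricLFunction hχ (by simp; linarith)).comp
        (f := fun z : ℂ ↦ 1 / 2 + z + a) z (by fun_prop)
  have hfactor : ∀ z : ℂ, 0 ≤ z.re → ‖R z‖ ≤ Real.exp (14 * a) *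
      (‖LFunction χ (1 / 2 + z - a)‖ / ‖LFunction χ (1 / 2 + z + a)‖) := by
    intro z hz
    simp only [R, symmetricLFunction, norm_div, norm_mul, norm_natCast_cpow_of_pos hN]
    have h1 : (N : ℝ) ^ ((1 / 2 + z - a) / 2).re ≤ (N : ℝ) ^ ((1 / 2 + z + a) / 2).re := by
      refine Real.rpow_le_rpow_of_exponent_le hN' ?_
      simp
      linarith
    have h2 := norm_gammaFactor_le_exp_mul χ (s := 1 / 2 + z - a) (a := 2 * a)
      (by simp; linarith) (by linarith)
    have e : (1 / 2 + z - a + ((2 * a : ℝ) : ℂ)) = 1 / 2 + z + a := by push_cast; ring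
    rw [e] at h2
    have h3 : 0 < ‖gammaFactor χ (1 / 2 + z + a)‖ :=
      norm_pos_iff.2 (gammaFactor_ne_zero χ (by simp; linarith))
    have h4 : 0 < (N : ℝ) ^ ((1 / 2 + z + a) / 2).re := by positivity
    rw [mul_div_mul_comm]
    gcongr
    rw [div_le_iff₀ (by positivity)]
    calc _ ≤ (N : ℝ) ^ ((1 / 2 + z + a) / 2).re *
          (Real.exp (7 * (2 * a)) * ‖gammaFactor χ (1 / 2 + z + a)‖) := by gcongr
      _ = _ := by rw [← mul_assoc 7]; norm_num; ring
  have hPL : ∀ z : ℂ, 0 ≤ z.re → ‖R z‖ ≤ 1 := by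
    intro z hz
    refine PhragmenLindelof.right_half_plane_of_bounded_on_real (f := R) ?_ ?_ ?_ ?_ hz
    · refine DifferentiableOn.diffContOnCl fun z hz ↦ (hd z ?_).differentiableWithinAt
      have hcl : IsClosed {z : ℂ | 0 ≤ z.re} := isClosed_le continuous_const continuous_re
      have hsub : {w : ℂ | 0 < w.re} ⊆ {w : ℂ | 0 ≤ w.re} := by
        intro w hw
        have hw' : 0 < w.re := hw
        exact hw'.le
      have : 0 ≤ z.re := closure_minimal hsub hcl hz
      linarith
    · set B : ℝ := 4 * N + 24 * N / a
      refine ⟨1, by norm_num, B, ?_⟩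
      refine IsBigO.of_bound (2 * Real.exp (14 * a) * Real.exp (B * 5)) ?_
      rw [eventually_inf_principal]
      refine Eventually.of_forall fun z hz ↦ ?_
      have hz : 0 < z.re := hz
      refine (hfactor z hz.le).trans ?_
      have hu1 : ‖1 / 2 + z - a‖ ≤ ‖z‖ + 1 := by
        calc ‖1 / 2 + z - a‖ = ‖z + ((1 / 2 - a : ℝ) : ℂ)‖ := by congr 1; push_cast; ring
          _ ≤ ‖z‖ + ‖((1 / 2 - a : ℝ) : ℂ)‖ := norm_add_le _ _
          _ ≤ _ := by
            rw [norm_real, Real.norm_of_nonneg (by linarith)]; linarith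
      have hu2 : ‖1 / 2 + z + a‖ ≤ ‖z‖ + 1 := by
        calc ‖1 / 2 + z + a‖ = ‖z + ((1 / 2 + a : ℝ) : ℂ)‖ := by congr 1; push_cast; ring
          _ ≤ ‖z‖ + ‖((1 / 2 + a : ℝ) : ℂ)‖ := norm_add_le _ _
          _ ≤ _ := by
            rw [norm_real, Real.norm_of_nonneg (by linarith)]; linarith
      have hr1 : 1 / 4 ≤ (1 / 2 + z - a).re := by simp; linarith
      have hr2 : 1 / 2 + a ≤ (1 / 2 + z + a).re := by simp; linarith
      have hL1 : ‖LFunction χ (1 / 2 + z - a)‖ ≤ Real.exp (4 * N * (‖z‖ + 5)) := by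
        have h1 := norm_LFunction_le hχ (by linarith : 0 < (1 / 2 + z - a).re)
        have h2 : ‖1 / 2 + z - a‖ / (1 / 2 + z - a).re ≤ 4 * (‖z‖ + 5) := by
          rw [div_le_iff₀ (by linarith)]
          nlinarith [norm_nonneg z]
        calc _ ≤ N * (‖1 / 2 + z - a‖ / (1 / 2 + z - a).re) := h1
          _ ≤ N * (4 * (‖z‖ + 5)) := by gcongr
          _ = 4 * N * (‖z‖ + 5) := by ring
          _ ≤ _ := by linarith [Real.add_one_le_exp (4 * N * (‖z‖ + 5))]
      have hL2 : 1 / 2 * Real.exp (-(24 * N / a * (‖z‖ + 5))) ≤ ‖LFunction χ (1 / 2 + z + a)‖ := by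
        refine le_trans ?_ (exp_neg_le_norm_LFunction hχ hL ha hr2)
        gcongr
        rw [div_mul_eq_mul_div]
        exact div_le_div_of_nonneg_right (mul_le_mul_of_nonneg_left (by linarith) (by positivity))
          ha.le
      have hexp : Real.exp (4 * N * (‖z‖ + 5)) / (1 / 2 * Real.exp (-(24 * N / a * (‖z‖ + 5)))) =
          2 * (Real.exp (B * 5) * Real.exp (B * ‖z‖)) := by
        rw [Real.exp_neg, ← Real.exp_add]
        have : B * 5 + B * ‖z‖ = 4 * N * (‖z‖ + 5) + 24 * N / a * (‖z‖ + 5) := by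
          simp only [B]; ring
        rw [this, Real.exp_add]
        field_simp
      calc _ ≤ Real.exp (14 * a) * (Real.exp (4 * N * (‖z‖ + 5)) /
            (1 / 2 * Real.exp (-(24 * N / a * (‖z‖ + 5))))) := by gcongr
        _ = _ := by
          rw [hexp, Real.rpow_one, Real.norm_of_nonneg (Real.exp_nonneg _)]
          ring
    · refine isBoundedUnder_of_eventually_le (a := Real.exp (14 * a) * 4) ?_
      filter_upwards [eventually_ge_atTop 2] with x hx
      refine (hfactor x (by simp; linarith)).trans ?_
      have h1 := norm_LFunction_le_two χ (s := 1 / 2 + x - a) (by simp; linarith)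
      have h2 := half_le_norm_LFunction χ (s := 1 / 2 + x + a) (by simp; linarith)
      gcongr
      rw [div_le_iff₀ (by linarith)]
      linarith
    · intro t
      have e : 1 / 2 + t * I - a = 1 - conj (1 / 2 + t * I + a : ℂ) := by
        simp only [map_add, map_div₀, map_one, map_mul, conj_ofReal, conj_I, conj_ofNat]
        ring
      simp only [R]
      rw [norm_div, e, norm_symmetricLFunction_one_sub_conj hχ hp hL (by simp; linarith)
        (by simp; linarith)]
      exact div_self_le_one _
  have h1 := hPL (s - 1 / 2) (by simpa using hs)
  simp only [R] at h1
  have e1 : 1 / 2 + (s - 1 / 2) - (a : ℂ) = s - a := by ring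
  have e2 : 1 / 2 + (s - 1 / 2) + (a : ℂ) = s + a := by ring
  have h2 := hden (s - 1 / 2) (by simp; linarith)
  rw [e1, e2, norm_div] at h1
  rw [e2] at h2
  rwa [div_le_one (norm_pos_iff.2 h2)] at h1

open Filter Topology in
theorem logDeriv_symmetricLFunction_re_nonneg {χ : DirichletCharacter ℂ N} (hχ : χ ≠ 1)
    (hp : χ.IsPrimitive) (hL : ∀ s : ℂ, 1 / 2 < s.re → LFunction χ s ≠ 0) {s : ℂ}
    (hs : 1 / 2 < s.re) : 0 ≤ (logDeriv (symmetricLFunction χ) s).re := by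
  have := Complex.neg_le_re_logDeriv (C := 0)
    (differentiableAt_symmetricLFunction hχ (by linarith : 0 < s.re))
    (symmetricLFunction_ne_zero (by linarith) (hL s hs)) (by
      filter_upwards [Ioo_mem_nhdsGT (by norm_num : (0 : ℝ) < 1 / 4)] with a ha
      simpa using norm_symmetricLFunction_sub_le hχ hp hL ha.1 ha.2.le hs.le)
  simpa using this

theorem logDeriv_symmetricLFunction {χ : DirichletCharacter ℂ N} (hχ : χ ≠ 1) {s : ℂ}
    (hs : 0 < s.re) (hL : LFunction χ s ≠ 0) :
    logDeriv (symmetricLFunction χ) s =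
      Real.log N / 2 + logDeriv (gammaFactor χ) s + logDeriv (LFunction χ) s := by
  have hN : (N : ℂ) ≠ 0 := NeZero.ne _
  have hc : (N : ℂ) ^ (s / 2) ≠ 0 := by
    rw [Ne, Complex.cpow_eq_zero_iff]
    exact fun h ↦ hN h.1
  have hd : HasDerivAt (fun s : ℂ ↦ (N : ℂ) ^ (s / 2))
      ((N : ℂ) ^ (s / 2) * Complex.log N * (1 / 2)) s :=
    ((hasDerivAt_id s).div_const 2).const_cpow (Or.inl hN)
  have hγ := differentiableAt_gammaFactor χ hs
  have e : symmetricLFunction χ =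
      fun s ↦ ((N : ℂ) ^ (s / 2) * gammaFactor χ s) * LFunction χ s := rfl
  rw [e, logDeriv_mul (f := fun s ↦ (N : ℂ) ^ (s / 2) * gammaFactor χ s) s
    (mul_ne_zero hc (gammaFactor_ne_zero χ hs)) hL (hd.differentiableAt.fun_mul hγ)
    (differentiable_LFunction hχ s), logDeriv_mul (f := fun s : ℂ ↦ (N : ℂ) ^ (s / 2)) s hc
    (gammaFactor_ne_zero χ hs) hd.differentiableAt hγ]
  congr 2
  rw [logDeriv_apply, hd.deriv, Complex.ofReal_log (Nat.cast_nonneg N), Complex.ofReal_natCast]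
  field_simp

end DirichletCharacter

/-- The weight `(log n) ^ (4 N ^ 2) / n ^ (N + 1)`, concentrated around `n = exp (4 N)`. -/
noncomputable def logPowWeight (N n : ℕ) : ℝ := Real.log n ^ (4 * N ^ 2) / (n : ℝ) ^ (N + 1)

open LSeries in
theorem iterate_logMul_apply (f : ℕ → ℂ) (J n : ℕ) :
    (logMul^[J] f) n = Complex.log n ^ J * f n := by
  induction J with
  | zero => simp
  | succ J ih =>
    rw [Function.iterate_succ_apply', logMul, ih, pow_succ']
    ring

namespace DirichletCharacter

variable {q : ℕ}

open ArithmeticFunction _root_.LSeries in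
theorem LSeries_iterate_logMul_twist_vonMangoldt (χ : DirichletCharacter ℂ q) (N : ℕ) :
    LSeries (logMul^[4 * N ^ 2] ((fun n : ℕ ↦ χ n) * fun n ↦ ((Λ n : ℝ) : ℂ))) (N + 1) =
      ∑' n : ℕ, ((Λ n * logPowWeight N n : ℝ) : ℂ) * χ n := by
  rw [LSeries]
  refine tsum_congr fun n ↦ ?_
  rcases eq_or_ne n 0 with rfl | hn
  · simp
  · rw [term_of_ne_zero hn, iterate_logMul_apply, logPowWeight, ← Nat.cast_add_one, Complex.cpow_natCast]
    push_cast
    simp only [Pi.mul_apply]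
    ring

open Complex in
theorem differentiableAt_logDeriv {f : ℂ → ℂ} {s : ℂ} {U : Set ℂ} (hU : IsOpen U)
    (hf : DifferentiableOn ℂ f U) (hs : s ∈ U) (h0 : f s ≠ 0) :
    DifferentiableAt ℂ (logDeriv f) s := by
  have h1 := (hf.deriv hU).differentiableAt (hU.mem_nhds hs)
  have h2 := hf.differentiableAt (hU.mem_nhds hs)
  exact h1.fun_div h2 h0

theorem exists_re_logDeriv_gammaFactor_le :
    ∃ C : ℝ, 0 ≤ C ∧ ∀ (q : ℕ) (χ : DirichletCharacter ℂ q),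
      (logDeriv (gammaFactor χ) (3 / 2)).re ≤ C := by
  refine ⟨max 0 (max (logDeriv Complex.Gammaℝ (3 / 2)).re
    (logDeriv (fun s ↦ Complex.Gammaℝ (s + 1)) (3 / 2)).re), le_max_left _ _, fun q χ ↦ ?_⟩
  refine le_max_of_le_right ?_
  by_cases h : χ.Even
  · have : gammaFactor χ = Complex.Gammaℝ := funext fun s ↦ h.gammaFactor_def s
    rw [this]
    exact le_max_left _ _
  · have : gammaFactor χ = fun s ↦ Complex.Gammaℝ (s + 1) := funext fun s ↦ by
      simp [gammaFactor, h]
    rw [this]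
    exact le_max_right _ _

open ArithmeticFunction in
theorem exists_norm_logDeriv_LFunction_le :
    ∃ C : ℝ, 0 ≤ C ∧ ∀ (q : ℕ) [NeZero q] (χ : DirichletCharacter ℂ q),
      ‖logDeriv (LFunction χ) (3 / 2)‖ ≤ C := by
  refine ⟨∑' n, ‖LSeries.term (fun n ↦ ((Λ n : ℝ) : ℂ)) (3 / 2) n‖,
    tsum_nonneg fun n ↦ norm_nonneg _, fun q _ χ ↦ ?_⟩
  have h32 : 1 < (3 / 2 : ℂ).re := by norm_num
  have hs := (LSeriesSummable_vonMangoldt h32).norm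
  have hs' := (LSeriesSummable_twist_vonMangoldt χ h32).norm
  rw [logDeriv_apply, deriv_LFunction_eq_deriv_LSeries χ h32, LFunction_eq_LSeries χ h32, ← norm_neg,
    ← neg_div, ← LSeries_twist_vonMangoldt_eq χ h32]
  refine (norm_tsum_le_tsum_norm hs').trans (hs'.tsum_le_tsum (fun n ↦ ?_) hs)
  refine LSeries.norm_term_le _ ?_
  simp only [Pi.mul_apply, norm_mul]
  exact mul_le_of_le_one_left (norm_nonneg _) (norm_le_one χ _)

variable [NeZero q]

open ArithmeticFunction _root_.LSeries in
theorem norm_iteratedDeriv_logDeriv_LFunction (χ : DirichletCharacter ℂ q) {N : ℕ} (hN : 0 < N) :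
    ‖iteratedDeriv (4 * N ^ 2) (logDeriv (LFunction χ)) (N + 1)‖ =
      ‖∑' n : ℕ, ((Λ n * logPowWeight N n : ℝ) : ℂ) * χ n‖ := by
  have hN' : (0 : ℝ) < N := by exact_mod_cast hN
  have hs : 1 < ((N : ℂ) + 1).re := by simpa using hN
  have he : logDeriv (LFunction χ) =ᶠ[nhds ((N : ℂ) + 1)]
      -LSeries ((fun n : ℕ ↦ χ n) * fun n ↦ ((Λ n : ℝ) : ℂ)) := by
    filter_upwards [(isOpen_lt continuous_const Complex.continuous_re).mem_nhds hs] with z hz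
    rw [Pi.neg_apply, LSeries_twist_vonMangoldt_eq χ hz, logDeriv_apply,
      deriv_LFunction_eq_deriv_LSeries χ hz, LFunction_eq_LSeries χ hz, neg_div, neg_neg]
  rw [he.iteratedDeriv_eq, iteratedDeriv_neg, LSeries_iteratedDeriv, norm_neg, norm_mul, norm_pow,
    norm_neg, norm_one, one_pow, one_mul, LSeries_iterate_logMul_twist_vonMangoldt]
  have hle : LSeries.abscissaOfAbsConv ((fun n : ℕ ↦ χ n) * fun n ↦ ((Λ n : ℝ) : ℂ)) ≤ 1 := by
    refine LSeries.abscissaOfAbsConv_le_of_forall_lt_LSeriesSummable' fun y hy ↦ ?_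
    exact LSeriesSummable_twist_vonMangoldt χ (by exact_mod_cast hy)
  refine hle.trans_lt ?_
  exact_mod_cast hs

open ArithmeticFunction in
/-- Under the Riemann hypothesis for `L(s, χ)`, the weighted sum of `Λ(n) χ(n)` exhibits square root
cancellation. -/
theorem exists_norm_tsum_vonMangoldt_mul_le :
    ∃ C : ℝ, 0 ≤ C ∧ ∀ (q : ℕ) [NeZero q] (χ : DirichletCharacter ℂ q), χ ≠ 1 → χ.IsPrimitive →
      (∀ s : ℂ, 1 / 2 < s.re → LFunction χ s ≠ 0) → ∀ N : ℕ, 2 ≤ N →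
      ‖∑' n : ℕ, ((Λ n * logPowWeight N n : ℝ) : ℂ) * χ n‖ ≤
        C * (1 + Real.log q) * ((4 * N ^ 2).factorial / ((N : ℝ) + 1 / 2) ^ (4 * N ^ 2 + 1)) := by
  obtain ⟨C₁, hC₁, h₁⟩ := exists_re_logDeriv_gammaFactor_le
  obtain ⟨C₂, hC₂, h₂⟩ := exists_norm_logDeriv_LFunction_le
  refine ⟨4 * (1 + 2 * C₁ + C₂ + 7), by positivity, fun q _ χ hχ hp hL N hN ↦ ?_⟩
  have hq : 1 ≤ q := NeZero.pos q
  have hlog : 0 ≤ Real.log q := Real.log_natCast_nonneg q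
  have hN2 : (2 : ℝ) ≤ N := by exact_mod_cast hN
  have hJ : 4 * N ^ 2 ≠ 0 := by positivity
  have hb : 1 ≤ (N : ℝ) + 1 / 2 := by linarith
  have hbJ : 8 * ((N : ℝ) + 1 / 2) ^ 2 ≤ 3 * ((4 * N ^ 2 : ℕ) + 1) := by
    push_cast
    nlinarith
  have hopen : IsOpen {s : ℂ | 0 < s.re} := isOpen_lt continuous_const Complex.continuous_re
  set F : ℂ → ℂ := fun w ↦ logDeriv (symmetricLFunction χ) (1 / 2 + w) with hF
  set G : ℂ → ℂ := fun w ↦ 7 + logDeriv (gammaFactor χ) (1 / 2 + w) with hG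
  have hre : ∀ w : ℂ, 0 < w.re → 1 / 2 < (1 / 2 + w).re := fun w hw ↦ by simpa using hw
  have hpos : ∀ w : ℂ, 0 < w.re → 0 < (1 / 2 + w).re := fun w hw ↦ by linarith [hre w hw]
  have hFd : DifferentiableOn ℂ F {w | 0 < w.re} := by
    intro w (hw : 0 < w.re)
    refine DifferentiableAt.differentiableWithinAt ?_
    refine (differentiableAt_logDeriv hopen (fun s hs ↦
      (differentiableAt_symmetricLFunction hχ hs).differentiableWithinAt) (hpos w hw)
      (symmetricLFunction_ne_zero (hpos w hw) (hL _ (hre w hw)))).comp (f := fun w ↦ 1 / 2 + w) w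
      (by fun_prop)
  have hGd : DifferentiableOn ℂ G {w | 0 < w.re} := by
    intro w (hw : 0 < w.re)
    refine DifferentiableAt.differentiableWithinAt (DifferentiableAt.const_add _ ?_)
    refine (differentiableAt_logDeriv hopen (fun s hs ↦
      (differentiableAt_gammaFactor χ hs).differentiableWithinAt) (hpos w hw)
      (gammaFactor_ne_zero χ (hpos w hw))).comp (f := fun w ↦ 1 / 2 + w) w (by fun_prop)
  have hF1 := norm_iteratedDeriv_le_of_re_nonneg hb hJ hbJ hFd fun w hw ↦
    logDeriv_symmetricLFunction_re_nonneg hχ hp hL (hre w hw)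
  have hG1 := norm_iteratedDeriv_le_of_re_nonneg hb hJ hbJ hGd fun w hw ↦ by
    have := neg_seven_le_re_logDeriv_gammaFactor χ (hre w hw)
    simp only [hG, Complex.add_re, Complex.re_ofNat]
    linarith
  set b : ℝ := (N : ℝ) + 1 / 2 with hbdef
  have hbpos : 0 < (b : ℂ).re := by
    rw [Complex.ofReal_re]
    linarith
  have hkey : iteratedDeriv (4 * N ^ 2) (logDeriv (LFunction χ)) (N + 1) =
      iteratedDeriv (4 * N ^ 2) F b - iteratedDeriv (4 * N ^ 2) G b := by
    have hbN : (1 / 2 : ℂ) + b = N + 1 := by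
      rw [hbdef]
      push_cast
      ring
    have hFc := ((hFd.contDiffOn hopen (n := (4 * N ^ 2 : ℕ))).contDiffAt (hopen.mem_nhds hbpos))
    have hGc := ((hGd.contDiffOn hopen (n := (4 * N ^ 2 : ℕ))).contDiffAt (hopen.mem_nhds hbpos))
    rw [← iteratedDeriv_sub hFc hGc, ← hbN]
    have := congrFun (iteratedDeriv_comp_const_add (4 * N ^ 2) (logDeriv (LFunction χ)) (1 / 2))
      (b : ℂ)
    rw [← this, ← iteratedDeriv_const_add (Nat.pos_of_ne_zero hJ) (Real.log q / 2 - 7 : ℂ)]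
    refine Filter.EventuallyEq.iteratedDeriv_eq _ ?_
    filter_upwards [hopen.mem_nhds hbpos] with w hw
    simp only [Pi.sub_apply, hF, hG]
    rw [logDeriv_symmetricLFunction hχ (hpos w hw) (hL _ (hre w hw))]
    ring
  have hhalf : (1 / 2 : ℂ) + 1 = 3 / 2 := by norm_num
  have hFb : (F 1).re ≤ Real.log q / 2 + C₁ + C₂ := by
    simp only [hF]
    rw [hhalf, logDeriv_symmetricLFunction hχ (by norm_num) (hL _ (by norm_num))]
    have e1 := h₁ q χ
    have e2 := (Complex.re_le_norm _).trans (h₂ q χ)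
    have e3 : ((Real.log q : ℂ) / 2).re = Real.log q / 2 := by
      rw [← Complex.ofReal_ofNat, ← Complex.ofReal_div, Complex.ofReal_re]
    simp only [Complex.add_re, e3]
    linarith
  have hGb : (G 1).re ≤ 7 + C₁ := by
    simp only [hG]
    rw [hhalf]
    have e1 := h₁ q χ
    simp only [Complex.add_re, Complex.re_ofNat]
    linarith
  rw [← norm_iteratedDeriv_logDeriv_LFunction χ (by lia), hkey]
  have hbp : (0 : ℝ) < b ^ (4 * N ^ 2 + 1) := by positivity
  calc _ ≤ _ := norm_sub_le _ _
    _ ≤ (4 * N ^ 2).factorial * (4 * (F 1).re / b ^ (4 * N ^ 2 + 1)) +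
        (4 * N ^ 2).factorial * (4 * (G 1).re / b ^ (4 * N ^ 2 + 1)) := add_le_add hF1 hG1
    _ = 4 * ((F 1).re + (G 1).re) * ((4 * N ^ 2).factorial / b ^ (4 * N ^ 2 + 1)) := by ring
    _ ≤ _ := by
      refine mul_le_mul_of_nonneg_right ?_ (by positivity)
      nlinarith

end DirichletCharacter

/-- The maximal value of `n * logPowWeight N n` for real `n`, attained at `n = exp (4 N)`. -/
noncomputable def logPowPeak (N : ℕ) : ℝ := (4 * N : ℝ) ^ (4 * N ^ 2) * Real.exp (-(4 * N ^ 2))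

theorem logPowPeak_pos {N : ℕ} (hN : N ≠ 0) : 0 < logPowPeak N := by
  have : (0 : ℝ) < N := by exact_mod_cast Nat.pos_of_ne_zero hN
  unfold logPowPeak
  positivity

theorem logPowWeight_nonneg (N n : ℕ) : 0 ≤ logPowWeight N n :=
  div_nonneg (pow_nonneg (Real.log_natCast_nonneg n) _) (by positivity)

theorem logPowWeight_eq {N n : ℕ} (hN : N ≠ 0) (hn : n ≠ 0) :
    logPowWeight N n = logPowPeak N * (Real.log n / (4 * N) *
      Real.exp (1 - Real.log n / (4 * N))) ^ (4 * N ^ 2) / n := by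
  have hN' : (0 : ℝ) < N := by exact_mod_cast Nat.pos_of_ne_zero hN
  have hn' : (0 : ℝ) < n := by exact_mod_cast Nat.pos_of_ne_zero hn
  rw [logPowWeight, logPowPeak, mul_pow (Real.log n / (4 * N)), ← Real.exp_nat_mul,
    pow_succ (n : ℝ) N]
  have h1 : (4 * N : ℝ) ^ (4 * N ^ 2) * (Real.log n / (4 * N)) ^ (4 * N ^ 2) =
      Real.log n ^ (4 * N ^ 2) := by
    rw [← mul_pow, mul_div_cancel₀ _ (by positivity)]
  have h2 : Real.exp (-(4 * N ^ 2)) * Real.exp ((4 * N ^ 2 : ℕ) * (1 - Real.log n / (4 * N))) =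
      ((n : ℝ) ^ N)⁻¹ := by
    rw [← Real.exp_add, ← Real.rpow_natCast (n : ℝ) N, Real.rpow_def_of_pos hn',
      ← Real.exp_neg]
    congr 1
    push_cast
    field_simp
    ring
  calc _ = Real.log n ^ (4 * N ^ 2) * ((n : ℝ) ^ N)⁻¹ / n := by field_simp
    _ = _ := by rw [← h1, ← h2]; ring

theorem logPowWeight_le_exp_neg_mul {N n : ℕ} (hN : N ≠ 0) (hn : n ≠ 0) :
    logPowWeight N n ≤ logPowPeak N * (Real.exp (1 / 4 - N) * (n : ℝ) ^ (1 / 4 : ℝ)) / n := by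
  have hN' : (0 : ℝ) < N := by exact_mod_cast Nat.pos_of_ne_zero hN
  have hn' : (0 : ℝ) < n := by exact_mod_cast Nat.pos_of_ne_zero hn
  have hpk := logPowPeak_pos hN
  rw [logPowWeight_eq hN hn]
  set t := Real.log n / (4 * N) with ht
  have ht0 : 0 ≤ t := div_nonneg (Real.log_natCast_nonneg n) (by positivity)
  have hlog : Real.log n = 4 * N * t := by rw [ht]; field_simp
  gcongr
  have key : t * Real.exp (1 - t) ≤ Real.exp (-(1 / (4 * N + 1)) + t / (4 * N)) := by
    have h1 := Real.add_one_le_exp (t / (N / (N + 1 / 4)) - 1)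
    have h2 := Real.add_one_le_exp ((N : ℝ) / (N + 1 / 4) - 1)
    have h3 : t ≤ Real.exp ((N : ℝ) / (N + 1 / 4) - 1) *
        Real.exp (t / (N / (N + 1 / 4)) - 1) := by
      calc t = (N / (N + 1 / 4)) * (t / (N / (N + 1 / 4))) := by field_simp
        _ ≤ _ := by
          gcongr <;> linarith
    calc _ ≤ (Real.exp ((N : ℝ) / (N + 1 / 4) - 1) * Real.exp (t / (N / (N + 1 / 4)) - 1)) *
          Real.exp (1 - t) := by gcongr
      _ = _ := by
        rw [← Real.exp_add, ← Real.exp_add]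
        congr 1
        field_simp
        ring
  calc _ ≤ Real.exp (-(1 / (4 * N + 1)) + t / (4 * N)) ^ (4 * N ^ 2) := by gcongr
    _ = Real.exp ((4 * N ^ 2 : ℕ) * (-(1 / (4 * N + 1)) + t / (4 * N))) := by
      rw [← Real.exp_nat_mul]
    _ ≤ Real.exp (1 / 4 - N + Real.log n * (1 / 4)) := by
      rw [Real.exp_le_exp, hlog]
      push_cast
      have : 4 * (N : ℝ) ^ 2 * (1 / (4 * N + 1)) ≥ N - 1 / 4 := by
        rw [ge_iff_le, mul_one_div, le_div_iff₀ (by positivity)]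
        nlinarith
      have h4 : 4 * (N : ℝ) ^ 2 * (t / (4 * N)) = N * t := by field_simp
      linarith
    _ = _ := by rw [Real.exp_add, Real.rpow_def_of_pos hn']

theorem logPowWeight_le_div_sq {N n : ℕ} (hN : 2 ≤ N) (hn : n ≠ 0) :
    logPowWeight N n ≤ logPowPeak N * (Real.exp 8 * Real.exp (4 * N)) / n ^ 2 := by
  have hN2 : (2 : ℝ) ≤ N := by exact_mod_cast hN
  have hN0 : N ≠ 0 := by lia
  have hN' : (0 : ℝ) < N := by linarith
  have hN1 : (0 : ℝ) < N - 1 := by linarith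
  have hn' : (0 : ℝ) < n := by exact_mod_cast Nat.pos_of_ne_zero hn
  have hpk := logPowPeak_pos hN0
  rw [logPowWeight_eq hN0 hn, sq (n : ℝ), ← div_div _ (n : ℝ) (n : ℝ)]
  set t := Real.log n / (4 * N) with ht
  have ht0 : 0 ≤ t := div_nonneg (Real.log_natCast_nonneg n) (by positivity)
  have hlog : Real.log n = 4 * N * t := by rw [ht]; field_simp
  have hexp : (n : ℝ) = Real.exp (4 * N * t) := by rw [← hlog, Real.exp_log hn']
  rw [mul_div_assoc (logPowPeak N) (Real.exp 8 * Real.exp (4 * N)) (n : ℝ)]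
  refine div_le_div_of_nonneg_right (mul_le_mul_of_nonneg_left ?_ hpk.le) hn'.le
  have key : t * Real.exp (1 - t) ≤ Real.exp (1 / (N * (N - 1)) + (1 - t) / N) := by
    have h1 := Real.add_one_le_exp (t / (N / (N - 1)) - 1)
    have h2 := Real.add_one_le_exp ((N : ℝ) / (N - 1) - 1)
    have h3 : t ≤ Real.exp ((N : ℝ) / (N - 1) - 1) * Real.exp (t / (N / (N - 1)) - 1) := by
      calc t = (N / (N - 1)) * (t / (N / (N - 1))) := by field_simp
        _ ≤ _ := by
          gcongr <;> linarith
    calc _ ≤ (Real.exp ((N : ℝ) / (N - 1) - 1) * Real.exp (t / (N / (N - 1)) - 1)) *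
          Real.exp (1 - t) := by gcongr
      _ = _ := by
        rw [← Real.exp_add, ← Real.exp_add]
        congr 1
        field_simp
        ring
  calc _ ≤ Real.exp (1 / (N * (N - 1)) + (1 - t) / N) ^ (4 * N ^ 2) := by gcongr
    _ = Real.exp ((4 * N ^ 2 : ℕ) * (1 / (N * (N - 1)) + (1 - t) / N)) := by
      rw [← Real.exp_nat_mul]
    _ ≤ Real.exp (8 + 4 * N - 4 * N * t) := by
      rw [Real.exp_le_exp]
      push_cast
      have h3 : 4 * (N : ℝ) ^ 2 * (1 / (N * (N - 1))) ≤ 8 := by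
        rw [mul_one_div, div_le_iff₀ (by positivity)]
        nlinarith
      have h4 : 4 * (N : ℝ) ^ 2 * ((1 - t) / N) = 4 * N - 4 * N * t := by field_simp
      linarith
    _ = _ := by
      rw [hexp, Real.exp_sub, Real.exp_add]

theorem le_logPowWeight {N n : ℕ} (hN : N ≠ 0) {L : ℝ} (hn : Real.exp (4 * N) ≤ n)
    (hnL : (n : ℝ) ≤ Real.exp L * Real.exp (4 * N)) :
    logPowPeak N * Real.exp (-(L ^ 2 / 4)) / n ≤ logPowWeight N n := by
  have hN' : (0 : ℝ) < N := by exact_mod_cast Nat.pos_of_ne_zero hN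
  have hn' : (0 : ℝ) < n := (Real.exp_pos _).trans_le hn
  have hpk := logPowPeak_pos hN
  rw [logPowWeight_eq hN (by exact_mod_cast hn'.ne')]
  set t := Real.log n / (4 * N) with ht
  have hlog : Real.log n = 4 * N * t := by rw [ht]; field_simp
  have h1 : 4 * N ≤ Real.log n := (Real.le_log_iff_exp_le hn').2 hn
  have h2 : Real.log n ≤ L + 4 * N := by
    rw [← Real.exp_add] at hnL
    exact (Real.log_le_iff_le_exp hn').2 hnL
  have ht1 : 1 ≤ t := by rw [hlog] at h1; nlinarith
  have htL : 4 * N * (t - 1) ≤ L := by rw [hlog] at h2; linarith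
  gcongr
  have key : Real.exp (-(t - 1) ^ 2) ≤ t * Real.exp (1 - t) := by
    have h3 := Real.one_sub_inv_le_log_of_pos (by linarith : 0 < t)
    have h4 : t = Real.exp (Real.log t) := (Real.exp_log (by linarith)).symm
    have h5 : t - 1 - (t - 1) ^ 2 ≤ 1 - t⁻¹ := by
      have h6 : 1 - t⁻¹ - (t - 1 - (t - 1) ^ 2) = (t - 1) ^ 3 / t := by field_simp; ring
      have : 0 ≤ (t - 1) ^ 3 / t := div_nonneg (pow_nonneg (by linarith) _) (by linarith)
      linarith
    calc _ ≤ Real.exp (Real.log t) * Real.exp (1 - t) := by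
          rw [← Real.exp_add, Real.exp_le_exp]
          linarith
      _ = _ := by rw [← h4]
  calc Real.exp (-(L ^ 2 / 4)) ≤ Real.exp ((4 * N ^ 2 : ℕ) * (-(t - 1) ^ 2)) := by
        rw [Real.exp_le_exp]
        push_cast
        have h0 : 0 ≤ 4 * N * (t - 1) := mul_nonneg (by positivity) (by linarith)
        nlinarith
    _ = Real.exp (-(t - 1) ^ 2) ^ (4 * N ^ 2) := by rw [← Real.exp_nat_mul]
    _ ≤ _ := by gcongr

theorem factorial_div_pow_le {N : ℕ} (hN : N ≠ 0) :
    (4 * N ^ 2).factorial / ((N : ℝ) + 1 / 2) ^ (4 * N ^ 2 + 1) ≤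
      2 * Real.exp 2 * Real.exp (-(2 * N)) * logPowPeak N := by
  have hN' : (0 : ℝ) < N := by exact_mod_cast Nat.pos_of_ne_zero hN
  have hfac : ((4 * N ^ 2).factorial : ℝ) ≤
      Real.exp 1 * (2 * N) * ((4 * N ^ 2) / Real.exp 1) ^ (4 * N ^ 2) := by
    have h1 := Stirling.stirlingSeq'_antitone (Nat.zero_le (4 * N ^ 2 - 1))
    have h2 : 4 * N ^ 2 - 1 + 1 = 4 * N ^ 2 := Nat.sub_add_cancel (by
      have := Nat.pos_of_ne_zero hN; nlinarith)
    simp only [Function.comp_apply, Nat.succ_eq_add_one, h2, zero_add] at h1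
    rw [Stirling.stirlingSeq_one, Stirling.stirlingSeq, div_le_iff₀ (by positivity)] at h1
    refine h1.trans (le_of_eq ?_)
    push_cast
    have h3 : √(2 * (4 * (N : ℝ) ^ 2)) = √2 * (2 * N) := by
      rw [Real.sqrt_mul (by norm_num)]
      congr 1
      rw [show 4 * (N : ℝ) ^ 2 = (2 * N) ^ 2 by ring, Real.sqrt_sq (by positivity)]
    rw [h3]
    field_simp
  rw [div_le_iff₀ (by positivity)]
  refine hfac.trans ?_
  have h1 : (N : ℝ) / (N + 1 / 2) ≤ Real.exp (-(1 / (2 * N + 1))) := by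
    have := Real.add_one_le_exp (-(1 / (2 * (N : ℝ) + 1)))
    refine le_trans (le_of_eq ?_) this
    field_simp
    ring
  have h2 : ((N : ℝ) / (N + 1 / 2)) ^ (4 * N ^ 2) ≤ Real.exp 1 * Real.exp (-(2 * N)) := by
    calc _ ≤ Real.exp (-(1 / (2 * N + 1))) ^ (4 * N ^ 2) := by gcongr
      _ = Real.exp ((4 * N ^ 2 : ℕ) * (-(1 / (2 * N + 1)))) := by rw [← Real.exp_nat_mul]
      _ ≤ _ := by
        rw [← Real.exp_add, Real.exp_le_exp]
        push_cast
        have : 4 * (N : ℝ) ^ 2 * (1 / (2 * N + 1)) ≥ 2 * N - 1 := by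
          rw [ge_iff_le, mul_one_div, le_div_iff₀ (by positivity)]
          nlinarith
        linarith
  have h3 : ((4 * (N : ℝ) ^ 2) / Real.exp 1) ^ (4 * N ^ 2) =
      logPowPeak N * ((N : ℝ) / (N + 1 / 2)) ^ (4 * N ^ 2) * (N + 1 / 2) ^ (4 * N ^ 2) := by
    have : Real.exp (-(4 * (N : ℝ) ^ 2)) = (Real.exp 1)⁻¹ ^ (4 * N ^ 2) := by
      rw [← Real.exp_neg, ← Real.exp_nat_mul]
      push_cast
      ring_nf
    rw [logPowPeak, this, ← mul_pow, ← mul_pow, ← mul_pow]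
    congr 1
    field_simp
  have hpk := logPowPeak_pos hN
  rw [h3]
  calc _ ≤ Real.exp 1 * (2 * N) * (logPowPeak N * (Real.exp 1 * Real.exp (-(2 * N))) *
        (N + 1 / 2) ^ (4 * N ^ 2)) := by gcongr
    _ = 2 * (Real.exp 1 * Real.exp 1) * Real.exp (-(2 * N)) * logPowPeak N *
        (N * (N + 1 / 2) ^ (4 * N ^ 2)) := by ring
    _ ≤ 2 * (Real.exp 1 * Real.exp 1) * Real.exp (-(2 * N)) * logPowPeak N *
        ((N + 1 / 2) * (N + 1 / 2) ^ (4 * N ^ 2)) := by gcongr; linarith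
    _ = _ := by
      rw [← Real.exp_add, pow_succ, one_add_one_eq_two]
      ring

section

open ArithmeticFunction

theorem summable_vonMangoldt_div_sq : Summable fun n : ℕ ↦ Λ n / (n : ℝ) ^ 2 := by
  have h2 : 1 < (2 : ℂ).re := by norm_num
  refine (LSeriesSummable_vonMangoldt h2).norm.congr fun n ↦ ?_
  rw [LSeries.norm_term_eq]
  rcases eq_or_ne n 0 with rfl | hn
  · simp
  · simp [hn, abs_of_nonneg vonMangoldt_nonneg]

theorem summable_vonMangoldt_mul_logPowWeight {N : ℕ} (hN : 2 ≤ N) :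
    Summable fun n ↦ Λ n * logPowWeight N n := by
  refine (summable_vonMangoldt_div_sq.mul_left
    (logPowPeak N * (Real.exp 8 * Real.exp (4 * N)))).of_nonneg_of_le
    (fun n ↦ mul_nonneg vonMangoldt_nonneg (logPowWeight_nonneg N n)) fun n ↦ ?_
  rcases eq_or_ne n 0 with rfl | hn
  · simp
  · have := mul_le_mul_of_nonneg_left (logPowWeight_le_div_sq hN hn)
      (vonMangoldt_nonneg (n := n))
    refine this.trans (le_of_eq ?_)
    ring

theorem logPowWeight_le_div {N n : ℕ} (hN : N ≠ 0) (hn : n ≠ 0) :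
    logPowWeight N n ≤ logPowPeak N / n := by
  have hpk := logPowPeak_pos hN
  rw [logPowWeight_eq hN hn]
  set t := Real.log n / (4 * N) with ht
  have ht0 : 0 ≤ t := div_nonneg (Real.log_natCast_nonneg n) (by positivity)
  have h1 : t * Real.exp (1 - t) ≤ 1 := by
    have := Real.add_one_le_exp (t - 1)
    calc _ ≤ Real.exp (t - 1) * Real.exp (1 - t) := by gcongr; linarith
      _ = 1 := by rw [← Real.exp_add]; simp
  have h2 := pow_le_one₀ (n := 4 * N ^ 2) (by positivity) h1
  refine div_le_div_of_nonneg_right ?_ (Nat.cast_nonneg n)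
  exact mul_le_of_le_one_right hpk.le h2

theorem exists_le_tsum_vonMangoldt_mul_logPowWeight :
    ∃ c : ℝ, 0 < c ∧ ∀ N : ℕ, 2 ≤ N → c * logPowPeak N ≤ ∑' n, Λ n * logPowWeight N n := by
  refine ⟨Real.exp (-(Real.log 16 ^ 2 / 4)) / 16, by positivity, fun N hN ↦ ?_⟩
  have hN0 : N ≠ 0 := by lia
  have hN2 : (2 : ℝ) ≤ N := by exact_mod_cast hN
  have hpk := logPowPeak_pos hN0
  set E := Real.exp (4 * N) with hE
  have hEpos : 0 < E := Real.exp_pos _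
  have hEN : 4 * (N : ℝ) + 1 ≤ E := Real.add_one_le_exp _
  set S := Finset.Ioc ⌊E⌋₊ ⌊16 * E⌋₊ with hS
  have hpsi : E ≤ ∑ n ∈ S, Λ n := by
    have h1 : Chebyshev.psi (16 * E) = Chebyshev.psi E + ∑ n ∈ S, Λ n := by
      rw [Chebyshev.psi, Chebyshev.psi, hS, ← Finset.sum_union]
      · rw [Finset.Ioc_union_Ioc_eq_Ioc (Nat.zero_le _)]
        exact Nat.floor_le_floor (by linarith)
      · exact Finset.Ioc_disjoint_Ioc_of_le le_rfl
    have h2 := Chebyshev.psi_ge' (by positivity : 0 ≤ 16 * E)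
    have h3 := Chebyshev.psi_le_const_mul_self hEpos.le
    have h4 : Real.log 4 = 2 * Real.log 2 := by
      rw [show (4 : ℝ) = 2 ^ 2 by norm_num, Real.log_pow]
      norm_num
    have h5 : Real.log (16 * E + 2) ≤ 5 * Real.log 2 + 4 * N := by
      calc _ ≤ Real.log (2 ^ 5 * E) := by
            apply Real.log_le_log (by positivity)
            linarith
        _ = _ := by
          rw [Real.log_mul (by norm_num) hEpos.ne', Real.log_pow, hE, Real.log_exp]
          norm_num
    have := Real.log_two_gt_d9
    have := Real.log_two_lt_d9
    rw [h4] at h3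
    nlinarith
  calc _ = logPowPeak N * Real.exp (-(Real.log 16 ^ 2 / 4)) / (16 * E) * E := by
        field_simp
    _ ≤ logPowPeak N * Real.exp (-(Real.log 16 ^ 2 / 4)) / (16 * E) * ∑ n ∈ S, Λ n := by gcongr
    _ = ∑ n ∈ S, Λ n * (logPowPeak N * Real.exp (-(Real.log 16 ^ 2 / 4)) / (16 * E)) := by
      rw [mul_comm, Finset.sum_mul]
    _ ≤ ∑ n ∈ S, Λ n * logPowWeight N n := by
      refine Finset.sum_le_sum fun n hn ↦ mul_le_mul_of_nonneg_left ?_ vonMangoldt_nonneg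
      rw [hS, Finset.mem_Ioc] at hn
      have hn1 : E ≤ n := (Nat.lt_of_floor_lt hn.1).le
      have hn2 : (n : ℝ) ≤ 16 * E := (Nat.le_floor_iff (by positivity)).1 hn.2
      refine le_trans ?_ (le_logPowWeight hN0 (L := Real.log 16) hn1 ?_)
      · have : (0 : ℝ) < n := hEpos.trans_le hn1
        gcongr
      · rwa [Real.exp_log (by norm_num)]
    _ ≤ _ := (summable_vonMangoldt_mul_logPowWeight hN).sum_le_tsum _ fun n _ ↦
      mul_nonneg vonMangoldt_nonneg (logPowWeight_nonneg N n)

theorem sum_Ioc_vonMangoldt_div_sq_le {X M : ℕ} (hX : X ≠ 0) (hXM : X ≤ M) :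
    ∑ n ∈ Finset.Ioc X M, Λ n / (n : ℝ) ^ 2 ≤ 3 * (Real.log 4 + 4) / X := by
  set C := Real.log 4 + 4 with hC
  have hC0 : 0 < C := by
    have := Real.log_pos (by norm_num : (1 : ℝ) < 4)
    linarith
  have hX0 : (0 : ℝ) < X := by exact_mod_cast Nat.pos_of_ne_zero hX
  have key : ∑ n ∈ Finset.Ioc X M, Λ n / (n : ℝ) ^ 2 ≤
      Chebyshev.psi M / (M + 1) ^ 2 + 2 * C * (1 / X - 1 / M) := by
    induction M, hXM using Nat.le_induction with
    | base =>
      simp only [Finset.Ioc_self, Finset.sum_empty, sub_self, mul_zero, add_zero]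
      exact div_nonneg (Chebyshev.psi_nonneg _) (by positivity)
    | succ M hM ih =>
      have hM0 : (0 : ℝ) < M := hX0.trans_le (by exact_mod_cast hM)
      have hpsi : Chebyshev.psi (M + 1 : ℕ) = Chebyshev.psi M + Λ (M + 1) := by
        rw [Chebyshev.psi, Chebyshev.psi, Nat.floor_natCast, Nat.floor_natCast,
          Finset.sum_Ioc_succ_top (Nat.zero_le M)]
      have hle := Chebyshev.psi_le_const_mul_self (Nat.cast_nonneg (α := ℝ) (M + 1))
      rw [Finset.sum_Ioc_succ_top hM]
      rw [hpsi] at hle ⊢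
      push_cast at hle ⊢
      set P := Chebyshev.psi M + Λ (M + 1)
      have e1 : P / ((M : ℝ) + 1) ^ 2 - P / (M + 1 + 1) ^ 2 ≤
          2 * C * (1 / M - 1 / (M + 1)) := by
        have e2 : P / ((M : ℝ) + 1) ^ 2 - P / (M + 1 + 1) ^ 2 =
            P * ((2 * M + 3) / ((M + 1) ^ 2 * (M + 2) ^ 2)) := by
          field_simp
          ring
        have e3 : 2 * C * (1 / M - 1 / (M + 1)) = C * (M + 1) * (2 / (M * (M + 1) ^ 2)) := by
          field_simp
          ring
        rw [e2, e3]
        gcongr ?_ * ?_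
        rw [div_le_div_iff₀ (by positivity) (by positivity)]
        nlinarith [sq_nonneg ((M : ℝ) + 1), mul_pos hM0 hM0, pow_pos hM0 3]
      have e4 : P / ((M : ℝ) + 1) ^ 2 =
          Chebyshev.psi M / (M + 1) ^ 2 + Λ (M + 1) / (M + 1) ^ 2 := add_div _ _ _
      linarith
  have hM0 : (0 : ℝ) < M := hX0.trans_le (by exact_mod_cast hXM)
  refine key.trans ?_
  have h1 : Chebyshev.psi M / ((M : ℝ) + 1) ^ 2 ≤ C / M := by
    have hle := Chebyshev.psi_le_const_mul_self hM0.le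
    rw [div_le_div_iff₀ (by positivity) hM0]
    calc _ ≤ C * M * M := by gcongr
      _ ≤ _ := by nlinarith
  have h2 : C / M ≤ C / X := by gcongr
  have h3 : 0 ≤ C / M := by positivity
  have h4 : 2 * C * (1 / X - 1 / M) = 2 * (C / X) - 2 * (C / M) := by ring
  have h5 : 3 * C / X = 3 * (C / X) := by ring
  linarith

theorem tsum_tail_vonMangoldt_mul_logPowWeight_le {N X : ℕ} (hN : 2 ≤ N) (hX : X ≠ 0) :
    ∑' n, (if X < n then Λ n * logPowWeight N n else 0) ≤
      3 * (Real.log 4 + 4) * Real.exp 8 * Real.exp (4 * N) / X * logPowPeak N := by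
  have hpk := logPowPeak_pos (by lia : N ≠ 0)
  have hnn : ∀ n, 0 ≤ Λ n * logPowWeight N n := fun n ↦
    mul_nonneg vonMangoldt_nonneg (logPowWeight_nonneg N n)
  refine Real.tsum_le_of_sum_range_le (fun n ↦ by split_ifs <;> simp [hnn]) fun M ↦ ?_
  rw [← Finset.sum_filter]
  calc _ ≤ ∑ n ∈ Finset.Ioc X (max X M), Λ n * logPowWeight N n := by
        refine Finset.sum_le_sum_of_subset_of_nonneg (fun n hn ↦ ?_) fun n _ _ ↦ hnn n
        simp only [Finset.mem_filter, Finset.mem_range, Finset.mem_Ioc, le_max_iff] at hn ⊢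
        exact ⟨hn.2, Or.inr hn.1.le⟩
    _ ≤ ∑ n ∈ Finset.Ioc X (max X M),
        logPowPeak N * (Real.exp 8 * Real.exp (4 * N)) * (Λ n / (n : ℝ) ^ 2) := by
      refine Finset.sum_le_sum fun n hn ↦ ?_
      have hn0 : n ≠ 0 := by
        rw [Finset.mem_Ioc] at hn
        lia
      have := mul_le_mul_of_nonneg_left (logPowWeight_le_div_sq hN hn0)
        (vonMangoldt_nonneg (n := n))
      refine this.trans (le_of_eq ?_)
      ring
    _ ≤ logPowPeak N * (Real.exp 8 * Real.exp (4 * N)) * (3 * (Real.log 4 + 4) / X) := by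
      rw [← Finset.mul_sum]
      exact mul_le_mul_of_nonneg_left (sum_Ioc_vonMangoldt_div_sq_le hX (le_max_left _ _))
        (by positivity)
    _ = _ := by ring

theorem summable_vonMangoldt_div_of_not_prime :
    Summable fun n : ℕ ↦ (if n.Prime then 0 else Λ n) / (n : ℝ) := by
  have := vonMangoldt.summable_residueClass_non_primes_div (0 : ZMod 1)
  refine this.congr fun n ↦ ?_
  have hn : n ∈ {n : ℕ | (n : ZMod 1) = 0} := Subsingleton.elim (n : ZMod 1) 0
  rw [vonMangoldt.residueClass, Set.indicator_of_mem hn]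

open Filter Topology in
theorem tendsto_logPowWeight_div_logPowPeak (n : ℕ) :
    Tendsto (fun N ↦ logPowWeight N n / logPowPeak N) atTop (𝓝 0) := by
  rcases eq_or_ne n 0 with rfl | hn
  · simp only [logPowWeight, Nat.cast_zero, ne_eq, Nat.add_eq_zero_iff, one_ne_zero, and_false,
      not_false_eq_true, zero_pow, div_zero, zero_div, tendsto_const_nhds]
  have h1 : Tendsto (fun N : ℕ ↦ Real.exp (1 / 4 - N) * ((n : ℝ) ^ (1 / 4 : ℝ) / n)) atTop
      (𝓝 (0 * ((n : ℝ) ^ (1 / 4 : ℝ) / n))) := by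
    refine Tendsto.mul_const _ (Real.tendsto_exp_atBot.comp ?_)
    exact tendsto_atBot_add_const_left _ _ (tendsto_neg_atTop_atBot.comp tendsto_natCast_atTop_atTop)
  rw [zero_mul] at h1
  refine squeeze_zero' ?_ ?_ h1
  · filter_upwards [eventually_ne_atTop 0] with N hN
    exact div_nonneg (logPowWeight_nonneg N n) (logPowPeak_pos hN).le
  · filter_upwards [eventually_ne_atTop 0] with N hN
    rw [div_le_iff₀ (logPowPeak_pos hN)]
    refine (logPowWeight_le_exp_neg_mul hN hn).trans (le_of_eq ?_)
    ring

open Filter Topology in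
theorem eventually_tsum_not_prime_le {ε : ℝ} (hε : 0 < ε) :
    ∀ᶠ N in atTop, ∑' n : ℕ, (if n.Prime then 0 else Λ n * logPowWeight N n) ≤
      ε * logPowPeak N := by
  have h := tendsto_tsum_of_dominated_convergence (𝓕 := atTop)
    (f := fun (N n : ℕ) ↦ (if n.Prime then 0 else Λ n) * (logPowWeight N n / logPowPeak N))
    (g := fun _ ↦ 0) summable_vonMangoldt_div_of_not_prime (fun n ↦ by
      simpa using (tendsto_logPowWeight_div_logPowPeak n).const_mul (if n.Prime then 0 else Λ n))
    (by
      filter_upwards [eventually_ne_atTop 0] with N hN n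
      have hpk := logPowPeak_pos hN
      have h0 : 0 ≤ if n.Prime then 0 else Λ n := by
        split_ifs
        · exact le_rfl
        · exact vonMangoldt_nonneg
      rw [norm_mul, Real.norm_of_nonneg h0,
        Real.norm_of_nonneg (div_nonneg (logPowWeight_nonneg N n) hpk.le), div_eq_mul_inv _ (n : ℝ)]
      refine mul_le_mul_of_nonneg_left ?_ h0
      rcases eq_or_ne n 0 with rfl | hn
      · simp [logPowWeight]
      · rw [div_le_iff₀ hpk, mul_comm, ← div_eq_mul_inv]
        exact logPowWeight_le_div hN hn)
  rw [tsum_zero] at h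
  filter_upwards [h.eventually_le_const hε, eventually_ne_atTop 0] with N hN hN0
  have hpk := logPowPeak_pos hN0
  calc _ = (∑' n : ℕ, (if n.Prime then 0 else Λ n) * (logPowWeight N n / logPowPeak N)) *
        logPowPeak N := by
        rw [← tsum_mul_right]
        refine tsum_congr fun n ↦ ?_
        split_ifs
        · simp
        · field_simp
    _ ≤ _ := by gcongr

theorem vonMangoldt_mul_logPowWeight_le_of_prime {N p : ℕ} (hN : N ≠ 0) (hp : p.Prime) :
    Λ p * logPowWeight N p ≤ 2 * Real.exp (1 / 4 - N) * logPowPeak N := by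
  have hpk := logPowPeak_pos hN
  have hp1 : (1 : ℝ) ≤ p := by exact_mod_cast hp.one_le
  have hp0 : (0 : ℝ) < p := by linarith
  have h1 : Real.log p ≤ (p : ℝ) ^ (1 / 2 : ℝ) / (1 / 2) :=
    Real.log_le_rpow_div hp0.le (by norm_num)
  have h2 : (p : ℝ) ^ (1 / 2 : ℝ) * (p : ℝ) ^ (1 / 4 : ℝ) ≤ p := by
    rw [← Real.rpow_add hp0]
    calc (p : ℝ) ^ (1 / 2 + 1 / 4 : ℝ) ≤ (p : ℝ) ^ (1 : ℝ) :=
          Real.rpow_le_rpow_of_exponent_le hp1 (by norm_num)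
      _ = p := Real.rpow_one _
  rw [vonMangoldt_apply_prime hp]
  calc _ ≤ (p : ℝ) ^ (1 / 2 : ℝ) / (1 / 2) *
        (logPowPeak N * (Real.exp (1 / 4 - N) * (p : ℝ) ^ (1 / 4 : ℝ)) / p) :=
        mul_le_mul h1 (logPowWeight_le_exp_neg_mul hN hp.ne_zero) (logPowWeight_nonneg N p)
          (by positivity)
    _ = 2 * Real.exp (1 / 4 - N) * logPowPeak N *
        ((p : ℝ) ^ (1 / 2 : ℝ) * (p : ℝ) ^ (1 / 4 : ℝ) / p) := by ring
    _ ≤ 2 * Real.exp (1 / 4 - N) * logPowPeak N * 1 := by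
      gcongr
      exact (div_le_one hp0).2 h2
    _ = _ := mul_one _

open Filter Topology in
theorem eventually_tsum_not_prime_or_dvd_le {ε : ℝ} (hε : 0 < ε) (B : ℕ) :
    ∀ᶠ N in atTop, ∀ q : ℕ, q ≠ 0 → q.primeFactors.card ≤ B →
      ∑' n : ℕ, (if n.Prime ∧ ¬ n ∣ q then 0 else Λ n * logPowWeight N n) ≤ ε * logPowPeak N := by
  have h1 : Tendsto (fun N : ℕ ↦ B * (2 * Real.exp (1 / 4 - N))) atTop (𝓝 (B * (2 * 0))) := by
    refine Tendsto.const_mul _ (Tendsto.const_mul _ (Real.tendsto_exp_atBot.comp ?_))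
    exact tendsto_atBot_add_const_left _ _ (tendsto_neg_atTop_atBot.comp tendsto_natCast_atTop_atTop)
  rw [mul_zero, mul_zero] at h1
  filter_upwards [eventually_tsum_not_prime_le (half_pos hε), h1.eventually_le_const (half_pos hε),
    eventually_ge_atTop 2] with N hN1 hN2 hN q hq hqB
  have hN0 : N ≠ 0 := by lia
  have hpk := logPowPeak_pos hN0
  have hnn : ∀ n, 0 ≤ Λ n * logPowWeight N n := fun n ↦
    mul_nonneg vonMangoldt_nonneg (logPowWeight_nonneg N n)
  have hs := summable_vonMangoldt_mul_logPowWeight hN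
  have hs1 : Summable fun n : ℕ ↦ if n.Prime then 0 else Λ n * logPowWeight N n :=
    hs.of_nonneg_of_le (fun n ↦ by split_ifs <;> simp [hnn]) fun n ↦ by split_ifs <;> simp [hnn]
  have hs2 : Summable fun n : ℕ ↦ if n ∈ q.primeFactors then Λ n * logPowWeight N n else 0 :=
    hs.of_nonneg_of_le (fun n ↦ by split_ifs <;> simp [hnn]) fun n ↦ by split_ifs <;> simp [hnn]
  calc _ ≤ ∑' n : ℕ, ((if n.Prime then 0 else Λ n * logPowWeight N n) +
        if n ∈ q.primeFactors then Λ n * logPowWeight N n else 0) := by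
        refine Summable.tsum_le_tsum (fun n ↦ ?_) (hs.of_nonneg_of_le
          (fun n ↦ by split_ifs <;> simp [hnn]) fun n ↦ by split_ifs <;> simp [hnn]) (hs1.add hs2)
        by_cases h : n.Prime <;> by_cases h' : n ∣ q <;> simp [h, h', hq]
    _ = ∑' n : ℕ, (if n.Prime then 0 else Λ n * logPowWeight N n) +
        ∑ n ∈ q.primeFactors, Λ n * logPowWeight N n := by
      rw [hs1.tsum_add hs2]
      congr 1
      rw [tsum_eq_sum (s := q.primeFactors) fun n hn ↦ if_neg hn]
      exact Finset.sum_congr rfl fun n hn ↦ if_pos hn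
    _ ≤ ε / 2 * logPowPeak N + B * (2 * Real.exp (1 / 4 - N)) * logPowPeak N := by
      refine add_le_add hN1 ?_
      calc _ ≤ ∑ n ∈ q.primeFactors, 2 * Real.exp (1 / 4 - N) * logPowPeak N :=
            Finset.sum_le_sum fun n hn ↦
              vonMangoldt_mul_logPowWeight_le_of_prime hN0 (Nat.prime_of_mem_primeFactors hn)
        _ = q.primeFactors.card * (2 * Real.exp (1 / 4 - N) * logPowPeak N) := by
          rw [Finset.sum_const, nsmul_eq_mul]
        _ ≤ B * (2 * Real.exp (1 / 4 - N) * logPowPeak N) := by gcongr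
        _ = _ := by ring
    _ ≤ ε / 2 * logPowPeak N + ε / 2 * logPowPeak N := by gcongr
    _ = _ := by ring

end

section

open ArithmeticFunction

theorem summable_ite_vonMangoldt_mul_logPowWeight {N : ℕ} (hN : 2 ≤ N) (P : ℕ → Prop)
    [DecidablePred P] : Summable fun n ↦ if P n then 0 else Λ n * logPowWeight N n := by
  have hnn : ∀ n, 0 ≤ Λ n * logPowWeight N n := fun n ↦
    mul_nonneg vonMangoldt_nonneg (logPowWeight_nonneg N n)
  exact (summable_vonMangoldt_mul_logPowWeight hN).of_nonneg_of_le
    (fun n ↦ by split_ifs <;> simp [hnn]) fun n ↦ by split_ifs <;> simp [hnn]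

theorem summable_vonMangoldt_mul_logPowWeight_mul {N : ℕ} (hN : 2 ≤ N) {a : ℕ → ℂ} {C : ℝ}
    (ha : ∀ n, ‖a n‖ ≤ C) : Summable fun n ↦ ((Λ n * logPowWeight N n : ℝ) : ℂ) * a n := by
  have hnn : ∀ n, 0 ≤ Λ n * logPowWeight N n := fun n ↦
    mul_nonneg vonMangoldt_nonneg (logPowWeight_nonneg N n)
  refine Summable.of_norm_bounded ((summable_vonMangoldt_mul_logPowWeight hN).mul_right C)
    fun n ↦ ?_
  rw [norm_mul, Complex.norm_of_nonneg (hnn n)]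
  exact mul_le_mul_of_nonneg_left (ha n) (hnn n)

theorem norm_tsum_sub_tsum_le_of_eq_on_primes {N : ℕ} (hN : 2 ≤ N) (q : ℕ) {a b : ℕ → ℂ}
    (ha : ∀ n, ‖a n‖ ≤ 1) (hb : ∀ n, ‖b n‖ ≤ 1) (hab : ∀ n, ‖a n - b n‖ ≤ 1)
    (heq : ∀ n : ℕ, n.Prime → ¬ n ∣ q → a n = b n) :
    ‖∑' n, ((Λ n * logPowWeight N n : ℝ) : ℂ) * a n -
      ∑' n, ((Λ n * logPowWeight N n : ℝ) : ℂ) * b n‖ ≤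
      ∑' n : ℕ, (if n.Prime ∧ ¬ n ∣ q then 0 else Λ n * logPowWeight N n) := by
  have hnn : ∀ n, 0 ≤ Λ n * logPowWeight N n := fun n ↦
    mul_nonneg vonMangoldt_nonneg (logPowWeight_nonneg N n)
  rw [← (summable_vonMangoldt_mul_logPowWeight_mul hN ha).tsum_sub
    (summable_vonMangoldt_mul_logPowWeight_mul hN hb)]
  refine tsum_of_norm_bounded (summable_ite_vonMangoldt_mul_logPowWeight hN
    (fun n : ℕ ↦ n.Prime ∧ ¬ n ∣ q)).hasSum fun n ↦ ?_
  rw [← mul_sub, norm_mul, Complex.norm_of_nonneg (hnn n)]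
  split_ifs with h
  · rw [heq n h.1 h.2, sub_self, norm_zero, mul_zero]
  · exact mul_le_of_le_one_right (hnn n) (hab n)

namespace DirichletCharacter

/-- Under GRH, the weighted sum of `Λ(n) χ(n)` exhibits square root cancellation, uniformly over
all nontrivial characters `χ`. -/
theorem exists_norm_tsum_vonMangoldt_mul_le_of_GRH (hGRH : GRH) :
    ∃ C : ℝ, 0 ≤ C ∧ ∀ (q : ℕ) [NeZero q] (χ : DirichletCharacter ℂ q), χ ≠ 1 → ∀ N : ℕ, 2 ≤ N →
      ‖∑' n : ℕ, ((Λ n * logPowWeight N n : ℝ) : ℂ) * χ n‖ ≤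
        (∑' n : ℕ, (if n.Prime ∧ ¬ n ∣ q then 0 else Λ n * logPowWeight N n)) +
          C * (1 + Real.log q) * Real.exp (-(2 * N)) * logPowPeak N := by
  obtain ⟨C, hC, h⟩ := exists_norm_tsum_vonMangoldt_mul_le
  refine ⟨C * (2 * Real.exp 2), by positivity, fun q _ χ hχ N hN ↦ ?_⟩
  have hc0 : χ.conductor ≠ 0 := fun h0 ↦
    NeZero.ne q (Nat.eq_zero_of_zero_dvd (h0 ▸ χ.conductor_dvd_level))
  have : NeZero χ.conductor := ⟨hc0⟩
  have hne : χ.primitiveCharacter ≠ 1 := fun h1 ↦ hχ <| by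
    rw [← χ.changeLevel_primitiveCharacter, h1, changeLevel_one]
  have hprim := h χ.conductor χ.primitiveCharacter hne χ.primitiveCharacter_isPrimitive
    (fun s hs h0 ↦ by
      have := hGRH _ _ s h0 (by linarith)
      linarith) N hN
  have hcop : ∀ n : ℕ, n.Coprime q → χ n = χ.primitiveCharacter n := fun n hn ↦ by
    have := χ.primitiveCharacter_apply_of_isCoprime (a := n) (Nat.isCoprime_iff_coprime.2 hn)
    simpa using this.symm
  have hncop : ∀ n : ℕ, ¬ n.Coprime q → χ n = 0 := fun n hn ↦
    χ.map_nonunit fun hu ↦ hn ((ZMod.isUnit_iff_coprime n q).1 hu)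
  have hdiff := norm_tsum_sub_tsum_le_of_eq_on_primes hN q (a := fun n ↦ χ n)
    (b := fun n ↦ χ.primitiveCharacter n) (fun n ↦ norm_le_one χ _) (fun n ↦ norm_le_one _ _)
    (fun n ↦ by
      by_cases hn : n.Coprime q
      · simp [hcop n hn]
      · rw [hncop n hn, zero_sub, norm_neg]
        exact norm_le_one _ _)
    (fun n hn hd ↦ hcop n ((Nat.Prime.coprime_iff_not_dvd hn).2 hd))
  have hlog : Real.log χ.conductor ≤ Real.log q :=
    Real.log_le_log (by exact_mod_cast Nat.pos_of_ne_zero hc0)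
      (by exact_mod_cast Nat.le_of_dvd (NeZero.pos q) χ.conductor_dvd_level)
  have hlog0 : 0 ≤ Real.log q := Real.log_natCast_nonneg q
  have hfac := factorial_div_pow_le (by lia : N ≠ 0)
  calc _ ≤ _ := norm_le_norm_sub_add _ _
    _ ≤ _ := add_le_add hdiff hprim
    _ ≤ _ := by
      refine add_le_add le_rfl ?_
      calc _ ≤ C * (1 + Real.log q) * (2 * Real.exp 2 * Real.exp (-(2 * N)) * logPowPeak N) := by
            gcongr
        _ = _ := by ring

theorem norm_tsum_one_sub_tsum_le {q N : ℕ} (hN : 2 ≤ N) :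
    ‖∑' n : ℕ, ((Λ n * logPowWeight N n : ℝ) : ℂ) * (1 : DirichletCharacter ℂ q) n -
      ((∑' n, Λ n * logPowWeight N n : ℝ) : ℂ)‖ ≤
        ∑' n : ℕ, (if n.Prime ∧ ¬ n ∣ q then 0 else Λ n * logPowWeight N n) := by
  have hcop : ∀ n : ℕ, n.Coprime q → (1 : DirichletCharacter ℂ q) n = 1 := fun n hn ↦
    MulChar.one_apply ((ZMod.isUnit_iff_coprime n q).2 hn)
  have hncop : ∀ n : ℕ, ¬ n.Coprime q → (1 : DirichletCharacter ℂ q) n = 0 := fun n hn ↦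
    MulChar.map_nonunit _ fun hu ↦ hn ((ZMod.isUnit_iff_coprime n q).1 hu)
  have := norm_tsum_sub_tsum_le_of_eq_on_primes hN q (a := fun n ↦ (1 : DirichletCharacter ℂ q) n)
    (b := fun n ↦ 1) (fun n ↦ norm_le_one _ _) (fun n ↦ norm_one.le)
    (fun n ↦ by
      by_cases hn : n.Coprime q
      · rw [hcop n hn, sub_self, norm_zero]
        exact zero_le_one
      · rw [hncop n hn, zero_sub, norm_neg, norm_one])
    (fun n hn hd ↦ hcop n ((Nat.Prime.coprime_iff_not_dvd hn).2 hd))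
  simpa only [mul_one, ← Complex.ofReal_tsum] using this

variable {q : ℕ} {G : Type*} [CommGroup G]

/-- The Dirichlet character obtained by composing a character of a group `G` with a homomorphism
from `(ZMod q)ˣ` to `G`. -/
noncomputable def ofAddChar (Φ : (ZMod q)ˣ →* G) (ψ : AddChar (Additive G) ℂ) :
    DirichletCharacter ℂ q :=
  MulChar.ofUnitHom (MonoidHom.comp (MonoidHom.toHomUnits
    { toFun := fun g ↦ ψ (Additive.ofMul g)
      map_one' := ψ.map_zero_eq_one
      map_mul' := fun _ _ ↦ ψ.map_add_eq_mul _ _ }) Φ)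

theorem ofAddChar_coe (Φ : (ZMod q)ˣ →* G) (ψ : AddChar (Additive G) ℂ) (u : (ZMod q)ˣ) :
    ofAddChar Φ ψ u = ψ (Additive.ofMul (Φ u)) := by
  rw [ofAddChar, MulChar.ofUnitHom_coe]
  rfl

theorem ofAddChar_one (Φ : (ZMod q)ˣ →* G) : ofAddChar Φ 1 = 1 := by
  ext u
  rw [ofAddChar_coe, MulChar.one_apply_coe, AddChar.one_apply]

theorem ofAddChar_ne_one {Φ : (ZMod q)ˣ →* G} (hΦ : Function.Surjective Φ)
    {ψ : AddChar (Additive G) ℂ} (hψ : ψ ≠ 1) : ofAddChar Φ ψ ≠ 1 := by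
  refine fun h ↦ hψ (DFunLike.ext _ _ fun g ↦ ?_)
  obtain ⟨u, hu⟩ := hΦ g.toMul
  rw [AddChar.one_apply, ← ofMul_toMul g, ← hu, ← ofAddChar_coe, h, MulChar.one_apply_coe]

open Classical in
theorem sum_mul_ofAddChar [Fintype G] (Φ : (ZMod q)ˣ →* G) (g : G) (x : ZMod q) :
    ∑ ψ : AddChar (Additive G) ℂ, ψ (-Additive.ofMul g) * ofAddChar Φ ψ x =
      if ∃ u : (ZMod q)ˣ, (u : ZMod q) = x ∧ Φ u = g then (Fintype.card G : ℂ) else 0 := by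
  by_cases hx : IsUnit x
  · obtain ⟨u, rfl⟩ := hx
    simp only [ofAddChar_coe, ← AddChar.map_add_eq_mul]
    rw [AddChar.sum_apply_eq_ite]
    have h : -Additive.ofMul g + Additive.ofMul (Φ u) = 0 ↔
        ∃ v : (ZMod q)ˣ, (v : ZMod q) = u ∧ Φ v = g := by
      rw [neg_add_eq_zero]
      constructor
      · exact fun h ↦ ⟨u, rfl, (Additive.ofMul.injective h).symm⟩
      · rintro ⟨v, hv, rfl⟩
        rw [Units.ext hv]
    simp only [h, Fintype.card_additive]
  · rw [if_neg]
    · exact Finset.sum_eq_zero fun ψ _ ↦ by rw [MulChar.map_nonunit _ hx, mul_zero]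
    · rintro ⟨u, rfl, -⟩
      exact hx u.isUnit

end DirichletCharacter

end

section

open ArithmeticFunction

namespace DirichletCharacter

open Classical in
/-- Under GRH, primes are equidistributed among the fibres of a surjective homomorphism from
`(ZMod q)ˣ`, in weighted form. -/
theorem exists_tsum_le_card_mul_of_GRH (hGRH : GRH) :
    ∃ C : ℝ, 0 ≤ C ∧ ∀ (q : ℕ) [NeZero q] (G : Type) [CommGroup G] [Fintype G]
      (Φ : (ZMod q)ˣ →* G), Function.Surjective Φ → ∀ (g : G) (N : ℕ), 2 ≤ N →
        ∑' n, Λ n * logPowWeight N n ≤ Fintype.card G *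
          ((∑' n : ℕ, if ∃ u : (ZMod q)ˣ, (u : ZMod q) = n ∧ Φ u = g then
              Λ n * logPowWeight N n else 0) +
            (∑' n : ℕ, if n.Prime ∧ ¬ n ∣ q then 0 else Λ n * logPowWeight N n) +
            C * (1 + Real.log q) * Real.exp (-(2 * N)) * logPowPeak N) := by
  obtain ⟨C, hC, h⟩ := exists_norm_tsum_vonMangoldt_mul_le_of_GRH hGRH
  refine ⟨C, hC, fun q _ G _ _ Φ hΦ g N hN ↦ ?_⟩
  set β := ∑' n : ℕ, if n.Prime ∧ ¬ n ∣ q then 0 else Λ n * logPowWeight N n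
  set E := C * (1 + Real.log q) * Real.exp (-(2 * N)) * logPowPeak N with hE
  set S := ∑' n : ℕ, if ∃ u : (ZMod q)ˣ, (u : ZMod q) = n ∧ Φ u = g then
    Λ n * logPowWeight N n else 0 with hS
  set M := ∑' n, Λ n * logPowWeight N n
  set T : AddChar (Additive G) ℂ → ℂ := fun ψ ↦
    ∑' n : ℕ, ((Λ n * logPowWeight N n : ℝ) : ℂ) * ofAddChar Φ ψ n with hT
  have hE0 : 0 ≤ E := by
    have := Real.log_natCast_nonneg q
    have := (logPowPeak_pos (by lia : N ≠ 0)).le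
    positivity
  have hcard : Fintype.card (AddChar (Additive G) ℂ) = Fintype.card G := by
    rw [AddChar.card_eq, Fintype.card_additive]
  have hsum : ∑ ψ : AddChar (Additive G) ℂ, ψ (-Additive.ofMul g) * T ψ =
      ((Fintype.card G * S : ℝ) : ℂ) := by
    simp only [hT, ← tsum_mul_left]
    rw [← Summable.tsum_finsetSum fun ψ _ ↦ (summable_vonMangoldt_mul_logPowWeight_mul hN
      (fun n ↦ norm_le_one (ofAddChar Φ ψ) _)).mul_left _, hS, ← tsum_mul_left,
      Complex.ofReal_tsum]
    refine tsum_congr fun n ↦ ?_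
    simp only [mul_left_comm (_ : ℂ) ((Λ n * logPowWeight N n : ℝ) : ℂ)]
    rw [← Finset.mul_sum, sum_mul_ofAddChar]
    split_ifs <;> push_cast <;> ring
  have h1 : ‖T 1 - M‖ ≤ β := by
    simp only [hT, ofAddChar_one]
    exact norm_tsum_one_sub_tsum_le hN
  have hβ : 0 ≤ β := (norm_nonneg _).trans h1
  have hrest : ‖∑ ψ ∈ Finset.univ.erase (1 : AddChar (Additive G) ℂ),
      ψ (-Additive.ofMul g) * T ψ‖ ≤ (Fintype.card G - 1 : ℝ) * (β + E) := by
    refine (norm_sum_le _ _).trans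
      ((Finset.sum_le_card_nsmul _ _ (β + E) fun ψ hψ ↦ ?_).trans_eq ?_)
    · rw [norm_mul, AddChar.norm_apply, one_mul]
      exact h q _ (ofAddChar_ne_one hΦ (Finset.ne_of_mem_erase hψ)) N hN
    · rw [Finset.card_erase_of_mem (Finset.mem_univ _), Finset.card_univ, hcard,
        nsmul_eq_mul, Nat.cast_pred Fintype.card_pos]
  have hM : (M : ℂ) = ((Fintype.card G * S : ℝ) : ℂ) - (T 1 - M) -
      ∑ ψ ∈ Finset.univ.erase (1 : AddChar (Additive G) ℂ), ψ (-Additive.ofMul g) * T ψ := by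
    rw [← hsum, ← Finset.add_sum_erase _ _ (Finset.mem_univ (1 : AddChar (Additive G) ℂ)),
      AddChar.one_apply]
    ring
  have hre := congrArg Complex.re hM
  simp only [Complex.sub_re, Complex.ofReal_re] at hre
  have h2 := (Complex.abs_re_le_norm _).trans h1
  have h3 := (Complex.abs_re_le_norm _).trans hrest
  rw [Complex.sub_re, Complex.ofReal_re] at h2
  have h4 := neg_abs_le ((T 1).re - M)
  have h5 := neg_abs_le (∑ ψ ∈ Finset.univ.erase (1 : AddChar (Additive G) ℂ),
      ψ (-Additive.ofMul g) * T ψ).re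
  nlinarith

open Classical in
theorem tsum_ite_le_of_forall_lt {q : ℕ} {G : Type} [CommGroup G] (Φ : (ZMod q)ˣ →* G) (g : G)
    {N X : ℕ} (hN : 2 ≤ N)
    (hX : ∀ l : ℕ, l.Prime → (∃ u : (ZMod q)ˣ, (u : ZMod q) = l ∧ Φ u = g) → X < l) :
    ∑' n : ℕ, (if ∃ u : (ZMod q)ˣ, (u : ZMod q) = n ∧ Φ u = g then
        Λ n * logPowWeight N n else 0) ≤
      (∑' n : ℕ, if n.Prime ∧ ¬ n ∣ q then 0 else Λ n * logPowWeight N n) +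
        ∑' n, if X < n then Λ n * logPowWeight N n else 0 := by
  have hnn : ∀ n, 0 ≤ Λ n * logPowWeight N n := fun n ↦
    mul_nonneg vonMangoldt_nonneg (logPowWeight_nonneg N n)
  have hs (P : ℕ → Prop) : Summable fun n ↦ if P n then Λ n * logPowWeight N n else 0 := by
    simpa only [ite_not] using summable_ite_vonMangoldt_mul_logPowWeight hN fun n ↦ ¬ P n
  have hs' := summable_ite_vonMangoldt_mul_logPowWeight hN fun n ↦ n.Prime ∧ ¬ n ∣ q
  have hsX : Summable fun n ↦ if X < n then Λ n * logPowWeight N n else 0 := by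
    convert hs fun n ↦ X < n
  rw [← hs'.tsum_add hsX]
  refine (hs _).tsum_le_tsum (fun n ↦ ?_) (hs'.add hsX)
  have := hnn n
  have := hX n
  split_ifs <;> grind

/-- Under GRH, the least prime in a fibre of a surjective homomorphism from `(ZMod q)ˣ` to a group
of bounded order is `O((log q)²)`, as long as `q` has boundedly many prime factors. -/
theorem exists_prime_le_of_GRH (hGRH : GRH) (B : ℕ) :
    ∃ C : ℝ, ∀ (q : ℕ) [NeZero q] (G : Type) [CommGroup G] [Fintype G] (Φ : (ZMod q)ˣ →* G),
      Function.Surjective Φ → Fintype.card G ≤ B → q.primeFactors.card ≤ B → ∀ g : G,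
        ∃ l : ℕ, l.Prime ∧ (∃ u : (ZMod q)ˣ, (u : ZMod q) = l ∧ Φ u = g) ∧
          (l : ℝ) ≤ C * (1 + Real.log q) ^ 2 := by
  obtain ⟨A, hA, hsum⟩ := exists_tsum_le_card_mul_of_GRH hGRH
  obtain ⟨c, hc, hmain⟩ := exists_le_tsum_vonMangoldt_mul_logPowWeight
  set b : ℝ := B + 1 with hb
  have hb0 : 0 < b := by positivity
  obtain ⟨N₁, hN₁⟩ := Filter.eventually_atTop.1
    (eventually_tsum_not_prime_or_dvd_le (ε := c / (8 * b)) (by positivity) B)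
  set N₀ := N₁ + 2
  set K := 1 + 4 * b * A / c with hK
  have hK1 : 1 ≤ K := by simp only [hK, le_add_iff_nonneg_right]; positivity
  set t := 3 * (Real.log 4 + 4) * Real.exp 8 with ht
  have ht0 : 0 < t := by
    have := Real.log_pos (by norm_num : (1 : ℝ) < 4)
    positivity
  set D := 4 * b * t / c with hD
  have hD0 : 0 < D := by positivity
  refine ⟨D * (Real.exp (4 * N₀ + 4) * K ^ 2) + 1, fun q _ G _ _ Φ hΦ hG hq g ↦ ?_⟩
  set L := 1 + Real.log q with hL
  have hL1 : 1 ≤ L := by simp only [hL, le_add_iff_nonneg_right]; exact Real.log_natCast_nonneg q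
  set r := ⌈Real.log (K * L) / 2⌉₊ with hr
  set N := N₀ + r with hN
  have hKL : 1 ≤ K * L := one_le_mul_of_one_le_of_one_le hK1 hL1
  have hKL0 : 0 < K * L := by positivity
  have hr1 : Real.log (K * L) / 2 ≤ r := Nat.le_ceil _
  have hr2 : (r : ℝ) < Real.log (K * L) / 2 + 1 :=
    Nat.ceil_lt_add_one (by have := Real.log_nonneg hKL; positivity)
  have hN2 : 2 ≤ N := by lia
  have hlow : K * L ≤ Real.exp (2 * N) := by
    rw [← Real.log_le_iff_le_exp hKL0, hN]
    push_cast
    linarith [N₀.cast_nonneg (α := ℝ)]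
  have hupp : Real.exp (4 * N) ≤ Real.exp (4 * N₀ + 4) * (K * L) ^ 2 := by
    have : (K * L) ^ 2 = Real.exp (2 * Real.log (K * L)) := by
      rw [two_mul, Real.exp_add, Real.exp_log hKL0, sq]
    rw [this, ← Real.exp_add, Real.exp_le_exp, hN]
    push_cast
    linarith
  set X := ⌈D * Real.exp (4 * N)⌉₊ with hX
  have hX1 : D * Real.exp (4 * N) ≤ X := Nat.le_ceil _
  have hX0 : (0 : ℝ) < X := lt_of_lt_of_le (by positivity) hX1
  have hX2 : (X : ℝ) ≤ D * Real.exp (4 * N) + 1 := (Nat.ceil_lt_add_one (by positivity)).le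
  by_contra! hcon
  have hlt : ∀ l : ℕ, l.Prime → (∃ u : (ZMod q)ˣ, (u : ZMod q) = l ∧ Φ u = g) → X < l :=
    fun l hl hu ↦ by
      have h1 := hcon l hl hu
      have h2 : D * Real.exp (4 * N) ≤ D * (Real.exp (4 * N₀ + 4) * (K * L) ^ 2) := by gcongr
      have h3 : 1 ≤ L ^ 2 := one_le_pow₀ hL1
      exact_mod_cast (by linarith : (X : ℝ) < l)
  have hH := logPowPeak_pos (by lia : N ≠ 0)
  have e1 := hsum q G Φ hΦ g N hN2
  have e2 := tsum_ite_le_of_forall_lt Φ g hN2 hlt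
  have e3 := tsum_tail_vonMangoldt_mul_logPowWeight_le hN2 (by exact_mod_cast hX0.ne' : X ≠ 0)
  have e4 := hN₁ N (by lia) q (NeZero.ne q) hq
  have e5 := hmain N hN2
  have e6 : b * (A * L * Real.exp (-(2 * N))) ≤ c / 4 := by
    rw [Real.exp_neg, ← div_eq_mul_inv, ← mul_div_assoc, div_le_iff₀ (Real.exp_pos _)]
    have h1 : c / 4 * (K * L) = c / 4 * L + b * (A * L) := by
      rw [hK]
      field_simp
    have h2 : c / 4 * (K * L) ≤ c / 4 * Real.exp (2 * N) := by gcongr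
    have h3 : 0 ≤ c / 4 * L := by positivity
    linarith
  have e7 : b * (t * Real.exp (4 * N) / X) ≤ c / 4 := by
    rw [← mul_div_assoc, div_le_iff₀ hX0]
    have : b * (t * Real.exp (4 * N)) = c / 4 * (D * Real.exp (4 * N)) := by
      rw [hD]
      field_simp
    rw [this]
    gcongr
  have hGb : (Fintype.card G : ℝ) ≤ b := by
    have : (Fintype.card G : ℝ) ≤ B := by exact_mod_cast hG
    linarith
  have hAL : 0 ≤ A * L * Real.exp (-(2 * N)) := by positivity
  have htX : 0 ≤ t * Real.exp (4 * N) / X := by positivity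
  have : c * logPowPeak N ≤ (3 / 4 * c) * logPowPeak N := by
    calc _ ≤ _ := e5.trans e1
      _ ≤ Fintype.card G * ((c / (8 * b) * logPowPeak N + t * Real.exp (4 * N) / X * logPowPeak N) +
          c / (8 * b) * logPowPeak N + A * L * Real.exp (-(2 * N)) * logPowPeak N) := by
        gcongr
        convert e2.trans (add_le_add e4 e3)
      _ = Fintype.card G * (c / (4 * b) + t * Real.exp (4 * N) / X +
          A * L * Real.exp (-(2 * N))) * logPowPeak N := by
        field_simp
        ring
      _ ≤ b * (c / (4 * b) + t * Real.exp (4 * N) / X +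
          A * L * Real.exp (-(2 * N))) * logPowPeak N := by
        gcongr
      _ ≤ (3 / 4 * c) * logPowPeak N := by
        refine mul_le_mul_of_nonneg_right ?_ hH.le
        have : b * (c / (4 * b)) = c / 4 := by field_simp
        linarith
  have := mul_pos hc hH
  linarith

end DirichletCharacter

end

/-- Reduction modulo `n` together with the quadratic characters modulo `p i`, as a homomorphism on
`(ZMod (n * ∏ i, p i))ˣ`. -/
noncomputable def ZMod.unitsMapProdQuadraticChar (n : ℕ) {ι : Type} [Fintype ι] (p : ι → ℕ)
    [∀ i, Fact (p i).Prime] : (ZMod (n * ∏ i, p i))ˣ →* (ZMod n)ˣ × (ι → ℤˣ) :=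
  (ZMod.unitsMap (Nat.dvd_mul_right _ _)).prod (MonoidHom.pi fun i ↦
    (quadraticChar (ZMod (p i))).toUnitHom.comp
      (ZMod.unitsMap ((Finset.dvd_prod_of_mem p (Finset.mem_univ i)).trans
        (Nat.dvd_mul_left _ _))))

section

variable {n : ℕ} {ι : Type} [Fintype ι] {p : ι → ℕ} [∀ i, Fact (p i).Prime]

theorem ZMod.unitsMapProdQuadraticChar_fst {u : (ZMod (n * ∏ i, p i))ˣ} {l : ℕ}
    (hu : (u : ZMod (n * ∏ i, p i)) = l) :
    ((unitsMapProdQuadraticChar n p u).1 : ZMod n) = l := by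
  simp only [unitsMapProdQuadraticChar, MonoidHom.prod_apply, ZMod.unitsMap_val, hu]
  exact ZMod.cast_natCast (Nat.dvd_mul_right _ _) l

theorem ZMod.unitsMapProdQuadraticChar_snd {u : (ZMod (n * ∏ i, p i))ˣ} {l : ℕ}
    (hu : (u : ZMod (n * ∏ i, p i)) = l) (i : ι) :
    ((unitsMapProdQuadraticChar n p u).2 i : ℤ) = legendreSym (p i) l := by
  have hd : p i ∣ n * ∏ i, p i := (Finset.dvd_prod_of_mem p (Finset.mem_univ i)).trans
    (Nat.dvd_mul_left _ _)
  change (((quadraticChar (ZMod (p i))).toUnitHom (ZMod.unitsMap hd u) : ℤˣ) : ℤ) = _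
  rw [MulChar.coe_toUnitHom, ZMod.unitsMap_val, hu, ZMod.cast_natCast hd, legendreSym,
    Int.cast_natCast]

theorem exists_legendreSym_eq (q : ℕ) [Fact q.Prime] (hq : q ≠ 2) (ε : ℤˣ) :
    ∃ x : ℕ, legendreSym q x = ε := by
  obtain rfl | rfl := Int.units_eq_one_or ε
  · exact ⟨1, by simp⟩
  · obtain ⟨a, ha⟩ := quadraticChar_exists_neg_one (F := ZMod q) (by rwa [ZMod.ringChar_zmod_n])
    exact ⟨a.val, by simpa [legendreSym] using ha⟩

theorem ZMod.unitsMapProdQuadraticChar_surjective (hp2 : ∀ i, p i ≠ 2)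
    (hp : Function.Injective p) (hpn : ∀ i, ¬ p i ∣ n) [NeZero n] :
    Function.Surjective (unitsMapProdQuadraticChar n p) := by
  rintro ⟨v, s⟩
  choose x hx using fun i ↦ exists_legendreSym_eq (p i) (hp2 i) (s i)
  obtain ⟨y, hy⟩ := Nat.chineseRemainderOfFinset x p Finset.univ
    (fun i _ ↦ (Fact.out : (p i).Prime).ne_zero)
    fun i _ j _ hij ↦ (Nat.coprime_primes Fact.out Fact.out).2 (hp.ne hij)
  have hcop : n.Coprime (∏ i, p i) := Nat.Coprime.prod_right fun i _ ↦
    ((Nat.Prime.coprime_iff_not_dvd Fact.out).2 (hpn i)).symm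
  obtain ⟨z, hz1, hz2⟩ := Nat.chineseRemainder hcop (v : ZMod n).val y
  have hzp : ∀ i, legendreSym (p i) z = s i := fun i ↦ by
    rw [← hx i]
    have : z ≡ x i [MOD p i] :=
      (hz2.of_dvd (Finset.dvd_prod_of_mem p (Finset.mem_univ i))).trans (hy i (Finset.mem_univ i))
    rw [legendreSym, legendreSym, Int.cast_natCast, Int.cast_natCast,
      (ZMod.natCast_eq_natCast_iff _ _ _).2 this]
  have hzn : (z : ZMod n) = v := by
    rw [(ZMod.natCast_eq_natCast_iff _ _ _).2 hz1, ZMod.natCast_zmod_val]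
  have hzc : z.Coprime (n * ∏ i, p i) := by
    refine Nat.Coprime.mul_right ((ZMod.isUnit_iff_coprime z n).1 (hzn ▸ v.isUnit))
      (Nat.Coprime.prod_right fun i _ ↦ ?_)
    refine ((Nat.Prime.coprime_iff_not_dvd Fact.out).2 fun hd ↦ (s i).ne_zero ?_).symm
    rw [← hzp i, legendreSym.eq_zero_iff, Int.cast_natCast]
    exact (ZMod.natCast_eq_zero_iff _ _).2 hd
  refine ⟨ZMod.unitOfCoprime z hzc, Prod.ext (Units.ext ?_) (funext fun i ↦ Units.ext ?_)⟩
  · rw [unitsMapProdQuadraticChar_fst (ZMod.coe_unitOfCoprime z hzc), hzn]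
  · rw [unitsMapProdQuadraticChar_snd (ZMod.coe_unitOfCoprime z hzc), hzp]

end

/-- Quadratic reciprocity, with the sign expressed through the residue of `l` modulo `4`. -/
theorem legendreSym_eq_of_mod_four_eq {l q r : ℕ} [Fact l.Prime] [Fact q.Prime] (hl : l ≠ 2)
    (hq : q ≠ 2) (hlr : l % 4 = r % 4) :
    legendreSym l q = (-1) ^ (q / 2 * (r / 2)) * legendreSym q l := by
  rw [legendreSym.quadratic_reciprocity' hq hl]
  congr 1
  have : l / 2 % 2 = r / 2 % 2 := by lia
  rw [mul_comm, pow_mul, mul_comm, pow_mul, neg_one_pow_eq_pow_mod_two (n := l / 2),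
    neg_one_pow_eq_pow_mod_two (n := r / 2), this]

/-- The effective form of the theorem: the least prime `l ≡ r (mod 4m)` with prescribed Legendre
symbols `(l / p i)` is `O((log ∏ i, p i)²)`. -/
theorem exists_prime_legendreSym_le_of_GRH (hGRH : GRH) (k n : ℕ) (hk : 0 < k) (hn : 0 < n) :
    ∃ c : ℝ, ∀ p : Fin k → ℕ, ∀ [∀ i, Fact (p i).Prime], (∀ i, p i ≠ 2) → Function.Injective p →
      (∀ i, ¬ p i ∣ n) → ∀ (s : Fin k → ℤˣ) (v : (ZMod n)ˣ),
        ∃ l : ℕ, l.Prime ∧ (l : ZMod n) = v ∧ (∀ i, legendreSym (p i) l = s i) ∧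
          (l : ℝ) ≤ c * Real.log (∏ i, (p i : ℝ)) ^ 2 := by
  have : NeZero n := ⟨hn.ne'⟩
  obtain ⟨C, hC⟩ := DirichletCharacter.exists_prime_le_of_GRH hGRH (n * 2 ^ k + n + k)
  refine ⟨|C| * (2 + Real.log n) ^ 2, fun p _ hp2 hp hpn s v ↦ ?_⟩
  have hpos : ∀ i, 0 < p i := fun i ↦ (Fact.out : (p i).Prime).pos
  have hP0 : ∏ i, p i ≠ 0 := Finset.prod_ne_zero_iff.2 fun i _ ↦ (hpos i).ne'
  have : NeZero (n * ∏ i, p i) := ⟨mul_ne_zero hn.ne' hP0⟩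
  have hcard : Fintype.card ((ZMod n)ˣ × (Fin k → ℤˣ)) ≤ n * 2 ^ k + n + k := by
    have h1 : Fintype.card (ZMod n)ˣ ≤ n := by
      rw [ZMod.card_units_eq_totient]
      exact n.totient_le
    have h2 : Fintype.card (Fin k → ℤˣ) = 2 ^ k := by simp
    rw [Fintype.card_prod, h2]
    nlinarith [Nat.mul_le_mul_right (2 ^ k) h1]
  have hprimes : (n * ∏ i, p i).primeFactors.card ≤ n * 2 ^ k + n + k := by
    rw [Nat.primeFactors_mul hn.ne' hP0]
    refine (Finset.card_union_le _ _).trans ?_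
    have h1 : n.primeFactors.card ≤ n := by
      refine (Finset.card_le_card (t := Finset.Icc 1 n) fun x hx ↦ ?_).trans (by simp)
      exact Finset.mem_Icc.2 ⟨Nat.pos_of_mem_primeFactors hx, Nat.le_of_mem_primeFactors hx⟩
    have h2 : (∏ i, p i).primeFactors.card ≤ k := by
      refine (Finset.card_le_card (t := Finset.univ.image p) fun x hx ↦ ?_).trans
        (Finset.card_image_le.trans (by simp))
      have hxp := Nat.prime_of_mem_primeFactors hx
      obtain ⟨i, hi, hxi⟩ := (hxp.prime.dvd_finsetProd_iff _).1 (Nat.dvd_of_mem_primeFactors hx)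
      exact Finset.mem_image.2 ⟨i, hi, ((Nat.prime_dvd_prime_iff_eq hxp Fact.out).1 hxi).symm⟩
    lia
  obtain ⟨l, hl, ⟨u, hu, hΦ⟩, hle⟩ := hC _ _ _
    (ZMod.unitsMapProdQuadraticChar_surjective hp2 hp hpn) hcard hprimes (v, s)
  refine ⟨l, hl, ?_, fun i ↦ ?_, hle.trans ?_⟩
  · rw [← ZMod.unitsMapProdQuadraticChar_fst hu, hΦ]
  · rw [← ZMod.unitsMapProdQuadraticChar_snd hu, hΦ]
  · have hn1 : 0 ≤ Real.log n := Real.log_natCast_nonneg n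
    have hlog : 1 ≤ Real.log (∏ i, (p i : ℝ)) := by
      rw [Real.le_log_iff_exp_le (Finset.prod_pos fun i _ ↦ by exact_mod_cast hpos i)]
      have h3 : 3 ≤ ∏ i, p i := by
        have h0 : 3 ≤ p ⟨0, hk⟩ := by
          have := (Fact.out : (p ⟨0, hk⟩).Prime).two_le
          have := hp2 ⟨0, hk⟩
          lia
        exact h0.trans (Nat.le_of_dvd (Nat.pos_of_ne_zero hP0)
          (Finset.dvd_prod_of_mem p (Finset.mem_univ _)))
      have h3' : (3 : ℝ) ≤ ∏ i, (p i : ℝ) := by exact_mod_cast h3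
      linarith [Real.exp_one_lt_d9]
    have hlogq : Real.log ((n * ∏ i, p i : ℕ) : ℝ) =
        Real.log n + Real.log (∏ i, (p i : ℝ)) := by
      push_cast
      rw [Real.log_mul (by exact_mod_cast hn.ne') (by exact_mod_cast hP0)]
    have hbound : 1 + Real.log ((n * ∏ i, p i : ℕ) : ℝ) ≤
        (2 + Real.log n) * Real.log (∏ i, (p i : ℝ)) := by
      rw [hlogq]
      nlinarith
    have h0 : 0 ≤ 1 + Real.log ((n * ∏ i, p i : ℕ) : ℝ) := by
      have := Real.log_natCast_nonneg (n * ∏ i, p i)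
      positivity
    calc _ ≤ |C| * (1 + Real.log ((n * ∏ i, p i : ℕ) : ℝ)) ^ 2 := by
          gcongr
          exact le_abs_self C
      _ ≤ |C| * ((2 + Real.log n) * Real.log (∏ i, (p i : ℝ))) ^ 2 := by gcongr
      _ = _ := by ring

/-- Given positive integers `k` and `m`, assuming GRH, there is a constant `c` depending
only on `m` and `k` such that for any pairwise distinct odd primes `p₁, …, p_k` none
dividing `m`, any signs `ε₁, …, ε_k ∈ {±1}`, and any integer `a` coprime to `m`, there is
an odd prime `l ≤ c·log²(p₁⋯p_k)` with `(pᵢ/l) = εᵢ` for all `i` and `l ≡ a (mod m)`. -/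
theorem stmt_17 (k m : ℕ) (hk : 0 < k) (hm : 0 < m) (hGRH : GRH) :
    ∃ c : ℝ, ∀ (p : Fin k → ℕ), (∀ i, (p i).Prime) → (∀ i, p i ≠ 2) →
      Function.Injective p → (∀ i, ¬ p i ∣ m) →
      ∀ ε : Fin k → ℤ, (∀ i, ε i = 1 ∨ ε i = -1) →
      ∀ a : ℤ, IsCoprime a (m : ℤ) →
      ∃ l : ℕ, ∃ hl : l.Prime, l ≠ 2 ∧
        (∀ i, @legendreSym l ⟨hl⟩ (p i) = ε i) ∧
        ((l : ZMod m) = (a : ZMod m)) ∧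
        (l : ℝ) ≤ c * Real.log (∏ i, (p i : ℝ)) ^ 2 := by
  obtain ⟨c, hc⟩ := exists_prime_legendreSym_le_of_GRH hGRH k (4 * m) hk (by lia)
  refine ⟨c, fun p hp hp2 hpi hpm ε hε a ha ↦ ?_⟩
  have : ∀ i, Fact (p i).Prime := fun i ↦ ⟨hp i⟩
  have : NeZero (4 * m) := ⟨by lia⟩
  have hpn : ∀ i, ¬ p i ∣ 4 * m := fun i hd ↦ by
    rcases (hp i).dvd_mul.1 hd with h | h
    · exact hp2 i ((Nat.prime_dvd_prime_iff_eq (hp i) Nat.prime_two).1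
        ((hp i).dvd_of_dvd_pow (n := 2) h))
    · exact hpm i h
  have hdvd : m ∣ 4 * m := Nat.dvd_mul_left _ _
  obtain ⟨v, hv⟩ := ZMod.unitsMap_surjective hdvd (ZMod.unitOfIsCoprime a ha)
  have he : ∀ i, ∃ e : ℤˣ, (e : ℤ) = ε i := fun i ↦ by
    rcases hε i with h | h
    · exact ⟨1, by simp [h]⟩
    · exact ⟨-1, by simp [h]⟩
  choose e he using he
  set r := (v : ZMod (4 * m)).val
  obtain ⟨l, hl, hlv, hls, hle⟩ := hc p hp2 hpi hpn
    (fun i ↦ (-1) ^ (p i / 2 * (r / 2)) * e i) v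
  have hlr : l ≡ r [MOD 4 * m] := by
    rw [← ZMod.natCast_eq_natCast_iff, hlv, ZMod.natCast_zmod_val]
  have hl2 : l ≠ 2 := by
    rintro rfl
    have := (ZMod.isUnit_iff_coprime 2 (4 * m)).1 (hlv ▸ v.isUnit)
    rw [Nat.coprime_two_left] at this
    grind
  refine ⟨l, hl, hl2, fun i ↦ ?_, ?_, hle⟩
  · have : Fact l.Prime := ⟨hl⟩
    rw [legendreSym_eq_of_mod_four_eq hl2 (hp2 i) (hlr.of_mul_right m), hls i, ← he i]
    push_cast
    rw [← mul_assoc, ← mul_pow]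
    simp
  · have h1 := congrArg (fun u : (ZMod m)ˣ ↦ (u : ZMod m)) hv
    simp only [ZMod.unitsMap_val, ZMod.coe_unitOfIsCoprime] at h1
    rw [← h1, ← hlv, ZMod.cast_natCast hdvd]
end
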